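/- For every ε₀ ∈ (0,1) there exists a constant C > 0 (depending only on ε₀ and on γ) such that for every positive integer m which is a sum of two squares and satisfies |τ̂_m(4)| ≤ 1 − ε₀, one has |Var(Z) − (4·B_C(E) − L²) · m/N| ≤ C · m / N^{3/2}, where B_C(E) = ∫₀ᴸ∫₀ᴸ N^{-1} Σ_{μ∈E} ⟨μ/‖μ‖, γ'(t₁)⟩² · ⟨μ/‖μ‖, γ'(t₂)⟩² dt₁ dt₂. -/

import Mathlib

open MeasureTheory ProbabilityTheory Real

noncomputable section

/-- The set of lattice points on the circle of radius `√m`: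
`E = {μ ∈ ℤ² : μ₁² + μ₂² = m}` (all solutions satisfy `|μᵢ| ≤ m`). -/
def latticeSet (m : ℕ) : Finset (ℤ × ℤ) :=
  (Finset.Icc (-(m : ℤ)) (m : ℤ) ×ˢ Finset.Icc (-(m : ℤ)) (m : ℤ)).filter
    (fun μ => μ.1 ^ 2 + μ.2 ^ 2 = (m : ℤ))

/-- `N = #E`, the number of lattice points on the circle of radius `√m`. -/
def latN (m : ℕ) : ℕ := (latticeSet m).card

/-- The probability space of the arithmetic random wave: `ℝ^E × ℝ^E`. -/
abbrev WaveSpace (m : ℕ) : Type :=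
  (↥(latticeSet m) → ℝ) × (↥(latticeSet m) → ℝ)

/-- The Gaussian probability measure of the arithmetic random wave: the product of
standard Gaussian measures on `ℝ^E × ℝ^E`. -/
def waveMeasure (m : ℕ) : Measure (WaveSpace m) :=
  (Measure.pi fun _ : ↥(latticeSet m) => gaussianReal 0 1).prod
    (Measure.pi fun _ : ↥(latticeSet m) => gaussianReal 0 1)

/-- The arithmetic random wave
`F(x) = N^{-1/2} ∑_{μ ∈ E} (b_μ cos(2π⟨μ,x⟩) + c_μ sin(2π⟨μ,x⟩))`. -/
def wave (m : ℕ) (ω : WaveSpace m) (x : ℝ × ℝ) : ℝ :=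
  (Real.sqrt (latN m))⁻¹ *
    ∑ μ : ↥(latticeSet m),
      (ω.1 μ * Real.cos (2 * π * (((μ : ℤ × ℤ).1 : ℝ) * x.1 + ((μ : ℤ × ℤ).2 : ℝ) * x.2)) +
       ω.2 μ * Real.sin (2 * π * (((μ : ℤ × ℤ).1 : ℝ) * x.1 + ((μ : ℤ × ℤ).2 : ℝ) * x.2)))

/-- The number of nodal intersections of the wave with the curve `γ` on `[0, L]`. -/
def nodalCount (m : ℕ) (γ : ℝ → ℝ × ℝ) (L : ℝ) (ω : WaveSpace m) : ℕ :=
  Set.ncard {t : ℝ | t ∈ Set.Icc 0 L ∧ wave m ω (γ t) = 0}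

/-- The fourth Fourier coefficient of the angular measure:
`τ̂_m(4) = (N m²)⁻¹ ∑_{μ ∈ E} (μ₁⁴ − 6 μ₁² μ₂² + μ₂⁴)`. -/
def tauHat4 (m : ℕ) : ℝ :=
  ((latN m : ℝ) * (m : ℝ) ^ 2)⁻¹ *
    ∑ μ ∈ latticeSet m,
      ((μ.1 : ℝ) ^ 4 - 6 * (μ.1 : ℝ) ^ 2 * (μ.2 : ℝ) ^ 2 + (μ.2 : ℝ) ^ 4)

/-- The constant
`B_𝒞(E) = ∫₀ᴸ∫₀ᴸ N⁻¹ ∑_{μ ∈ E} ⟨μ/‖μ‖, γ'(t₁)⟩² ⟨μ/‖μ‖, γ'(t₂)⟩² dt₁ dt₂`. -/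
def Bconst (m : ℕ) (γ : ℝ → ℝ × ℝ) (L : ℝ) : ℝ :=
  ∫ t₁ in (0:ℝ)..L, ∫ t₂ in (0:ℝ)..L,
    ((latN m : ℝ))⁻¹ *
      ∑ μ ∈ latticeSet m,
        (((μ.1 : ℝ) / Real.sqrt ((μ.1 : ℝ) ^ 2 + (μ.2 : ℝ) ^ 2) * (deriv γ t₁).1 +
          (μ.2 : ℝ) / Real.sqrt ((μ.1 : ℝ) ^ 2 + (μ.2 : ℝ) ^ 2) * (deriv γ t₁).2) ^ 2 *
         ((μ.1 : ℝ) / Real.sqrt ((μ.1 : ℝ) ^ 2 + (μ.2 : ℝ) ^ 2) * (deriv γ t₂).1 +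
          (μ.2 : ℝ) / Real.sqrt ((μ.1 : ℝ) ^ 2 + (μ.2 : ℝ) ^ 2) * (deriv γ t₂).2) ^ 2)

theorem mem_latticeSet {m : ℕ} {μ : ℤ × ℤ} :
    μ ∈ latticeSet m ↔ μ.1 ^ 2 + μ.2 ^ 2 = (m : ℤ) := by
  simp only [latticeSet, Finset.mem_filter, Finset.mem_product, Finset.mem_Icc, and_iff_right_iff_imp]
  intro h
  have h1 : μ.1 ^ 2 ≤ (m : ℤ) := by nlinarith [sq_nonneg μ.2]
  have h2 : μ.2 ^ 2 ≤ (m : ℤ) := by nlinarith [sq_nonneg μ.1]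
  have key : ∀ x : ℤ, x ^ 2 ≤ (m : ℤ) → -(m : ℤ) ≤ x ∧ x ≤ m := by
    intro x hx
    exact abs_le.1 (by nlinarith [sq_abs x, abs_nonneg x, Int.le_self_sq |x|])
  exact ⟨key _ h1, key _ h2⟩

/-- The square of the Euclidean length of an integer vector. -/
def normSq (v : ℤ × ℤ) : ℤ := v.1 ^ 2 + v.2 ^ 2

theorem normSq_nonneg (v : ℤ × ℤ) : 0 ≤ normSq v := by
  unfold normSq; positivity

theorem normSq_eq_zero {v : ℤ × ℤ} : normSq v = 0 ↔ v = 0 := by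
  unfold normSq
  constructor
  · intro h
    have h1 : v.1 = 0 := by nlinarith [sq_nonneg v.1, sq_nonneg v.2]
    have h2 : v.2 = 0 := by nlinarith [sq_nonneg v.1, sq_nonneg v.2]
    exact Prod.ext h1 h2
  · rintro rfl; simp

/-- Twice the signed area of a triangle. -/
def triDet (A B C : ℤ × ℤ) : ℤ :=
  (B.1 - A.1) * (C.2 - A.2) - (B.2 - A.2) * (C.1 - A.1)

/-- For a triangle inscribed in a circle of radius `R`, the product of the sides is
`4 R` times the area. -/
theorem prod_normSq_eq {m : ℕ} {A B C : ℤ × ℤ} (hA : A ∈ latticeSet m) (hB : B ∈ latticeSet m)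
    (hC : C ∈ latticeSet m) :
    normSq (A - B) * normSq (B - C) * normSq (C - A) = 4 * m * triDet A B C ^ 2 := by
  rw [mem_latticeSet] at hA hB hC
  obtain ⟨a, b⟩ := A
  obtain ⟨c, d⟩ := B
  obtain ⟨e, f⟩ := C
  simp only [normSq, triDet, Prod.fst_sub, Prod.snd_sub] at *
  generalize hM : (m : ℤ) = M at *
  have h1 : (a - c) ^ 2 + (b - d) ^ 2 = 2 * (M - (a * c + b * d)) := by linear_combination hA + hB
  have h2 : (c - e) ^ 2 + (d - f) ^ 2 = 2 * (M - (c * e + d * f)) := by linear_combination hB + hC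
  have h3 : (e - a) ^ 2 + (f - b) ^ 2 = 2 * (M - (a * e + b * f)) := by linear_combination hA + hC
  rw [h1, h2, h3]
  have e1 : (a * d - b * c) ^ 2 = M ^ 2 - (a * c + b * d) ^ 2 := by
    linear_combination (c ^ 2 + d ^ 2) * hA + M * hB
  have e2 : (c * f - d * e) ^ 2 = M ^ 2 - (c * e + d * f) ^ 2 := by
    linear_combination (e ^ 2 + f ^ 2) * hB + M * hC
  have e3 : (e * b - f * a) ^ 2 = M ^ 2 - (a * e + b * f) ^ 2 := by
    linear_combination (e ^ 2 + f ^ 2) * hA + M * hC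
  have f1 : (a * d - b * c) * (c * f - d * e) =
      (a * c + b * d) * (c * e + d * f) - M * (a * e + b * f) := by
    linear_combination (-(a * e + b * f)) * hB
  have f2 : (c * f - d * e) * (e * b - f * a) =
      (c * e + d * f) * (a * e + b * f) - M * (a * c + b * d) := by
    linear_combination (-(a * c + b * d)) * hC
  have f3 : (e * b - f * a) * (a * d - b * c) =
      (a * e + b * f) * (a * c + b * d) - M * (c * e + d * f) := by
    linear_combination (-(c * e + d * f)) * hA
  have hdet : ((c - a) * (f - b) - (d - b) * (e - a)) ^ 2 =
      (a * d - b * c) ^ 2 + (c * f - d * e) ^ 2 + (e * b - f * a) ^ 2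
      + 2 * ((a * d - b * c) * (c * f - d * e)) + 2 * ((c * f - d * e) * (e * b - f * a))
      + 2 * ((e * b - f * a) * (a * d - b * c)) := by ring
  have gram : M ^ 3 + 2 * (a * c + b * d) * (c * e + d * f) * (a * e + b * f)
      = M * ((a * c + b * d) ^ 2 + (c * e + d * f) ^ 2 + (a * e + b * f) ^ 2) := by
    linear_combination ((c * e + d * f) ^ 2 - (c ^ 2 + d ^ 2) * (e ^ 2 + f ^ 2)) * hA +
      ((a * e + b * f) ^ 2 - M * (e ^ 2 + f ^ 2)) * hB + ((a * c + b * d) ^ 2 - M ^ 2) * hC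
  rw [hdet, e1, e2, e3, f1, f2, f3]
  linear_combination (-4) * gram

theorem triDet_ne_zero {m : ℕ} {A B C : ℤ × ℤ} (hA : A ∈ latticeSet m) (hB : B ∈ latticeSet m)
    (hC : C ∈ latticeSet m) (hAB : A ≠ B) (hBC : B ≠ C) (hCA : C ≠ A) : triDet A B C ≠ 0 := by
  intro h
  have := prod_normSq_eq hA hB hC
  rw [h] at this
  simp only [ne_eq, OfNat.ofNat_ne_zero, not_false_eq_true, zero_pow, mul_zero, mul_eq_zero,
    normSq_eq_zero, sub_eq_zero] at this
  tauto

/-- The product of the squared sides of an inscribed lattice triangle is at least `4 m`. -/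
theorem four_mul_le_prod_normSq {m : ℕ} {A B C : ℤ × ℤ} (hA : A ∈ latticeSet m)
    (hB : B ∈ latticeSet m) (hC : C ∈ latticeSet m) (hAB : A ≠ B) (hBC : B ≠ C) (hCA : C ≠ A) :
    4 * (m : ℤ) ≤ normSq (A - B) * normSq (B - C) * normSq (C - A) := by
  rw [prod_normSq_eq hA hB hC]
  have h1 : 1 ≤ triDet A B C ^ 2 := by
    have := triDet_ne_zero hA hB hC hAB hBC hCA
    have : 0 < triDet A B C ^ 2 := by positivity
    omega
  nlinarith [Int.natCast_nonneg m]

/-- A nonzero vector is a difference of two lattice points of the circle in at most two ways. -/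
theorem card_filter_sub_mem_le {m : ℕ} {v : ℤ × ℤ} (hv : v ≠ 0) :
    ((latticeSet m).filter (fun A => A - v ∈ latticeSet m)).card ≤ 2 := by
  by_contra! h
  obtain ⟨A, B, C, hA, hB, hC, hAB, hAC, hBC⟩ := Finset.two_lt_card_iff.1 h
  rw [Finset.mem_filter] at hA hB hC
  refine triDet_ne_zero hA.1 hB.1 hC.1 hAB hBC hAC.symm ?_
  have key : ∀ X : ℤ × ℤ, X ∈ latticeSet m ∧ X - v ∈ latticeSet m →
      2 * (X.1 * v.1 + X.2 * v.2) = normSq v := by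
    rintro X ⟨h1, h2⟩
    rw [mem_latticeSet] at h1 h2
    simp only [normSq, Prod.fst_sub, Prod.snd_sub] at *
    linear_combination h1 - h2
  have a := key A hA
  have b := key B hB
  have c := key C hC
  have h1 : (B.1 - A.1) * v.1 + (B.2 - A.2) * v.2 = 0 := by linarith
  have h2 : (C.1 - A.1) * v.1 + (C.2 - A.2) * v.2 = 0 := by linarith
  have h3 : triDet A B C * v.1 = 0 := by
    unfold triDet; linear_combination (C.2 - A.2) * h1 - (B.2 - A.2) * h2
  have h4 : triDet A B C * v.2 = 0 := by
    unfold triDet; linear_combination (B.1 - A.1) * h2 - (C.1 - A.1) * h1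
  by_contra hne
  exact hv (Prod.ext (by simpa [hne] using h3) (by simpa [hne] using h4))

/-- At most two lattice points of the circle lie within distance `√T` of a given point
when `T` is small compared to `m ^ (1 / 3)`. -/
theorem card_filter_normSq_le {m : ℕ} {T : ℤ} (hT : (4 * T) ^ 3 < 4 * m) (w : ℤ × ℤ) :
    ((latticeSet m).filter (fun A => normSq (A - w) ≤ T)).card ≤ 2 := by
  by_contra! h
  obtain ⟨A, B, C, hA, hB, hC, hAB, hAC, hBC⟩ := Finset.two_lt_card_iff.1 h
  rw [Finset.mem_filter] at hA hB hC
  have key : ∀ X Y : ℤ × ℤ, normSq (X - w) ≤ T → normSq (Y - w) ≤ T →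
      normSq (X - Y) ≤ 4 * T := by
    intro X Y h1 h2
    simp only [normSq, Prod.fst_sub, Prod.snd_sub] at *
    nlinarith [sq_nonneg (X.1 - w.1 + (Y.1 - w.1)), sq_nonneg (X.2 - w.2 + (Y.2 - w.2))]
  have h1 := key A B hA.2 hB.2
  have h2 := key B C hB.2 hC.2
  have h3 := key C A hC.2 hA.2
  have h4 := four_mul_le_prod_normSq hA.1 hB.1 hC.1 hAB hBC hAC.symm
  have h0 : 0 ≤ 4 * T := (normSq_nonneg _).trans h1
  have h5 : normSq (A - B) * normSq (B - C) * normSq (C - A) ≤ (4 * T) * (4 * T) * (4 * T) := by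
    have := normSq_nonneg (A - B)
    have := normSq_nonneg (B - C)
    have := normSq_nonneg (C - A)
    gcongr
  nlinarith

/-- The Gaussian integer attached to an integer vector. -/
def toGauss (μ : ℤ × ℤ) : GaussianInt := ⟨μ.1, μ.2⟩

theorem norm_toGauss (μ : ℤ × ℤ) : (toGauss μ).norm = μ.1 ^ 2 + μ.2 ^ 2 := by
  simp [toGauss, Zsqrtd.norm_def]; ring

theorem toGauss_injective : Function.Injective toGauss := by
  rintro ⟨a, b⟩ ⟨c, d⟩ h
  simpa [toGauss, Zsqrtd.ext_iff] using h

theorem toGauss_mem {m : ℕ} {μ : ℤ × ℤ} : μ ∈ latticeSet m ↔ (toGauss μ).norm = m := by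
  rw [mem_latticeSet, norm_toGauss]

theorem finite_gaussianInt_norm_lt (B : ℕ) : {z : GaussianInt | z.norm < B}.Finite := by
  refine ((Set.finite_Icc (-(B : ℤ)) B).prod (Set.finite_Icc (-(B : ℤ)) B) |>.image toGauss).subset ?_
  intro z hz
  refine ⟨(z.re, z.im), ?_, rfl⟩
  simp only [Set.mem_ofPred_eq, Zsqrtd.norm_def] at hz
  have key : ∀ x : ℤ, x ^ 2 ≤ (B : ℤ) → -(B : ℤ) ≤ x ∧ x ≤ B := by
    intro x hx
    exact abs_le.1 (by nlinarith [sq_abs x, abs_nonneg x, Int.le_self_sq |x|])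
  exact ⟨Set.mem_Icc.2 (key _ (by nlinarith [sq_nonneg z.im])),
    Set.mem_Icc.2 (key _ (by nlinarith [sq_nonneg z.re]))⟩

open UniqueFactorizationMonoid in
open scoped Classical in
theorem exists_latN_le_card_Iic :
    ∃ c : ℕ, ∀ m : ℕ, 0 < m → ∃ s : Multiset GaussianInt, (∀ p ∈ s, 2 ≤ p.norm) ∧
      (s.map Zsqrtd.norm).prod = (m : ℤ) ^ 2 ∧ latN m ≤ c * (Finset.Iic s).card := by
  let : StrongNormalizationMonoid GaussianInt :=
    UniqueFactorizationMonoid.strongNormalizationMonoid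
  have hnorm_unit : ∀ u : GaussianInt, IsUnit u → u.norm = 1 := by
    intro u hu
    have := (Zsqrtd.norm_eq_one_iff (d := -1)).2 hu
    have h0 : 0 ≤ u.norm := GaussianInt.norm_nonneg u
    omega
  refine ⟨(latticeSet 1).card, fun m hm => ?_⟩
  have hm0 : (m : GaussianInt) ≠ 0 := by exact_mod_cast hm.ne'
  refine ⟨normalizedFactors (m : GaussianInt), ?_, ?_, ?_⟩
  · intro p hp
    have hpp := prime_of_normalized_factor p hp
    have h0 : 0 ≤ p.norm := GaussianInt.norm_nonneg p
    have h1 : p.norm ≠ 0 := by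
      rw [Ne, GaussianInt.norm_eq_zero]; exact hpp.ne_zero
    have h2 : p.norm ≠ 1 := by
      intro h
      exact hpp.not_isUnit ((Zsqrtd.norm_eq_one_iff (d := -1)).1 (by omega))
    omega
  · have h1 := prod_normalizedFactors hm0
    obtain ⟨u, hu⟩ := h1
    have h2 : (normalizedFactors (m : GaussianInt)).prod.norm = (m : ℤ) ^ 2 := by
      have := congrArg Zsqrtd.norm hu
      rw [Zsqrtd.norm_mul, hnorm_unit _ u.isUnit, mul_one] at this
      rw [this, Zsqrtd.norm_natCast]; ring
    rw [← h2]
    exact (map_multiset_prod (Zsqrtd.normMonoidHom (d := -1)) _).symm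
  · refine Finset.card_le_mul_card_image_of_maps_to
      (f := fun μ => normalizedFactors (toGauss μ)) ?_ _ ?_
    · intro μ hμ
      rw [Finset.mem_Iic]
      have hz0 : toGauss μ ≠ 0 := by
        intro h
        rw [toGauss_mem, h] at hμ
        simp at hμ; omega
      rw [← dvd_iff_normalizedFactors_le_normalizedFactors hz0 hm0]
      refine ⟨star (toGauss μ), ?_⟩
      rw [← Zsqrtd.norm_eq_mul_conj, toGauss_mem.1 hμ]; simp
    · intro t _
      by_cases hne : (Finset.filter (fun μ => normalizedFactors (toGauss μ) = t) (latticeSet m)).Nonempty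
      · obtain ⟨μ₀, hμ₀⟩ := hne
        rw [Finset.mem_filter] at hμ₀
        rw [← Finset.card_image_of_injective _ toGauss_injective]
        refine (Finset.card_le_card (t := (latticeSet 1).image (fun u => toGauss μ₀ * toGauss u)) ?_).trans
          Finset.card_image_le
        intro z hz
        simp only [Finset.mem_image, Finset.mem_filter] at hz ⊢
        obtain ⟨μ, ⟨hμ, hμt⟩, rfl⟩ := hz
        have nz : ∀ ν ∈ latticeSet m, toGauss ν ≠ 0 := by
          intro ν hν h
          rw [toGauss_mem, h] at hν
          simp at hν; omega
        have h1 := prod_normalizedFactors (nz _ hμ₀.1)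
        have h2 := prod_normalizedFactors (nz _ hμ)
        rw [hμt] at h2
        rw [hμ₀.2] at h1
        obtain ⟨u, hu⟩ := h1.symm.trans h2
        refine ⟨((u : GaussianInt).re, (u : GaussianInt).im), ?_, hu⟩
        rw [toGauss_mem]
        exact hnorm_unit _ u.isUnit
      · rw [Finset.not_nonempty_iff_eq_empty] at hne
        rw [hne]; simp

theorem exists_card_Iic_le :
    ∃ C : ℝ, 0 < C ∧ ∀ s : Multiset GaussianInt, (∀ p ∈ s, 2 ≤ p.norm) →
      ((Finset.Iic s).card : ℝ) ≤ C * ((s.map Zsqrtd.norm).prod : ℝ) ^ ((1:ℝ)/18) := by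
  classical
  set P := (finite_gaussianInt_norm_lt (2 ^ 18)).toFinset with hP
  refine ⟨36 ^ P.card, by positivity, fun s hs => ?_⟩
  rw [Multiset.card_Iic]
  have hprod : ((s.map Zsqrtd.norm).prod : ℝ) ^ ((1:ℝ)/18)
      = ∏ p ∈ s.toFinset, ((p.norm : ℝ) ^ ((1:ℝ)/18)) ^ (s.count p) := by
    rw [Finset.prod_multiset_map_count]
    push_cast
    rw [← Real.finsetProd_rpow _ _ (fun p hp => by
      have := hs p (Multiset.mem_toFinset.1 hp)
      have : (0:ℝ) ≤ p.norm := by exact_mod_cast (by omega : 0 ≤ p.norm)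
      positivity)]
    refine Finset.prod_congr rfl fun p hp => ?_
    have := hs p (Multiset.mem_toFinset.1 hp)
    have h0 : (0:ℝ) ≤ p.norm := by exact_mod_cast (by omega : 0 ≤ p.norm)
    rw [← Real.rpow_natCast, ← Real.rpow_natCast, ← Real.rpow_mul h0, ← Real.rpow_mul h0, mul_comm]
  have h36 : ∏ p ∈ s.toFinset, (if p ∈ P then (36:ℝ) else 1) ≤ 36 ^ P.card := by
    rw [Finset.prod_ite, Finset.prod_const_one, mul_one, Finset.prod_const]
    refine pow_le_pow_right₀ (by norm_num) (Finset.card_le_card ?_)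
    intro p hp; exact (Finset.mem_filter.1 hp).2
  calc ((∏ p ∈ s.toFinset, (s.count p + 1) : ℕ) : ℝ)
      ≤ ∏ p ∈ s.toFinset, ((if p ∈ P then (36:ℝ) else 1) *
          ((p.norm : ℝ) ^ ((1:ℝ)/18)) ^ (s.count p)) := by
        push_cast
        refine Finset.prod_le_prod (fun _ _ => by positivity) fun p hp => ?_
        have h2 : (2:ℝ) ≤ p.norm := by exact_mod_cast hs p (Multiset.mem_toFinset.1 hp)
        generalize s.count p = e
        split_ifs with hpP
        · have h3 : (1 + 1/36 : ℝ) ≤ (p.norm : ℝ) ^ ((1:ℝ)/18) := by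
            refine le_trans ?_ (Real.rpow_le_rpow (by norm_num) h2 (by norm_num))
            rw [Real.le_rpow_iff_log_le (by norm_num) (by norm_num)]
            have := Real.log_le_sub_one_of_pos (show (0:ℝ) < 1 + 1/36 by norm_num)
            have := Real.log_two_gt_d9
            linarith
          have h4 := one_add_mul_le_pow (show (-2:ℝ) ≤ 1/36 by norm_num) e
          have h5 := pow_le_pow_left₀ (by norm_num) h3 e
          linarith
        · have h3 : (2:ℝ) ^ (18:ℕ) ≤ p.norm := by
            have : ¬ p.norm < ((2 ^ 18 : ℕ) : ℤ) := by simpa [hP] using hpP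
            exact_mod_cast not_lt.1 this
          have h4 : (2:ℝ) ≤ (p.norm : ℝ) ^ ((1:ℝ)/18) := by
            have := Real.rpow_le_rpow (by norm_num) h3 (show (0:ℝ) ≤ 1/18 by norm_num)
            rwa [← Real.rpow_natCast, ← Real.rpow_mul (by norm_num),
              show ((18:ℕ):ℝ) * (1/18) = 1 by norm_num, Real.rpow_one] at this
          have h5 := pow_le_pow_left₀ (by norm_num) h4 e
          have h6 : (e : ℝ) + 1 ≤ 2 ^ e := by exact_mod_cast Nat.lt_two_pow_self
          linarith
    _ ≤ 36 ^ P.card * ((s.map Zsqrtd.norm).prod : ℝ) ^ ((1:ℝ)/18) := by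
        rw [Finset.prod_mul_distrib, hprod]
        refine mul_le_mul_of_nonneg_right h36 (Finset.prod_nonneg fun p hp => ?_)
        have := hs p (Multiset.mem_toFinset.1 hp)
        have h0 : (0:ℝ) ≤ p.norm := by exact_mod_cast (by omega : 0 ≤ p.norm)
        positivity

/-- The number of lattice points on a circle grows slower than a small power of the radius. -/
theorem exists_latN_le : ∃ C : ℝ, 0 < C ∧ ∀ m : ℕ, 0 < m → (latN m : ℝ) ≤ C * (m : ℝ) ^ ((1:ℝ)/9) := by
  obtain ⟨c, hc⟩ := exists_latN_le_card_Iic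
  obtain ⟨C, hC, h⟩ := exists_card_Iic_le
  refine ⟨(c + 1) * C, by positivity, fun m hm => ?_⟩
  obtain ⟨s, hs1, hs2, hs3⟩ := hc m hm
  have h1 := h s hs1
  rw [hs2] at h1
  have h2 : (((m : ℤ) ^ 2 : ℤ) : ℝ) ^ ((1:ℝ)/18) = (m : ℝ) ^ ((1:ℝ)/9) := by
    push_cast
    rw [← Real.rpow_natCast, ← Real.rpow_mul (by positivity)]; norm_num
  rw [h2] at h1
  calc (latN m : ℝ) ≤ c * (Finset.Iic s).card := by exact_mod_cast hs3
    _ ≤ (c + 1) * (C * (m : ℝ) ^ ((1:ℝ)/9)) := by gcongr; linarith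
    _ = _ := by ring

theorem inv_sqrt_normSq_le {v : ℤ × ℤ} {k : ℕ} (hk : 0 < k) (h : max v.1.natAbs v.2.natAbs = k) :
    (√(normSq v : ℝ))⁻¹ ≤ (k : ℝ)⁻¹ := by
  have hk' : (0:ℝ) < k := by exact_mod_cast hk
  refine inv_anti₀ hk' (Real.le_sqrt_of_sq_le ?_)
  have : ((k : ℤ) ^ 2) ≤ normSq v := by
    unfold normSq
    rcases le_total v.1.natAbs v.2.natAbs with h' | h'
    · rw [max_eq_right h'] at h
      rw [← h, Int.natAbs_sq]; nlinarith [sq_nonneg v.1]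
    · rw [max_eq_left h'] at h
      rw [← h, Int.natAbs_sq]; nlinarith [sq_nonneg v.2]
  exact_mod_cast this

/-- A bound for sums of inverse lengths over a family of nonzero integer vectors in which
each vector is repeated boundedly many times and few vectors are very short. -/
theorem sum_inv_sqrt_normSq_le {α : Type*} (Q : Finset α) (v : α → ℤ × ℤ)
    (hv : ∀ q ∈ Q, v q ≠ 0) {ρ K M : ℕ} (hK : 0 < K) {T : ℤ} {x : ℝ} (hx : 0 < x)
    (hxT : x ≤ T + 1)
    (hρ : ∀ w : ℤ × ℤ, w ≠ 0 → (Q.filter (fun q => v q = w)).card ≤ ρ)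
    (hM : (Q.filter (fun q => normSq (v q) ≤ T)).card ≤ M) :
    ∑ q ∈ Q, (√(normSq (v q) : ℝ))⁻¹ ≤ 8 * K * ρ + M / K + Q.card / √x := by
  classical
  have hK' : (0:ℝ) < K := by exact_mod_cast hK
  set k : α → ℕ := fun q => max (v q).1.natAbs (v q).2.natAbs with hk
  have kpos : ∀ q ∈ Q, 0 < k q := by
    intro q hq
    by_contra h
    have h0 : max (v q).1.natAbs (v q).2.natAbs = 0 := by simpa [hk] using h
    refine hv q hq (Prod.ext ?_ ?_)
    · exact Int.natAbs_eq_zero.1 (by omega)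
    · exact Int.natAbs_eq_zero.1 (by omega)
  have h1 : ∑ q ∈ Q.filter (fun q => k q ≤ K), (√(normSq (v q) : ℝ))⁻¹ ≤ 8 * K * ρ := by
    rw [← Finset.sum_fiberwise_of_maps_to (s := Q.filter (fun q => k q ≤ K))
      (t := Finset.Icc 1 K) (g := k)
      (fun q hq => Finset.mem_Icc.2 ⟨kpos q (Finset.mem_filter.1 hq).1, (Finset.mem_filter.1 hq).2⟩)]
    calc _ ≤ ∑ j ∈ Finset.Icc 1 K, (8 * ρ : ℝ) := by
          refine Finset.sum_le_sum fun j hj => ?_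
          have hj0 : 0 < j := (Finset.mem_Icc.1 hj).1
          have hj' : (0:ℝ) < j := by exact_mod_cast hj0
          set S := Finset.filter (fun q => k q = j) (Q.filter (fun q => k q ≤ K)) with hS
          have hcard : S.card ≤ ρ * (Finset.box j : Finset (ℤ × ℤ)).card := by
            refine Finset.card_le_mul_card_image_of_maps_to (f := v) ?_ ρ ?_
            · intro q hq
              rw [Int.mem_box]; exact (Finset.mem_filter.1 hq).2
            · intro w hw
              have hw0 : w ≠ 0 := by
                rintro rfl
                rw [Int.mem_box] at hw
                simp at hw; omega
              refine le_trans (Finset.card_le_card ?_) (hρ w hw0)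
              intro q hq
              simp only [hS, Finset.mem_filter] at hq ⊢
              exact ⟨hq.1.1.1, hq.2⟩
          rw [Int.card_box hj0.ne'] at hcard
          calc ∑ q ∈ S, (√(normSq (v q) : ℝ))⁻¹ ≤ ∑ q ∈ S, (j : ℝ)⁻¹ :=
                Finset.sum_le_sum fun q hq => inv_sqrt_normSq_le hj0 (Finset.mem_filter.1 hq).2
            _ = S.card * (j : ℝ)⁻¹ := by rw [Finset.sum_const, nsmul_eq_mul]
            _ ≤ (ρ * (8 * j)) * (j : ℝ)⁻¹ := by gcongr; exact_mod_cast hcard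
            _ = 8 * ρ := by field_simp
      _ = 8 * K * ρ := by
          rw [Finset.sum_const, Nat.card_Icc, nsmul_eq_mul]; push_cast [Nat.add_sub_cancel]; ring
  have h2 : ∑ q ∈ Q, (if normSq (v q) ≤ T then (K : ℝ)⁻¹ else 0) ≤ M / K := by
    rw [← Finset.sum_filter, Finset.sum_const, nsmul_eq_mul, div_eq_mul_inv]
    gcongr
  have h3 : ∑ q ∈ Q, (√x)⁻¹ = Q.card / √x := by
    rw [Finset.sum_const, nsmul_eq_mul, div_eq_mul_inv]
  rw [Finset.sum_filter] at h1
  rw [← h3]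
  refine le_trans ?_ (add_le_add (add_le_add h1 h2) le_rfl)
  rw [← Finset.sum_add_distrib, ← Finset.sum_add_distrib]
  refine Finset.sum_le_sum fun q hq => ?_
  have hsx : 0 < (√x)⁻¹ := by positivity
  have hn : 0 ≤ (√(normSq (v q) : ℝ))⁻¹ := by positivity
  by_cases hkK : k q ≤ K
  · rw [if_pos hkK]
    have : (0:ℝ) ≤ if normSq (v q) ≤ T then (K : ℝ)⁻¹ else 0 := by split_ifs <;> positivity
    linarith
  · rw [if_neg hkK]
    split_ifs with hT
    · have := inv_sqrt_normSq_le (kpos q hq) (v := v q) rfl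
      have h5 : ((k q : ℕ) : ℝ)⁻¹ ≤ (K : ℝ)⁻¹ :=
        inv_anti₀ hK' (by exact_mod_cast (not_le.1 hkK).le)
      linarith
    · have h5 : (√(normSq (v q) : ℝ))⁻¹ ≤ (√x)⁻¹ := by
        refine inv_anti₀ (by positivity) (Real.sqrt_le_sqrt (hxT.trans ?_))
        exact_mod_cast (not_le.1 hT)
      linarith

theorem exists_threshold {m : ℕ} (hm : 0 < m) :
    ∃ T : ℤ, (4 * T) ^ 3 < 4 * m ∧ ((m : ℝ) / 16) ^ ((1:ℝ)/3) ≤ T + 1 := by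
  have hm' : (0:ℝ) < m := by exact_mod_cast hm
  set x := ((m : ℝ) / 16) ^ ((1:ℝ)/3) with hx
  have hx0 : 0 < x := by positivity
  refine ⟨⌈x⌉ - 1, ?_, by push_cast; linarith [Int.le_ceil x]⟩
  have h1 : ((⌈x⌉ - 1 : ℤ) : ℝ) < x := by push_cast; linarith [Int.ceil_lt_add_one x]
  have h0 : (0:ℝ) ≤ ((⌈x⌉ - 1 : ℤ) : ℝ) := by
    have : 0 < ⌈x⌉ := Int.ceil_pos.2 hx0
    exact_mod_cast (by omega : 0 ≤ ⌈x⌉ - 1)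
  have h3 : x ^ 3 = m / 16 := by
    rw [hx, ← Real.rpow_natCast, ← Real.rpow_mul (by positivity)]; norm_num
  have h2 : ((⌈x⌉ - 1 : ℤ) : ℝ) ^ 3 < m / 16 := by
    rw [← h3]; exact pow_lt_pow_left₀ h1 h0 (by norm_num)
  have : ((4 * ((⌈x⌉ - 1 : ℤ) : ℝ)) ^ 3) < 4 * m := by nlinarith
  exact_mod_cast this

/-- The contribution of the long vectors is negligible. -/
theorem exists_sq_div_sqrt_le : ∃ C : ℝ, 0 < C ∧ ∀ m : ℕ, 0 < m →
    (latN m : ℝ) ^ 2 / √(((m : ℝ) / 16) ^ ((1:ℝ)/3)) ≤ C * √(latN m) := by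
  obtain ⟨C, hC, h⟩ := exists_latN_le
  refine ⟨C ^ ((3:ℝ)/2) * 16, by positivity, fun m hm => ?_⟩
  have hm' : (0:ℝ) < m := by exact_mod_cast hm
  have hN : (0:ℝ) ≤ latN m := by positivity
  rw [div_le_iff₀ (by positivity)]
  have h1 : √(((m : ℝ) / 16) ^ ((1:ℝ)/3)) = (m : ℝ) ^ ((1:ℝ)/6) * (1/16) ^ ((1:ℝ)/6) := by
    rw [Real.sqrt_eq_rpow, ← Real.rpow_mul (by positivity), div_eq_mul_one_div,
      Real.mul_rpow (by positivity) (by positivity)]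
    norm_num
  have h2 : (1/16 : ℝ) ≤ (1/16) ^ ((1:ℝ)/6) := by
    conv_lhs => rw [← Real.rpow_one (1/16 : ℝ)]
    exact Real.rpow_le_rpow_of_exponent_ge (by norm_num) (by norm_num) (by norm_num)
  have h3 : (latN m : ℝ) ^ ((3:ℝ)/2) ≤ C ^ ((3:ℝ)/2) * (m : ℝ) ^ ((1:ℝ)/6) := by
    refine (Real.rpow_le_rpow hN (h m hm) (by norm_num)).trans_eq ?_
    rw [Real.mul_rpow (by positivity) (by positivity), ← Real.rpow_mul (by positivity)]
    norm_num
  have h4 : (latN m : ℝ) ^ 2 = (latN m : ℝ) ^ ((3:ℝ)/2) * √(latN m) := by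
    rw [Real.sqrt_eq_rpow, ← Real.rpow_add_of_nonneg hN (by norm_num) (by norm_num)]
    norm_num
  rw [h1, h4]
  calc (latN m : ℝ) ^ ((3:ℝ)/2) * √(latN m)
      ≤ (C ^ ((3:ℝ)/2) * (m : ℝ) ^ ((1:ℝ)/6)) * √(latN m) := by gcongr
    _ = C ^ ((3:ℝ)/2) * 16 * √(latN m) * ((m : ℝ) ^ ((1:ℝ)/6) * (1/16)) := by ring
    _ ≤ _ := by gcongr

theorem card_pairs_sub_eq_le {m : ℕ} {w : ℤ × ℤ} (hw : w ≠ 0) :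
    ((latticeSet m ×ˢ latticeSet m).filter (fun p => p.1 - p.2 = w)).card ≤ 2 := by
  refine le_trans (Finset.card_le_card_of_injOn Prod.fst ?_ ?_) (card_filter_sub_mem_le (m := m) hw)
  · rintro ⟨A, B⟩ h
    simp only [Finset.coe_filter, Finset.mem_product, Set.mem_ofPred_eq] at h ⊢
    obtain ⟨⟨hA, hB⟩, rfl⟩ := h
    exact ⟨hA, by simpa using hB⟩
  · rintro ⟨A, B⟩ h ⟨A', B'⟩ h' hAA
    simp only [Finset.coe_filter, Finset.mem_product, Set.mem_ofPred_eq] at h h' hAA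
    subst hAA
    have : A - B = A - B' := h.2.trans h'.2.symm
    simpa using this

theorem card_pairs_zero (m : ℕ) :
    ((latticeSet m ×ˢ latticeSet m).filter (fun p => p.1 - p.2 = 0)).card ≤ latN m := by
  refine le_trans (Finset.card_le_card_of_injOn Prod.fst (t := latticeSet m) ?_ ?_) le_rfl
  · rintro ⟨A, B⟩ h
    simp only [Finset.coe_filter, Finset.mem_product, Set.mem_ofPred_eq] at h
    exact h.1.1
  · rintro ⟨A, B⟩ h ⟨A', B'⟩ h' hAA
    simp only [Finset.coe_filter, Finset.mem_product, Set.mem_ofPred_eq, sub_eq_zero] at h h' hAA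
    obtain ⟨_, rfl⟩ := h
    obtain ⟨_, rfl⟩ := h'
    simp [hAA]

/-- Sums of inverse distances between distinct lattice points on a circle. -/
theorem exists_sum_pairs_le : ∃ C : ℝ, 0 < C ∧ ∀ m : ℕ, 0 < m → 0 < latN m →
    ∑ p ∈ (latticeSet m ×ˢ latticeSet m).filter (fun p => p.1 - p.2 ≠ 0),
      (√(normSq (p.1 - p.2) : ℝ))⁻¹ ≤ C * √(latN m) := by
  obtain ⟨C, hC, h⟩ := exists_sq_div_sqrt_le
  refine ⟨34 + C, by positivity, fun m hm hN => ?_⟩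
  have hm' : (0:ℝ) < m := by exact_mod_cast hm
  have hN' : (1:ℝ) ≤ latN m := by exact_mod_cast hN
  obtain ⟨T, hT1, hT2⟩ := exists_threshold hm
  have hs : 1 ≤ √(latN m : ℝ) := Real.one_le_sqrt.2 hN'
  set K := ⌈√(latN m : ℝ)⌉₊ with hK
  have hK1 : √(latN m : ℝ) ≤ K := Nat.le_ceil _
  have hK2 : (K : ℝ) ≤ 2 * √(latN m) := by
    have := Nat.ceil_lt_add_one (show 0 ≤ √(latN m : ℝ) by positivity)
    linarith
  have hK0 : 0 < K := Nat.ceil_pos.2 (by linarith)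
  have main := sum_inv_sqrt_normSq_le
    ((latticeSet m ×ˢ latticeSet m).filter (fun p => p.1 - p.2 ≠ 0)) (fun p => p.1 - p.2)
    (fun q hq => (Finset.mem_filter.1 hq).2) (ρ := 2) (M := 2 * latN m) hK0
    (x := ((m : ℝ) / 16) ^ ((1:ℝ)/3)) (by positivity) hT2 ?_ ?_
  · refine main.trans ?_
    have hc : (((latticeSet m ×ˢ latticeSet m).filter (fun p => p.1 - p.2 ≠ 0)).card : ℝ)
        ≤ (latN m : ℝ) ^ 2 := by
      rw [sq]
      exact_mod_cast (Finset.card_filter_le _ _).trans_eq (Finset.card_product _ _)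
    have h2 : ((2 * latN m : ℕ) : ℝ) / K ≤ 2 * √(latN m) := by
      rw [div_le_iff₀ (by exact_mod_cast hK0)]
      push_cast
      nlinarith [Real.mul_self_sqrt (show (0:ℝ) ≤ latN m by positivity)]
    have h3 := (div_le_div_of_nonneg_right hc (Real.sqrt_nonneg (((m : ℝ) / 16) ^ ((1:ℝ)/3)))).trans
      (h m hm)
    push_cast at *
    linarith
  · intro w hw
    refine (Finset.card_le_card ?_).trans (card_pairs_sub_eq_le (m := m) hw)
    exact Finset.filter_subset_filter _ (Finset.filter_subset _ _)
  · refine (Finset.card_le_mul_card_image_of_maps_to (f := Prod.fst) (t := latticeSet m)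
      (fun p hp => ?_) 2 (fun A hA => ?_)).trans_eq rfl
    · simp only [Finset.mem_filter, Finset.mem_product] at hp; exact hp.1.1.1
    · refine le_trans (Finset.card_le_card_of_injOn Prod.snd ?_ ?_) (card_filter_normSq_le hT1 A)
      · rintro ⟨A', B⟩ h
        simp only [Finset.coe_filter, Finset.mem_filter, Finset.mem_product, Set.mem_ofPred_eq] at h ⊢
        obtain ⟨⟨⟨⟨_, hB⟩, _⟩, hn⟩, rfl⟩ := h
        refine ⟨hB, ?_⟩
        simpa [normSq, ← sq_abs, abs_sub_comm] using hn
      · rintro ⟨A', B⟩ h ⟨A'', B'⟩ h' hBB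
        simp only [Finset.coe_filter, Finset.mem_filter, Finset.mem_product, Set.mem_ofPred_eq] at h h' hBB
        rw [h.2, h'.2, hBB]

/-- Quadruples of lattice points. -/
abbrev quads (m : ℕ) : Finset (((ℤ × ℤ) × (ℤ × ℤ)) × ((ℤ × ℤ) × (ℤ × ℤ))) :=
  (latticeSet m ×ˢ latticeSet m) ×ˢ (latticeSet m ×ˢ latticeSet m)

/-- The alternating sum of a quadruple. -/
abbrev quadVec (q : ((ℤ × ℤ) × (ℤ × ℤ)) × ((ℤ × ℤ) × (ℤ × ℤ))) : ℤ × ℤ :=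
  (q.1.1 - q.1.2) + (q.2.1 - q.2.2)

theorem card_quads_eq_le (m : ℕ) (w : ℤ × ℤ) :
    ((quads m).filter (fun q => quadVec q = w)).card ≤
      2 * (latN m) ^ 2 + latN m *
        ((latticeSet m ×ˢ latticeSet m).filter (fun p => p.1 - p.2 = w)).card := by
  classical
  have h1 : ((quads m).filter (fun q => quadVec q = w)).card =
      ∑ p ∈ latticeSet m ×ˢ latticeSet m,
        ((latticeSet m ×ˢ latticeSet m).filter (fun p' => p'.1 - p'.2 = w - (p.1 - p.2))).card := by
    rw [Finset.card_filter, Finset.sum_product]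
    refine Finset.sum_congr rfl fun p _ => ?_
    rw [Finset.card_filter]
    refine Finset.sum_congr rfl fun p' _ => ?_
    simp only [quadVec, eq_sub_iff_add_eq, add_comm]
  rw [h1]
  calc _ ≤ ∑ p ∈ latticeSet m ×ˢ latticeSet m, (2 + if p.1 - p.2 = w then latN m else 0) := by
        refine Finset.sum_le_sum fun p _ => ?_
        split_ifs with hp
        · rw [hp, sub_self]
          exact (card_pairs_zero m).trans (by omega)
        · exact card_pairs_sub_eq_le (sub_ne_zero.2 (Ne.symm hp))
    _ = _ := by
        rw [Finset.sum_add_distrib, ← Finset.sum_filter, Finset.sum_const, Finset.sum_const,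
          Finset.card_product]
        simp only [smul_eq_mul, latN]; ring

theorem card_quads_zero_le (m : ℕ) :
    ((quads m).filter (fun q => quadVec q = 0)).card ≤ 3 * latN m ^ 2 := by
  refine (card_quads_eq_le m 0).trans ?_
  nlinarith [Nat.mul_le_mul_left (latN m) (card_pairs_zero m)]

/-- Sums of inverse lengths of alternating sums of quadruples of lattice points on a circle. -/
theorem exists_sum_quads_le : ∃ C : ℝ, 0 < C ∧ ∀ m : ℕ, 0 < m → 0 < latN m →
    ∑ q ∈ (quads m).filter (fun q => quadVec q ≠ 0),
      (√(normSq (quadVec q) : ℝ))⁻¹ ≤ C * (latN m : ℝ) ^ 2 * √(latN m) := by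
  obtain ⟨C, hC, h⟩ := exists_sq_div_sqrt_le
  refine ⟨66 + C, by positivity, fun m hm hN => ?_⟩
  have hm' : (0:ℝ) < m := by exact_mod_cast hm
  have hN' : (1:ℝ) ≤ latN m := by exact_mod_cast hN
  obtain ⟨T, hT1, hT2⟩ := exists_threshold hm
  have hs : 1 ≤ √(latN m : ℝ) := Real.one_le_sqrt.2 hN'
  set K := ⌈√(latN m : ℝ)⌉₊ with hK
  have hK1 : √(latN m : ℝ) ≤ K := Nat.le_ceil _
  have hK2 : (K : ℝ) ≤ 2 * √(latN m) := by
    have := Nat.ceil_lt_add_one (show 0 ≤ √(latN m : ℝ) by positivity)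
    linarith
  have hK0 : 0 < K := Nat.ceil_pos.2 (by linarith)
  have main := sum_inv_sqrt_normSq_le
    ((quads m).filter (fun q => quadVec q ≠ 0)) quadVec
    (fun q hq => (Finset.mem_filter.1 hq).2) (ρ := 4 * latN m ^ 2) (M := 2 * latN m ^ 3) hK0
    (x := ((m : ℝ) / 16) ^ ((1:ℝ)/3)) (by positivity) hT2 ?_ ?_
  · refine main.trans ?_
    have hc : (((quads m).filter (fun q => quadVec q ≠ 0)).card : ℝ)
        ≤ (latN m : ℝ) ^ 2 * (latN m : ℝ) ^ 2 := by
      have := (Finset.card_filter_le (quads m) (fun q => quadVec q ≠ 0)).trans_eq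
        ((Finset.card_product _ _).trans (by rw [Finset.card_product]))
      calc _ ≤ (((latticeSet m).card * (latticeSet m).card * ((latticeSet m).card * (latticeSet m).card) : ℕ) : ℝ) := by
            exact_mod_cast this
        _ = _ := by push_cast [latN]; ring
    have h2 : ((2 * latN m ^ 3 : ℕ) : ℝ) / K ≤ 2 * ((latN m : ℝ) ^ 2 * √(latN m)) := by
      rw [div_le_iff₀ (by exact_mod_cast hK0)]
      push_cast
      have h5 := Real.mul_self_sqrt (show (0:ℝ) ≤ latN m by positivity)
      have h6 : (latN m : ℝ) ≤ √(latN m) * K := by nlinarith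
      calc (2 * (latN m : ℝ) ^ 3) = 2 * (latN m : ℝ) ^ 2 * latN m := by ring
        _ ≤ 2 * (latN m : ℝ) ^ 2 * (√(latN m) * K) := by gcongr
        _ = _ := by ring
    have h3 := (div_le_div_of_nonneg_right hc (Real.sqrt_nonneg (((m : ℝ) / 16) ^ ((1:ℝ)/3))))
    rw [mul_div_assoc] at h3
    have h4 := mul_le_mul_of_nonneg_left (h m hm) (show 0 ≤ (latN m : ℝ) ^ 2 by positivity)
    have h5 : (8 * K * ((4 * latN m ^ 2 : ℕ) : ℝ)) ≤ 64 * ((latN m : ℝ) ^ 2 * √(latN m)) := by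
      push_cast
      have := mul_le_mul_of_nonneg_left hK2 (show 0 ≤ 32 * (latN m : ℝ) ^ 2 by positivity)
      linarith
    linarith
  · intro w hw
    refine (Finset.card_le_card (Finset.filter_subset_filter _ (Finset.filter_subset _ _))).trans
      ((card_quads_eq_le m w).trans ?_)
    have := card_pairs_sub_eq_le (m := m) hw
    nlinarith [Nat.mul_le_mul_left (latN m) this]
  · refine (Finset.card_le_mul_card_image_of_maps_to (f := fun q => (q.1, q.2.1))
      (t := (latticeSet m ×ˢ latticeSet m) ×ˢ latticeSet m)
      (fun p hp => ?_) 2 (fun A hA => ?_)).trans_eq ?_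
    · simp only [Finset.mem_filter, Finset.mem_product] at hp ⊢; exact ⟨hp.1.1.1, hp.1.1.2.1⟩
    · refine le_trans (Finset.card_le_card_of_injOn (fun q => q.2.2) ?_ ?_)
        (card_filter_normSq_le hT1 (A.1.1 - A.1.2 + A.2))
      · rintro ⟨p, A', B⟩ h
        simp only [Finset.coe_filter, Finset.mem_filter, Finset.mem_product, Set.mem_ofPred_eq] at h ⊢
        obtain ⟨⟨⟨⟨_, hB⟩, _⟩, hn⟩, rfl⟩ := h
        refine ⟨hB.2, ?_⟩
        refine le_trans (le_of_eq ?_) hn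
        simp only [normSq, quadVec, Prod.fst_sub, Prod.fst_add, Prod.snd_sub, Prod.snd_add]; ring
      · rintro ⟨p, A', B⟩ h ⟨p', A'', B'⟩ h' hBB
        simp only [Finset.coe_filter, Finset.mem_filter, Finset.mem_product, Set.mem_ofPred_eq] at h h' hBB
        have := h.2.trans h'.2.symm
        simp only [Prod.mk.injEq] at this
        rw [this.1, this.2, hBB]
    · rw [Finset.card_product, Finset.card_product]; simp only [latN]; ring

/-- The weight `1 / (1 + Λ u²)` has integral `O(Λ^{-1/2})` when `u` and `u'` do not
vanish simultaneously. -/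
lemma integral_weight_le {L A c Λ : ℝ} (hL : 0 < L) (hc : 0 < c) (hΛ : 1 ≤ Λ)
    {u u1 u2 : ℝ → ℝ} (hu : ∀ t, HasDerivAt u (u1 t) t) (hu1 : ∀ t, HasDerivAt u1 (u2 t) t)
    (hu2 : Continuous u2) (h1 : ∀ t ∈ Set.Icc 0 L, |u1 t| ≤ A)
    (h2 : ∀ t ∈ Set.Icc 0 L, |u2 t| ≤ A)
    (hlow : ∀ t ∈ Set.Icc 0 L, c ≤ u t ^ 2 + u1 t ^ 2) :
    ∫ t in (0:ℝ)..L, (1 + Λ * u t ^ 2)⁻¹ ≤ c⁻¹ * (L + 4 * A + 2 * A * L) / √Λ := by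
  have hΛ0 : 0 < Λ := by linarith
  have hs : 0 < √Λ := Real.sqrt_pos.2 hΛ0
  have hs1 : 1 ≤ √Λ := by rw [Real.one_le_sqrt]; exact hΛ
  have hss : √Λ * √Λ = Λ := Real.mul_self_sqrt hΛ0.le
  have cu : Continuous u := continuous_iff_continuousAt.2 fun t => (hu t).continuousAt
  have cu1 : Continuous u1 := continuous_iff_continuousAt.2 fun t => (hu1 t).continuousAt
  have hpos : ∀ t, 0 < 1 + Λ * u t ^ 2 := fun t => by positivity
  have cw : Continuous fun t => (1 + Λ * u t ^ 2)⁻¹ :=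
    Continuous.inv₀ (by fun_prop) fun t => (hpos t).ne'
  have hA : 0 ≤ A := (abs_nonneg _).trans (h1 0 ⟨le_rfl, hL.le⟩)
  have hat : ∀ t, HasDerivAt (fun t => Real.arctan (√Λ * u t))
      (√Λ * (u1 t * (1 + Λ * u t ^ 2)⁻¹)) t := by
    intro t
    have := ((hu t).const_mul (√Λ)).arctan
    convert this using 1
    rw [mul_pow, Real.sq_sqrt hΛ0.le]; field_simp
  have hbp := intervalIntegral.integral_mul_deriv_eq_deriv_mul (a := 0) (b := L)
    (u := u1) (u' := u2) (fun t _ => hu1 t) (fun t _ => hat t)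
    (hu2.intervalIntegrable _ _) ((continuous_const.mul (cu1.mul cw)).intervalIntegrable _ _)
  have hatb : ∀ x, |Real.arctan x| ≤ 2 := by
    intro x
    rw [abs_le]
    have := Real.arctan_lt_pi_div_two x
    have := Real.neg_pi_div_two_lt_arctan x
    have := Real.pi_lt_four
    constructor <;> linarith
  have hI : ∫ t in (0:ℝ)..L, u1 t * (√Λ * (u1 t * (1 + Λ * u t ^ 2)⁻¹)) ≤ 4 * A + 2 * A * L := by
    rw [hbp]
    have hb : ∀ t ∈ Set.Icc 0 L, |u1 t * Real.arctan (√Λ * u t)| ≤ 2 * A := by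
      intro t ht
      rw [abs_mul, mul_comm 2 A]
      exact mul_le_mul (h1 t ht) (hatb _) (abs_nonneg _) hA
    have hint : |∫ t in (0:ℝ)..L, u2 t * Real.arctan (√Λ * u t)| ≤ 2 * A * L := by
      have := intervalIntegral.norm_integral_le_of_norm_le_const (a := 0) (b := L) (C := 2 * A)
        (f := fun t => u2 t * Real.arctan (√Λ * u t)) (by
          intro t ht
          rw [Set.uIoc_of_le hL.le] at ht
          rw [Real.norm_eq_abs, abs_mul, mul_comm 2 A]
          exact mul_le_mul (h2 t ⟨ht.1.le, ht.2⟩) (hatb _) (abs_nonneg _) hA)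
      simpa [abs_of_pos hL] using this
    have e1 := abs_le.1 (hb L ⟨hL.le, le_rfl⟩)
    have e2 := abs_le.1 (hb 0 ⟨le_rfl, hL.le⟩)
    have e3 := abs_le.1 hint
    linarith
  have hpt : ∀ t ∈ Set.Icc 0 L, c * (1 + Λ * u t ^ 2)⁻¹ ≤
      Λ⁻¹ + (√Λ)⁻¹ * (u1 t * (√Λ * (u1 t * (1 + Λ * u t ^ 2)⁻¹))) := by
    intro t ht
    have := hlow t ht
    have hp := hpos t
    have e : (√Λ)⁻¹ * (u1 t * (√Λ * (u1 t * (1 + Λ * u t ^ 2)⁻¹))) =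
        u1 t ^ 2 * (1 + Λ * u t ^ 2)⁻¹ := by field_simp
    have e2 : u t ^ 2 * (1 + Λ * u t ^ 2)⁻¹ ≤ Λ⁻¹ := by
      rw [← div_eq_mul_inv, div_le_iff₀ hp, mul_add, ← mul_assoc, inv_mul_cancel₀ hΛ0.ne']
      have : 0 < Λ⁻¹ := by positivity
      linarith
    rw [e]
    have : c * (1 + Λ * u t ^ 2)⁻¹ ≤ (u t ^ 2 + u1 t ^ 2) * (1 + Λ * u t ^ 2)⁻¹ := by
      gcongr
    linarith [add_mul (u t ^ 2) (u1 t ^ 2) (1 + Λ * u t ^ 2)⁻¹]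
  have hmono := intervalIntegral.integral_mono_on (a := 0) (b := L) (μ := volume) hL.le
    (f := fun t => c * (1 + Λ * u t ^ 2)⁻¹)
    (by apply Continuous.intervalIntegrable; fun_prop)
    (by apply Continuous.intervalIntegrable; fun_prop) hpt
  rw [intervalIntegral.integral_const_mul, intervalIntegral.integral_add (by simp)
    (by apply Continuous.intervalIntegrable; fun_prop), intervalIntegral.integral_const,
    intervalIntegral.integral_const_mul] at hmono
  have hLL : Λ⁻¹ ≤ (√Λ)⁻¹ := by
    apply inv_anti₀ hs; nlinarith
  rw [mul_div_assoc, ← div_eq_inv_mul, le_div_iff₀ hc, mul_comm]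
  refine hmono.trans ?_
  simp only [sub_zero, smul_eq_mul]
  calc L * Λ⁻¹ + (√Λ)⁻¹ * _ ≤ L * (√Λ)⁻¹ + (√Λ)⁻¹ * (4 * A + 2 * A * L) := by gcongr
    _ = _ := by ring

/-- A uniform van der Corput estimate for phases `φ` with `φ' = Λ u`. -/
lemma van_der_corput {L A c Λ K : ℝ} (hL : 0 < L) (hc : 0 < c) (hΛ : 1 ≤ Λ)
    {φ u u1 u2 g g1 : ℝ → ℝ} (hφ : ∀ t, HasDerivAt φ (Λ * u t) t)
    (hu : ∀ t, HasDerivAt u (u1 t) t) (hu1 : ∀ t, HasDerivAt u1 (u2 t) t)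
    (hu2 : Continuous u2) (hg : ∀ t, HasDerivAt g (g1 t) t) (hg1 : Continuous g1)
    (h1 : ∀ t ∈ Set.Icc 0 L, |u1 t| ≤ A)
    (h2 : ∀ t ∈ Set.Icc 0 L, |u2 t| ≤ A)
    (hlow : ∀ t ∈ Set.Icc 0 L, c ≤ u t ^ 2 + u1 t ^ 2)
    (hgK : ∀ t ∈ Set.Icc 0 L, |g t| ≤ K) (hg1K : ∀ t ∈ Set.Icc 0 L, |g1 t| ≤ K) :
    ‖∫ t in (0:ℝ)..L, (g t : ℂ) * Complex.exp (φ t * Complex.I)‖ ≤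
      (2 + L + (A + 1) * (c⁻¹ * (L + 4 * A + 2 * A * L))) * K / √Λ := by
  have hΛ0 : 0 < Λ := by linarith
  have hs : 0 < √Λ := Real.sqrt_pos.2 hΛ0
  have hss : √Λ ^ 2 = Λ := Real.sq_sqrt hΛ0.le
  have cu : Continuous u := continuous_iff_continuousAt.2 fun t => (hu t).continuousAt
  have cu1 : Continuous u1 := continuous_iff_continuousAt.2 fun t => (hu1 t).continuousAt
  have cg : Continuous g := continuous_iff_continuousAt.2 fun t => (hg t).continuousAt
  have cφ : Continuous φ := continuous_iff_continuousAt.2 fun t => (hφ t).continuousAt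
  have hpos : ∀ t, 0 < 1 + Λ * u t ^ 2 := fun t => by positivity
  have cw : Continuous fun t => (1 + Λ * u t ^ 2)⁻¹ :=
    Continuous.inv₀ (by fun_prop) fun t => (hpos t).ne'
  have hA : 0 ≤ A := (abs_nonneg _).trans (h1 0 ⟨le_rfl, hL.le⟩)
  have hK : 0 ≤ K := (abs_nonneg _).trans (hgK 0 ⟨le_rfl, hL.le⟩)
  set w : ℝ → ℝ := fun t => (1 + Λ * u t ^ 2)⁻¹ with hw
  have hw0 : ∀ t, 0 ≤ w t := fun t => (inv_pos.2 (hpos t)).le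
  have huw : ∀ t, |u t * w t| ≤ (√Λ)⁻¹ := by
    intro t
    rw [hw, abs_mul, abs_of_pos (inv_pos.2 (hpos t)), ← div_eq_mul_inv, div_le_iff₀ (hpos t),
      ← div_eq_inv_mul, le_div_iff₀ hs]
    nlinarith [sq_nonneg (√Λ * |u t| - 1), sq_abs (u t), abs_nonneg (u t)]
  set p : ℝ → ℝ := fun t => g t * (u t * w t) with hp
  set p1 : ℝ → ℝ := fun t => g1 t * (u t * w t) +
    g t * (u1 t * ((1 - Λ * u t ^ 2) * w t ^ 2)) with hp1
  have hdw : ∀ t, HasDerivAt (fun t => u t * w t) (u1 t * ((1 - Λ * u t ^ 2) * w t ^ 2)) t := by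
    intro t
    have hd : HasDerivAt (fun t => 1 + Λ * u t ^ 2) (Λ * (2 * u t * u1 t)) t := by
      exact ((((hu t).pow 2).const_mul Λ).const_add 1).congr_deriv (by simp)
    refine ((hu t).mul (hd.inv (hpos t).ne')).congr_deriv ?_
    have := (hpos t).ne'
    change u1 t * (1 + Λ * u t ^ 2)⁻¹ + u t * _ =
      u1 t * ((1 - Λ * u t ^ 2) * ((1 + Λ * u t ^ 2)⁻¹) ^ 2)
    field_simp
    ring
  have hdp : ∀ t, HasDerivAt p (p1 t) t := fun t => (hg t).mul (hdw t)
  have cp1 : Continuous p1 := by simp only [hp1]; fun_prop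
  have cp : Continuous p := continuous_iff_continuousAt.2 fun t => (hdp t).continuousAt
  have hde : ∀ t, HasDerivAt (fun t => Complex.exp (φ t * Complex.I))
      (Complex.exp (φ t * Complex.I) * ((Λ * u t : ℝ) * Complex.I)) t := fun t =>
    ((hφ t).ofReal_comp.mul_const Complex.I).cexp
  have cexp : Continuous fun t => Complex.exp (φ t * Complex.I) := by fun_prop
  have hbp := intervalIntegral.integral_mul_deriv_eq_deriv_mul (a := 0) (b := L)
    (u := fun t => (p t : ℂ)) (u' := fun t => (p1 t : ℂ))
    (fun t _ => (hdp t).ofReal_comp) (fun t _ => hde t)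
    (by apply Continuous.intervalIntegrable; fun_prop)
    (by apply Continuous.intervalIntegrable; fun_prop)
  have hnorm : ∀ t, ‖Complex.exp (φ t * Complex.I)‖ = 1 := fun t =>
    Complex.norm_exp_ofReal_mul_I _
  have hWint := integral_weight_le hL hc hΛ hu hu1 hu2 h1 h2 hlow
  have hsplit : ∀ t, (g t : ℂ) * Complex.exp (φ t * Complex.I) =
      -Complex.I * ((p t : ℂ) * (Complex.exp (φ t * Complex.I) * ((Λ * u t : ℝ) * Complex.I)))
      + ((g t * w t : ℝ) : ℂ) * Complex.exp (φ t * Complex.I) := by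
    intro t
    have : (g t : ℂ) = ((g t * (u t * w t) * (Λ * u t) + g t * w t : ℝ) : ℂ) := by
      congr 1
      change g t = g t * (u t * (1 + Λ * u t ^ 2)⁻¹) * (Λ * u t) + g t * (1 + Λ * u t ^ 2)⁻¹
      have := (hpos t).ne'
      field_simp
      ring
    have hI : Complex.I * Complex.I = -1 := Complex.I_mul_I
    rw [this, hp]
    push_cast
    linear_combination ((g t : ℂ) * (u t * w t) * (Λ * u t) * Complex.exp (φ t * Complex.I)) * hI
  simp_rw [hsplit]
  rw [intervalIntegral.integral_add (by apply Continuous.intervalIntegrable; fun_prop)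
    (by apply Continuous.intervalIntegrable; fun_prop), intervalIntegral.integral_const_mul, hbp]
  have hE1 : ‖∫ t in (0:ℝ)..L, (p1 t : ℂ) * Complex.exp (φ t * Complex.I)‖ ≤
      ∫ t in (0:ℝ)..L, (K * (√Λ)⁻¹ + K * A * w t) := by
    apply intervalIntegral.norm_integral_le_of_norm_le hL.le
    · refine Filter.Eventually.of_forall fun t ht => ?_
      have ht' : t ∈ Set.Icc 0 L := ⟨ht.1.le, ht.2⟩
      rw [norm_mul, hnorm, mul_one, Complex.norm_real, Real.norm_eq_abs, hp1]
      refine (abs_add_le _ _).trans (add_le_add ?_ ?_)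
      · rw [abs_mul]; exact mul_le_mul (hg1K t ht') (huw t) (abs_nonneg _) hK
      · rw [abs_mul, abs_mul, mul_assoc]
        refine mul_le_mul (hgK t ht') (mul_le_mul (h1 t ht') ?_ (abs_nonneg _) hA) (by positivity) hK
        rw [abs_mul, abs_of_nonneg (sq_nonneg (w t)), sq (w t), ← mul_assoc]
        refine mul_le_of_le_one_left (hw0 t) ?_
        change |1 - Λ * u t ^ 2| * (1 + Λ * u t ^ 2)⁻¹ ≤ 1
        rw [← div_eq_mul_inv, div_le_one (hpos t), abs_le]
        have : 0 ≤ Λ * u t ^ 2 := by positivity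
        constructor <;> linarith
    · apply Continuous.intervalIntegrable; fun_prop
  have hE2 : ‖∫ t in (0:ℝ)..L, ((g t * w t : ℝ) : ℂ) * Complex.exp (φ t * Complex.I)‖ ≤
      ∫ t in (0:ℝ)..L, K * w t := by
    apply intervalIntegral.norm_integral_le_of_norm_le hL.le
    · refine Filter.Eventually.of_forall fun t ht => ?_
      have ht' : t ∈ Set.Icc 0 L := ⟨ht.1.le, ht.2⟩
      rw [norm_mul, hnorm, mul_one, Complex.norm_real, Real.norm_eq_abs, abs_mul,
        abs_of_nonneg (hw0 t)]
      exact mul_le_mul_of_nonneg_right (hgK t ht') (hw0 t)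
    · apply Continuous.intervalIntegrable; fun_prop
  have hB : ∀ t ∈ Set.Icc 0 L, ‖(p t : ℂ) * Complex.exp (φ t * Complex.I)‖ ≤ K * (√Λ)⁻¹ := by
    intro t ht
    rw [norm_mul, hnorm, mul_one, Complex.norm_real, Real.norm_eq_abs, hp, abs_mul]
    exact mul_le_mul (hgK t ht) (huw t) (abs_nonneg _) hK
  rw [intervalIntegral.integral_add (by simp) (by apply Continuous.intervalIntegrable; fun_prop),
    intervalIntegral.integral_const, intervalIntegral.integral_const_mul] at hE1
  rw [intervalIntegral.integral_const_mul] at hE2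
  have hBL := hB L ⟨hL.le, le_rfl⟩
  have hB0 := hB 0 ⟨le_rfl, hL.le⟩
  refine (norm_add_le _ _).trans ?_
  rw [norm_mul, norm_neg, Complex.norm_I, one_mul]
  have n1 := norm_sub_le ((p L : ℂ) * Complex.exp (φ L * Complex.I) -
    (p 0 : ℂ) * Complex.exp (φ 0 * Complex.I))
    (∫ t in (0:ℝ)..L, (p1 t : ℂ) * Complex.exp (φ t * Complex.I))
  have n2 := norm_sub_le ((p L : ℂ) * Complex.exp (φ L * Complex.I))
    ((p 0 : ℂ) * Complex.exp (φ 0 * Complex.I))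
  simp only [sub_zero, smul_eq_mul] at hE1
  have hW2 : (K * A + K) * ∫ t in (0:ℝ)..L, w t ≤
      (K * A + K) * (c⁻¹ * (L + 4 * A + 2 * A * L) / √Λ) := by gcongr
  calc _ ≤ 2 * (K * (√Λ)⁻¹) + L * (K * (√Λ)⁻¹) + (K * A + K) * ∫ t in (0:ℝ)..L, w t := by linarith
    _ ≤ 2 * (K * (√Λ)⁻¹) + L * (K * (√Λ)⁻¹) +
      (K * A + K) * (c⁻¹ * (L + 4 * A + 2 * A * L) / √Λ) := by linarith
    _ = _ := by ring

/-- Coordinates of a plane curve that has unit speed and nowhere-vanishing curvature on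
`[0, L]`, with its first three derivatives. -/
structure PlaneArc (L : ℝ) where
  x : ℝ → ℝ
  y : ℝ → ℝ
  x1 : ℝ → ℝ
  y1 : ℝ → ℝ
  x2 : ℝ → ℝ
  y2 : ℝ → ℝ
  x3 : ℝ → ℝ
  y3 : ℝ → ℝ
  pos : 0 < L
  hx : ∀ t, HasDerivAt x (x1 t) t
  hy : ∀ t, HasDerivAt y (y1 t) t
  hx1 : ∀ t, HasDerivAt x1 (x2 t) t
  hy1 : ∀ t, HasDerivAt y1 (y2 t) t
  hx2 : ∀ t, HasDerivAt x2 (x3 t) t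
  hy2 : ∀ t, HasDerivAt y2 (y3 t) t
  cx3 : Continuous x3
  cy3 : Continuous y3
  unit : ∀ t ∈ Set.Icc 0 L, x1 t ^ 2 + y1 t ^ 2 = 1
  curv : ∀ t ∈ Set.Icc 0 L, 0 < x2 t ^ 2 + y2 t ^ 2

lemma hasDerivAt_fst_snd {f : ℝ → ℝ × ℝ} (hf : Differentiable ℝ f) (t : ℝ) :
    HasDerivAt (fun t => (f t).1) (deriv f t).1 t ∧
    HasDerivAt (fun t => (f t).2) (deriv f t).2 t := by
  have h := (hf t).hasDerivAt
  exact ⟨(ContinuousLinearMap.fst ℝ ℝ ℝ).hasFDerivAt.comp_hasDerivAt t h,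
    (ContinuousLinearMap.snd ℝ ℝ ℝ).hasFDerivAt.comp_hasDerivAt t h⟩

/-- The coordinates of a smooth curve. -/
def PlaneArc.ofContDiff {L : ℝ} (hL : 0 < L) (γ : ℝ → ℝ × ℝ) (hγ : ContDiff ℝ (⊤ : ℕ∞) γ)
    (hunit : ∀ t ∈ Set.Icc (0:ℝ) L, (deriv γ t).1 ^ 2 + (deriv γ t).2 ^ 2 = 1)
    (hcurv : ∀ t ∈ Set.Icc (0:ℝ) L, deriv (deriv γ) t ≠ 0) : PlaneArc L :=
  have h1 := (contDiff_infty_iff_deriv.1 hγ)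
  have h2 := (contDiff_infty_iff_deriv.1 h1.2)
  have h3 := (contDiff_infty_iff_deriv.1 h2.2)
  { x := fun t => (γ t).1
    y := fun t => (γ t).2
    x1 := fun t => (deriv γ t).1
    y1 := fun t => (deriv γ t).2
    x2 := fun t => (deriv (deriv γ) t).1
    y2 := fun t => (deriv (deriv γ) t).2
    x3 := fun t => (deriv (deriv (deriv γ)) t).1
    y3 := fun t => (deriv (deriv (deriv γ)) t).2
    pos := hL
    hx := fun t => (hasDerivAt_fst_snd h1.1 t).1
    hy := fun t => (hasDerivAt_fst_snd h1.1 t).2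
    hx1 := fun t => (hasDerivAt_fst_snd h2.1 t).1
    hy1 := fun t => (hasDerivAt_fst_snd h2.1 t).2
    hx2 := fun t => (hasDerivAt_fst_snd h3.1 t).1
    hy2 := fun t => (hasDerivAt_fst_snd h3.1 t).2
    cx3 := continuous_fst.comp h3.2.continuous
    cy3 := continuous_snd.comp h3.2.continuous
    unit := hunit
    curv := by
      intro t ht
      by_contra hcon
      apply hcurv t ht
      have e1 : (deriv (deriv γ) t).1 = 0 := by nlinarith [sq_nonneg (deriv (deriv γ) t).1, sq_nonneg (deriv (deriv γ) t).2]
      have e2 : (deriv (deriv γ) t).2 = 0 := by nlinarith [sq_nonneg (deriv (deriv γ) t).1, sq_nonneg (deriv (deriv γ) t).2]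
      exact Prod.ext e1 e2 }

namespace PlaneArc
variable {L : ℝ} (P : PlaneArc L)

lemma cx : Continuous P.x := continuous_iff_continuousAt.2 fun t => (P.hx t).continuousAt
lemma cy : Continuous P.y := continuous_iff_continuousAt.2 fun t => (P.hy t).continuousAt
lemma cx1 : Continuous P.x1 := continuous_iff_continuousAt.2 fun t => (P.hx1 t).continuousAt
lemma cy1 : Continuous P.y1 := continuous_iff_continuousAt.2 fun t => (P.hy1 t).continuousAt
lemma cx2 : Continuous P.x2 := continuous_iff_continuousAt.2 fun t => (P.hx2 t).continuousAt
lemma cy2 : Continuous P.y2 := continuous_iff_continuousAt.2 fun t => (P.hy2 t).continuousAt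

lemma perp (t : ℝ) (ht : t ∈ Set.Icc 0 L) : P.x1 t * P.x2 t + P.y1 t * P.y2 t = 0 := by
  have h1 : HasDerivWithinAt (fun t => P.x1 t ^ 2 + P.y1 t ^ 2)
      (2 * (P.x1 t * P.x2 t + P.y1 t * P.y2 t)) (Set.Icc 0 L) t := by
    refine (((P.hx1 t).pow 2).add ((P.hy1 t).pow 2)).hasDerivWithinAt.congr_deriv ?_
    simp; ring
  have h2 : HasDerivWithinAt (fun t => P.x1 t ^ 2 + P.y1 t ^ 2) 0 (Set.Icc 0 L) t :=
    (hasDerivWithinAt_const t _ (1:ℝ)).congr (fun s hs => P.unit s hs) (P.unit t ht)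
  have := (uniqueDiffOn_Icc P.pos t ht).eq_deriv _ h1 h2
  linarith

/-- A common bound for the derivatives of the coordinates, and a lower bound for the
curvature. -/
lemma exists_bounds : ∃ A ≥ (1:ℝ), ∃ κ > 0, κ ≤ 1 ∧ ∀ t ∈ Set.Icc 0 L,
    P.x2 t ^ 2 + P.y2 t ^ 2 ≤ A ^ 2 ∧ P.x3 t ^ 2 + P.y3 t ^ 2 ≤ A ^ 2 ∧
    κ ≤ P.x2 t ^ 2 + P.y2 t ^ 2 := by
  have cx2 := P.cx2
  have cy2 := P.cy2
  have cx3 := P.cx3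
  have cy3 := P.cy3
  obtain ⟨B, hB⟩ := isCompact_Icc.exists_bound_of_continuousOn (s := Set.Icc 0 L)
    (f := fun t => P.x2 t ^ 2 + P.y2 t ^ 2) (by fun_prop)
  obtain ⟨B', hB'⟩ := isCompact_Icc.exists_bound_of_continuousOn (s := Set.Icc 0 L)
    (f := fun t => P.x3 t ^ 2 + P.y3 t ^ 2) (by fun_prop)
  obtain ⟨t0, ht0, hmin⟩ := isCompact_Icc.exists_isMinOn (s := Set.Icc 0 L)
    (f := fun t => P.x2 t ^ 2 + P.y2 t ^ 2) ⟨0, le_rfl, P.pos.le⟩ (by fun_prop)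
  set A := max 1 (max B B')
  have hA1 : 1 ≤ A := le_max_left _ _
  have hAA : A ≤ A ^ 2 := by nlinarith
  refine ⟨A, hA1, min 1 (P.x2 t0 ^ 2 + P.y2 t0 ^ 2), ?_, min_le_left _ _, ?_⟩
  · exact lt_min one_pos (P.curv t0 ht0)
  · intro t ht
    refine ⟨?_, ?_, (min_le_right _ _).trans (hmin ht)⟩
    · exact ((le_abs_self _).trans (hB t ht)).trans
        (((le_max_left _ _).trans (le_max_right _ _)).trans hAA)
    · exact ((le_abs_self _).trans (hB' t ht)).trans
        (((le_max_right _ _).trans (le_max_right _ _)).trans hAA)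

/-- `2π⟨v, γ(t)⟩`. -/
def phase (v : ℤ × ℤ) (t : ℝ) : ℝ := 2 * π * (v.1 * P.x t + v.2 * P.y t)

lemma abs_dot_le {a b c d A : ℝ} (hA : 0 ≤ A) (h1 : a ^ 2 + b ^ 2 = 1) (h2 : c ^ 2 + d ^ 2 ≤ A ^ 2) :
    |a * c + b * d| ≤ A := by
  apply abs_le_of_sq_le_sq _ hA
  nlinarith [sq_nonneg (a * d - b * c)]

lemma dot_sq_add_dot_sq_ge {a b x y z w κ : ℝ} (hκ : κ ≤ 1) (hab : a ^ 2 + b ^ 2 = 1)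
    (hxy : x ^ 2 + y ^ 2 = 1) (hp : x * z + y * w = 0) (hzw : κ ≤ z ^ 2 + w ^ 2) :
    κ ≤ (a * x + b * y) ^ 2 + (a * z + b * w) ^ 2 := by
  set k := x * w - y * z
  have ez : z = -(k * y) := by simp only [k]; linear_combination (-z) * hxy + x * hp
  have ew : w = k * x := by simp only [k]; linear_combination (-w) * hxy + y * hp
  have hk : κ ≤ k ^ 2 := by
    have : z ^ 2 + w ^ 2 = k ^ 2 := by rw [ez, ew]; linear_combination k ^ 2 * hxy
    linarith
  have e : (a * x + b * y) ^ 2 + (a * z + b * w) ^ 2 =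
      (a * x + b * y) ^ 2 + k ^ 2 * (b * x - a * y) ^ 2 := by rw [ez, ew]; ring
  have e2 : (a * x + b * y) ^ 2 + (b * x - a * y) ^ 2 = 1 := by
    linear_combination (x ^ 2 + y ^ 2) * hab + hxy
  rw [e]
  nlinarith [sq_nonneg (a * x + b * y), sq_nonneg (b * x - a * y)]

/-- Oscillatory integrals along the arc decay like `|v|^{-1/2}`. -/
lemma exists_osc_le : ∃ C > 0, ∀ v : ℤ × ℤ, v ≠ 0 → ∀ (K : ℝ) (g g1 : ℝ → ℝ),
    (∀ t, HasDerivAt g (g1 t) t) → Continuous g1 → (∀ t ∈ Set.Icc 0 L, |g t| ≤ K) →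
    (∀ t ∈ Set.Icc 0 L, |g1 t| ≤ K) →
    ‖∫ t in (0:ℝ)..L, (g t : ℂ) * Complex.exp (P.phase v t * Complex.I)‖ ≤
      C * K * √((√(normSq v : ℝ))⁻¹) := by
  obtain ⟨A, hA, κ, hκ, hκ1, hb⟩ := P.exists_bounds
  have hL := P.pos
  refine ⟨2 + L + (A + 1) * (κ⁻¹ * (L + 4 * A + 2 * A * L)), by positivity, ?_⟩
  intro v hv K g g1 hg hg1 hK hK1
  set C := 2 + L + (A + 1) * (κ⁻¹ * (L + 4 * A + 2 * A * L)) with hC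
  have hC0 : 0 < C := by positivity
  have hK0 : 0 ≤ K := (abs_nonneg _).trans (hK 0 ⟨le_rfl, hL.le⟩)
  have hn : (1:ℝ) ≤ normSq v := by
    have h0 := normSq_nonneg v
    have h1 : normSq v ≠ 0 := fun h => hv (normSq_eq_zero.1 h)
    exact_mod_cast (show (1:ℤ) ≤ normSq v by omega)
  set n := √(normSq v : ℝ) with hnn
  have hn1 : 1 ≤ n := Real.one_le_sqrt.2 hn
  have hn0 : 0 < n := by linarith
  have hnsq : n ^ 2 = (v.1:ℝ) ^ 2 + (v.2:ℝ) ^ 2 := by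
    rw [hnn, Real.sq_sqrt (by linarith)]; simp [normSq]
  set a := (v.1 : ℝ) / n
  set b := (v.2 : ℝ) / n
  have hab : a ^ 2 + b ^ 2 = 1 := by
    simp only [a, b]; field_simp; linarith
  have ha : n * a = v.1 := by simp only [a]; field_simp
  have hbb : n * b = v.2 := by simp only [b]; field_simp
  have hpi := Real.two_le_pi
  have hΛ : 1 ≤ 2 * π * n := by nlinarith
  have key := van_der_corput (A := A) (c := κ) (Λ := 2 * π * n) (K := K) hL hκ hΛ
    (φ := P.phase v) (u := fun t => a * P.x1 t + b * P.y1 t)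
    (u1 := fun t => a * P.x2 t + b * P.y2 t) (u2 := fun t => a * P.x3 t + b * P.y3 t)
    (g := g) (g1 := g1)
    (by
      intro t
      refine ((((P.hx t).const_mul (v.1:ℝ)).add ((P.hy t).const_mul (v.2:ℝ))).const_mul
        (2 * π)).congr_deriv ?_
      rw [← ha, ← hbb]; ring)
    (fun t => ((P.hx1 t).const_mul a).add ((P.hy1 t).const_mul b))
    (fun t => ((P.hx2 t).const_mul a).add ((P.hy2 t).const_mul b))
    (by have := P.cx3; have := P.cy3; fun_prop) hg hg1
    (fun t ht => abs_dot_le (by linarith) hab (hb t ht).1)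
    (fun t ht => abs_dot_le (by linarith) hab (hb t ht).2.1)
    (fun t ht => dot_sq_add_dot_sq_ge hκ1 hab (P.unit t ht) (P.perp t ht) (hb t ht).2.2) hK hK1
  refine key.trans ?_
  rw [← hC, div_eq_mul_inv, ← Real.sqrt_inv]
  gcongr
  nlinarith

@[fun_prop]
lemma continuous_phase (v : ℤ × ℤ) : Continuous (P.phase v) := by
  have := P.cx
  have := P.cy
  unfold phase; fun_prop

lemma phase_zero (t : ℝ) : P.phase 0 t = 0 := by simp [phase]

lemma phase_add (v w : ℤ × ℤ) (t : ℝ) : P.phase (v + w) t = P.phase v t + P.phase w t := by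
  simp [phase]; ring

lemma phase_sub (v w : ℤ × ℤ) (t : ℝ) : P.phase (v - w) t = P.phase v t - P.phase w t := by
  simp [phase]; ring

lemma phase_neg (v : ℤ × ℤ) (t : ℝ) : P.phase (-v) t = -P.phase v t := by
  simp [phase]; ring

/-- The sum of the diagonal terms approximates the double integral of a sum of oscillating
terms. -/
lemma exists_double_osc_le : ∃ C > 0, ∀ {ι : Type} (S : Finset ι) (v : ι → ℤ × ℤ) (K : ℝ)
    (G G1 H H1 : ι → ℝ → ℝ), (∀ q t, HasDerivAt (G q) (G1 q t) t) →
    (∀ q t, HasDerivAt (H q) (H1 q t) t) → (∀ q, Continuous (G1 q)) → (∀ q, Continuous (H1 q)) →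
    (∀ q ∈ S, ∀ t ∈ Set.Icc 0 L, |G q t| ≤ K) → (∀ q ∈ S, ∀ t ∈ Set.Icc 0 L, |G1 q t| ≤ K) →
    (∀ q ∈ S, ∀ t ∈ Set.Icc 0 L, |H q t| ≤ K) → (∀ q ∈ S, ∀ t ∈ Set.Icc 0 L, |H1 q t| ≤ K) →
    ‖(∫ t in (0:ℝ)..L, ∫ s in (0:ℝ)..L, ∑ q ∈ S, ((G q t * H q s : ℝ) : ℂ) *
        Complex.exp ((P.phase (v q) t - P.phase (v q) s : ℝ) * Complex.I)) -
      ((∑ q ∈ S.filter (fun q => v q = 0), (∫ t in (0:ℝ)..L, G q t) * ∫ s in (0:ℝ)..L, H q s : ℝ) : ℂ)‖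
      ≤ C * K ^ 2 * ∑ q ∈ S.filter (fun q => v q ≠ 0), (√(normSq (v q) : ℝ))⁻¹ := by
  obtain ⟨C, hC, hosc⟩ := P.exists_osc_le
  refine ⟨C ^ 2, by positivity, ?_⟩
  intro ι S v K G G1 H H1 hG hH cG1 cH1 hGK hG1K hHK hH1K
  have cG : ∀ q, Continuous (G q) := fun q =>
    continuous_iff_continuousAt.2 fun t => (hG q t).continuousAt
  have cH : ∀ q, Continuous (H q) := fun q =>
    continuous_iff_continuousAt.2 fun t => (hH q t).continuousAt
  set I : ι → ℂ := fun q => ∫ t in (0:ℝ)..L, (G q t : ℂ) *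
    Complex.exp (P.phase (v q) t * Complex.I) with hI
  set J : ι → ℂ := fun q => ∫ t in (0:ℝ)..L, (H q t : ℂ) *
    Complex.exp (P.phase (-v q) t * Complex.I) with hJ
  have hmain : (∫ t in (0:ℝ)..L, ∫ s in (0:ℝ)..L, ∑ q ∈ S, ((G q t * H q s : ℝ) : ℂ) *
        Complex.exp ((P.phase (v q) t - P.phase (v q) s : ℝ) * Complex.I)) = ∑ q ∈ S, I q * J q := by
    have e : ∀ t s q, ((G q t * H q s : ℝ) : ℂ) *
        Complex.exp ((P.phase (v q) t - P.phase (v q) s : ℝ) * Complex.I) =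
        ((G q t : ℂ) * Complex.exp (P.phase (v q) t * Complex.I)) *
        ((H q s : ℂ) * Complex.exp (P.phase (-v q) s * Complex.I)) := by
      intro t s q
      rw [phase_neg]; push_cast
      rw [sub_mul, sub_eq_add_neg, Complex.exp_add, neg_mul]; ring
    simp_rw [e]
    have e2 : ∀ t, (∫ s in (0:ℝ)..L, ∑ q ∈ S, ((G q t : ℂ) * Complex.exp (P.phase (v q) t * Complex.I)) *
        ((H q s : ℂ) * Complex.exp (P.phase (-v q) s * Complex.I))) =
        ∑ q ∈ S, ((G q t : ℂ) * Complex.exp (P.phase (v q) t * Complex.I)) * J q := by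
      intro t
      rw [intervalIntegral.integral_finsetSum]
      · simp_rw [intervalIntegral.integral_const_mul]; rfl
      · intro q _
        apply Continuous.intervalIntegrable
        have := cH q; have := P.continuous_phase (-v q)
        fun_prop
    simp_rw [e2]
    rw [intervalIntegral.integral_finsetSum]
    · simp_rw [intervalIntegral.integral_mul_const]; rfl
    · intro q _
      apply Continuous.intervalIntegrable
      have := cG q; have := P.continuous_phase (v q)
      fun_prop
  rw [hmain, ← Finset.sum_filter_add_sum_filter_not S (fun q => v q = 0)]
  have hz : ∑ q ∈ S.filter (fun q => v q = 0), I q * J q =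
      ((∑ q ∈ S.filter (fun q => v q = 0), (∫ t in (0:ℝ)..L, G q t) * ∫ s in (0:ℝ)..L, H q s : ℝ) : ℂ) := by
    rw [Complex.ofReal_sum]
    refine Finset.sum_congr rfl fun q hq => ?_
    have hv : v q = 0 := (Finset.mem_filter.1 hq).2
    simp only [hI, hJ, hv, neg_zero, phase_zero, Complex.ofReal_zero, zero_mul, Complex.exp_zero, mul_one]
    rw [Complex.ofReal_mul, intervalIntegral.integral_ofReal, intervalIntegral.integral_ofReal]
  rw [hz, add_sub_cancel_left, Finset.mul_sum]
  refine norm_sum_le_of_le _ fun q hq => ?_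
  obtain ⟨hqS, hv⟩ := Finset.mem_filter.1 hq
  rw [norm_mul]
  have b1 := hosc (v q) hv K (G q) (G1 q) (hG q) (cG1 q) (hGK q hqS) (hG1K q hqS)
  have b2 := hosc (-v q) (neg_ne_zero.2 hv) K (H q) (H1 q) (hH q) (cH1 q) (hHK q hqS) (hH1K q hqS)
  have en : normSq (-v q) = normSq (v q) := by simp [normSq]
  rw [en] at b2
  have hs := Real.mul_self_sqrt (show 0 ≤ (√(normSq (v q) : ℝ))⁻¹ by positivity)
  calc ‖I q‖ * ‖J q‖ ≤ (C * K * √((√(normSq (v q) : ℝ))⁻¹)) * (C * K * √((√(normSq (v q) : ℝ))⁻¹)) := by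
        apply mul_le_mul b1 b2 (norm_nonneg _) ((norm_nonneg _).trans b1)
    _ = C ^ 2 * K ^ 2 * (√((√(normSq (v q) : ℝ))⁻¹) * √((√(normSq (v q) : ℝ))⁻¹)) := by ring
    _ = _ := by rw [hs]

/-- The weighted two-point function `N⁻¹ ∑ g_μ(t) h_μ(s) e(⟨μ, γ(t) - γ(s)⟩)`. -/
def corr (m : ℕ) (g h : ℤ × ℤ → ℝ → ℝ) (t s : ℝ) : ℂ :=
  (latN m : ℂ)⁻¹ * ∑ μ ∈ latticeSet m, ((g μ t * h μ s : ℝ) : ℂ) *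
    Complex.exp ((P.phase μ t - P.phase μ s : ℝ) * Complex.I)

lemma corr_normSq (m : ℕ) (g h : ℤ × ℤ → ℝ → ℝ) (t s : ℝ) :
    ((‖P.corr m g h t s‖ ^ 2 : ℝ) : ℂ) = ((latN m : ℂ)⁻¹) ^ 2 *
      ∑ p ∈ latticeSet m ×ˢ latticeSet m,
      (((g p.1 t * g p.2 t) * (h p.1 s * h p.2 s) : ℝ) : ℂ) *
      Complex.exp ((P.phase (p.1 - p.2) t - P.phase (p.1 - p.2) s : ℝ) * Complex.I) := by
  rw [Complex.ofReal_pow, ← Complex.mul_conj', corr, map_mul, map_sum, Finset.sum_product]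
  have : (starRingEnd ℂ) (latN m : ℂ)⁻¹ = (latN m : ℂ)⁻¹ := by simp
  rw [this, mul_mul_mul_comm, ← sq, Finset.sum_mul_sum]
  congr 1
  refine Finset.sum_congr rfl fun a _ => Finset.sum_congr rfl fun b _ => ?_
  rw [map_mul, Complex.conj_ofReal, ← Complex.exp_conj, map_mul, Complex.conj_ofReal,
    Complex.conj_I, mul_mul_mul_comm, ← Complex.exp_add, phase_sub, phase_sub, ← Complex.ofReal_mul]
  congr 2
  · ring
  · push_cast; ring

lemma corr_fourth (m : ℕ) (g h : ℤ × ℤ → ℝ → ℝ) (t s : ℝ) :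
    ((‖P.corr m g h t s‖ ^ 4 : ℝ) : ℂ) = ((latN m : ℂ)⁻¹) ^ 4 *
      ∑ q ∈ quads m,
      ((((g q.1.1 t * g q.1.2 t) * (g q.2.1 t * g q.2.2 t)) *
        ((h q.1.1 s * h q.1.2 s) * (h q.2.1 s * h q.2.2 s)) : ℝ) : ℂ) *
      Complex.exp ((P.phase (quadVec q) t - P.phase (quadVec q) s : ℝ) * Complex.I) := by
  have : (‖P.corr m g h t s‖ ^ 4 : ℝ) = ‖P.corr m g h t s‖ ^ 2 * ‖P.corr m g h t s‖ ^ 2 := by ring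
  rw [this, Complex.ofReal_mul, corr_normSq, mul_mul_mul_comm, Finset.sum_mul_sum,
    ← Finset.sum_product']
  congr 1
  · ring
  · refine Finset.sum_congr rfl fun q _ => ?_
    rw [mul_mul_mul_comm, ← Complex.exp_add, phase_add, phase_add, ← Complex.ofReal_mul]
    congr 2
    · ring
    · push_cast; ring

end PlaneArc

/-- A family of amplitudes bounded by `A` on `[0, L]`, together with their derivatives. -/
structure AmpBound (L : ℝ) (m : ℕ) (A : ℝ) (g g1 : ℤ × ℤ → ℝ → ℝ) : Prop where
  deriv : ∀ μ t, HasDerivAt (g μ) (g1 μ t) t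
  cont : ∀ μ, Continuous (g1 μ)
  le : ∀ μ ∈ latticeSet m, ∀ t ∈ Set.Icc 0 L, |g μ t| ≤ A
  le1 : ∀ μ ∈ latticeSet m, ∀ t ∈ Set.Icc 0 L, |g1 μ t| ≤ A

lemma AmpBound.continuous {L A : ℝ} {m : ℕ} {g g1 : ℤ × ℤ → ℝ → ℝ} (hg : AmpBound L m A g g1)
    (μ : ℤ × ℤ) : Continuous (g μ) :=
  continuous_iff_continuousAt.2 fun t => (hg.deriv μ t).continuousAt

lemma abs_mul_le_sq {A a b : ℝ} (ha : |a| ≤ A) (hb : |b| ≤ A) :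
    |a * b| ≤ A ^ 2 := by
  rw [abs_mul, sq]; exact mul_le_mul ha hb (abs_nonneg _) ((abs_nonneg _).trans ha)

lemma abs_mul_add_mul_le {A a b a1 b1 : ℝ} (ha : |a| ≤ A) (hb : |b| ≤ A)
    (ha1 : |a1| ≤ A) (hb1 : |b1| ≤ A) : |a1 * b + a * b1| ≤ 2 * A ^ 2 := by
  have := abs_add_le (a1 * b) (a * b1)
  have := abs_mul_le_sq ha1 hb
  have := abs_mul_le_sq ha hb1
  linarith

namespace PlaneArc
variable {L : ℝ} (P : PlaneArc L)

lemma exists_corr_moments (A : ℝ) : ∃ C > 0, ∀ m : ℕ, 0 < m → 0 < latN m →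
    ∀ g g1 h h1 : ℤ × ℤ → ℝ → ℝ, AmpBound L m A g g1 → AmpBound L m A h h1 →
    |(∫ t in (0:ℝ)..L, ∫ s in (0:ℝ)..L, ‖P.corr m g h t s‖ ^ 2) -
      ((latN m : ℝ)⁻¹) ^ 2 * ∑ μ ∈ latticeSet m, (∫ t in (0:ℝ)..L, g μ t ^ 2) *
        ∫ s in (0:ℝ)..L, h μ s ^ 2| ≤ C / (latN m * √(latN m)) ∧
    (∫ t in (0:ℝ)..L, ∫ s in (0:ℝ)..L, ‖P.corr m g h t s‖ ^ 4) ≤ C / (latN m * √(latN m)) := by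
  obtain ⟨C, hC, hosc⟩ := P.exists_double_osc_le
  obtain ⟨C2, hC2, hpairs⟩ := exists_sum_pairs_le
  obtain ⟨C4, hC4, hquads⟩ := exists_sum_quads_le
  have hL := P.pos
  refine ⟨C * (2 * A ^ 2) ^ 2 * C2 + (C * (8 * A ^ 4) ^ 2 * C4 + 3 * (8 * A ^ 4 * L) ^ 2) + 1,
    by positivity, ?_⟩
  intro m hm hN g g1 h h1 hg hh
  have hN1 : (1:ℝ) ≤ latN m := by exact_mod_cast hN
  have hN0 : (0:ℝ) < latN m := by linarith
  set N : ℝ := ((latN m : ℕ) : ℝ) with hNdef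
  have hs : 0 < √N := Real.sqrt_pos.2 hN0
  have hss : √N * √N = N := Real.mul_self_sqrt hN0.le
  have hs1 : 1 ≤ √N := Real.one_le_sqrt.2 hN1
  have cg := hg.continuous
  have ch := hh.continuous
  have cg1 := hg.cont
  have ch1 := hh.cont
  have key : ∀ {f f1 : ℤ × ℤ → ℝ → ℝ}, AmpBound L m A f f1 → 
      (∀ p : (ℤ × ℤ) × (ℤ × ℤ), ∀ t, HasDerivAt (fun t => f p.1 t * f p.2 t)
        (f1 p.1 t * f p.2 t + f p.1 t * f1 p.2 t) t) ∧
      (∀ p ∈ latticeSet m ×ˢ latticeSet m, ∀ t ∈ Set.Icc 0 L, |f p.1 t * f p.2 t| ≤ 2 * A ^ 2 ∧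
        |f1 p.1 t * f p.2 t + f p.1 t * f1 p.2 t| ≤ 2 * A ^ 2) := by
    intro f f1 hf
    refine ⟨fun p t => (hf.deriv p.1 t).mul (hf.deriv p.2 t), fun p hp t ht => ?_⟩
    obtain ⟨h1, h2⟩ := Finset.mem_product.1 hp
    exact ⟨(abs_mul_le_sq (hf.le _ h1 t ht) (hf.le _ h2 t ht)).trans (by nlinarith [sq_nonneg A]),
      abs_mul_add_mul_le (hf.le _ h1 t ht) (hf.le _ h2 t ht) (hf.le1 _ h1 t ht) (hf.le1 _ h2 t ht)⟩
  have key4 : ∀ {f f1 : ℤ × ℤ → ℝ → ℝ}, AmpBound L m A f f1 → 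
      (∀ q : ((ℤ × ℤ) × (ℤ × ℤ)) × ((ℤ × ℤ) × (ℤ × ℤ)), ∀ t,
        HasDerivAt (fun t => (f q.1.1 t * f q.1.2 t) * (f q.2.1 t * f q.2.2 t))
        ((f1 q.1.1 t * f q.1.2 t + f q.1.1 t * f1 q.1.2 t) * (f q.2.1 t * f q.2.2 t) +
         (f q.1.1 t * f q.1.2 t) * (f1 q.2.1 t * f q.2.2 t + f q.2.1 t * f1 q.2.2 t)) t) ∧
      (∀ q ∈ quads m, ∀ t ∈ Set.Icc 0 L,
        |(f q.1.1 t * f q.1.2 t) * (f q.2.1 t * f q.2.2 t)| ≤ 8 * A ^ 4 ∧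
        |(f1 q.1.1 t * f q.1.2 t + f q.1.1 t * f1 q.1.2 t) * (f q.2.1 t * f q.2.2 t) +
         (f q.1.1 t * f q.1.2 t) * (f1 q.2.1 t * f q.2.2 t + f q.2.1 t * f1 q.2.2 t)| ≤ 8 * A ^ 4) := by
    intro f f1 hf
    obtain ⟨k1, k2⟩ := key hf
    refine ⟨fun q t => (k1 q.1 t).mul (k1 q.2 t), fun q hq t ht => ?_⟩
    obtain ⟨h1, h2⟩ := Finset.mem_product.1 hq
    obtain ⟨a1, a2⟩ := k2 _ h1 t ht
    obtain ⟨b1, b2⟩ := k2 _ h2 t ht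
    have e1 := abs_mul_le_sq a1 b1
    have e2 := abs_mul_add_mul_le a1 b1 a2 b2
    have e3 : (2 * A ^ 2) ^ 2 = 4 * A ^ 4 := by ring
    rw [e3] at e1 e2
    constructor
    · have : 0 ≤ A ^ 4 := by positivity
      linarith
    · linarith
  constructor
  · obtain ⟨kg1, kg2⟩ := key hg
    obtain ⟨kh1, kh2⟩ := key hh
    have b := hosc (latticeSet m ×ˢ latticeSet m) (fun p => p.1 - p.2) (2 * A ^ 2)
      (fun p t => g p.1 t * g p.2 t) (fun p t => g1 p.1 t * g p.2 t + g p.1 t * g1 p.2 t)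
      (fun p t => h p.1 t * h p.2 t) (fun p t => h1 p.1 t * h p.2 t + h p.1 t * h1 p.2 t)
      kg1 kh1 (fun p => by fun_prop) (fun p => by fun_prop)
      (fun p hp t ht => (kg2 p hp t ht).1) (fun p hp t ht => (kg2 p hp t ht).2)
      (fun p hp t ht => (kh2 p hp t ht).1) (fun p hp t ht => (kh2 p hp t ht).2)
    have e : ((∫ t in (0:ℝ)..L, ∫ s in (0:ℝ)..L, ‖P.corr m g h t s‖ ^ 2 : ℝ) : ℂ) =
        ((latN m : ℂ)⁻¹) ^ 2 * (∫ t in (0:ℝ)..L, ∫ s in (0:ℝ)..L,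
          ∑ p ∈ latticeSet m ×ˢ latticeSet m,
          (((g p.1 t * g p.2 t) * (h p.1 s * h p.2 s) : ℝ) : ℂ) *
          Complex.exp ((P.phase (p.1 - p.2) t - P.phase (p.1 - p.2) s : ℝ) * Complex.I)) := by
      rw [← intervalIntegral.integral_ofReal]
      simp_rw [← intervalIntegral.integral_ofReal, corr_normSq, intervalIntegral.integral_const_mul]
    have ed : ∑ q ∈ (latticeSet m ×ˢ latticeSet m).filter (fun p => p.1 - p.2 = 0),
        (∫ t in (0:ℝ)..L, g q.1 t * g q.2 t) * ∫ s in (0:ℝ)..L, h q.1 s * h q.2 s =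
        ∑ μ ∈ latticeSet m, (∫ t in (0:ℝ)..L, g μ t ^ 2) * ∫ s in (0:ℝ)..L, h μ s ^ 2 := by
      rw [Finset.sum_filter, Finset.sum_product]
      refine Finset.sum_congr rfl fun μ hμ => ?_
      simp_rw [sub_eq_zero]
      rw [Finset.sum_ite_eq, if_pos hμ]
      simp_rw [sq]
    rw [ed] at b
    have b2 := b.trans (mul_le_mul_of_nonneg_left (hpairs m hm hN) (by positivity))
    rw [← Real.norm_eq_abs, ← Complex.norm_real, Complex.ofReal_sub, e, Complex.ofReal_mul]
    have ec : (((N⁻¹) ^ 2 : ℝ) : ℂ) = ((latN m : ℂ)⁻¹) ^ 2 := by rw [hNdef]; push_cast; rfl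
    rw [ec, ← mul_sub, norm_mul]
    have en : ‖((latN m : ℂ)⁻¹) ^ 2‖ = (N⁻¹) ^ 2 := by simp [hNdef]
    rw [en]
    calc (N⁻¹) ^ 2 * _ ≤ (N⁻¹) ^ 2 * (C * (2 * A ^ 2) ^ 2 * (C2 * √N)) := by gcongr
      _ = (C * (2 * A ^ 2) ^ 2 * C2) / (N * √N) := by
        field_simp; rw [Real.sq_sqrt hN0.le]; ring
      _ ≤ _ := by
        gcongr
        have : 0 ≤ C * (8 * A ^ 4) ^ 2 * C4 + 3 * (8 * A ^ 4 * L) ^ 2 := by positivity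
        linarith
  · obtain ⟨kg1, kg2⟩ := key4 hg
    obtain ⟨kh1, kh2⟩ := key4 hh
    have b := hosc (quads m) quadVec (8 * A ^ 4)
      (fun q t => (g q.1.1 t * g q.1.2 t) * (g q.2.1 t * g q.2.2 t)) _
      (fun q t => (h q.1.1 t * h q.1.2 t) * (h q.2.1 t * h q.2.2 t)) _
      kg1 kh1 (fun p => by fun_prop) (fun p => by fun_prop)
      (fun p hp t ht => (kg2 p hp t ht).1) (fun p hp t ht => (kg2 p hp t ht).2)
      (fun p hp t ht => (kh2 p hp t ht).1) (fun p hp t ht => (kh2 p hp t ht).2)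
    have e : ((∫ t in (0:ℝ)..L, ∫ s in (0:ℝ)..L, ‖P.corr m g h t s‖ ^ 4 : ℝ) : ℂ) =
        ((latN m : ℂ)⁻¹) ^ 4 * (∫ t in (0:ℝ)..L, ∫ s in (0:ℝ)..L,
          ∑ q ∈ quads m,
          ((((g q.1.1 t * g q.1.2 t) * (g q.2.1 t * g q.2.2 t)) *
          ((h q.1.1 s * h q.1.2 s) * (h q.2.1 s * h q.2.2 s)) : ℝ) : ℂ) *
          Complex.exp ((P.phase (quadVec q) t - P.phase (quadVec q) s : ℝ) * Complex.I)) := by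
      rw [← intervalIntegral.integral_ofReal]
      simp_rw [← intervalIntegral.integral_ofReal, corr_fourth, intervalIntegral.integral_const_mul]
    set D : ℝ := ∑ q ∈ (quads m).filter (fun q => quadVec q = 0),
        (∫ t in (0:ℝ)..L, (g q.1.1 t * g q.1.2 t) * (g q.2.1 t * g q.2.2 t)) *
        ∫ s in (0:ℝ)..L, (h q.1.1 s * h q.1.2 s) * (h q.2.1 s * h q.2.2 s) with hD
    have hDle : |D| ≤ 3 * N ^ 2 * (8 * A ^ 4 * L) ^ 2 := by
      have hint : ∀ {f f1 : ℤ × ℤ → ℝ → ℝ}, AmpBound L m A f f1 → ∀ q ∈ quads m,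
          |∫ t in (0:ℝ)..L, (f q.1.1 t * f q.1.2 t) * (f q.2.1 t * f q.2.2 t)| ≤ 8 * A ^ 4 * L := by
        intro f f1 hf q hq
        have := intervalIntegral.norm_integral_le_of_norm_le_const (a := 0) (b := L)
          (C := 8 * A ^ 4) (f := fun t => (f q.1.1 t * f q.1.2 t) * (f q.2.1 t * f q.2.2 t)) (by
            intro t ht
            rw [Set.uIoc_of_le hL.le] at ht
            exact ((key4 hf).2 q hq t ⟨ht.1.le, ht.2⟩).1)
        simpa [abs_of_pos hL] using this
      rw [hD, ← Real.norm_eq_abs]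
      refine (norm_sum_le_of_le (n := fun _ => (8 * A ^ 4 * L) ^ 2) _ fun q hq => ?_).trans ?_
      · have hq := (Finset.mem_filter.1 hq).1
        rw [Real.norm_eq_abs]
        exact abs_mul_le_sq (hint hg q hq) (hint hh q hq)
      · rw [Finset.sum_const, nsmul_eq_mul]
        gcongr
        rw [hNdef]
        exact_mod_cast card_quads_zero_le m
    have b2 := b.trans (mul_le_mul_of_nonneg_left (hquads m hm hN) (by positivity))
    have b3 := norm_le_of_mem_closedBall (mem_closedBall_iff_norm.2 b2) 
    rw [Complex.norm_real, Real.norm_eq_abs] at b3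
    refine (le_abs_self _).trans ?_
    rw [← Real.norm_eq_abs, ← Complex.norm_real, e, norm_mul]
    have en : ‖((latN m : ℂ)⁻¹) ^ 4‖ = (N⁻¹) ^ 4 := by simp [hNdef]
    rw [en]
    calc (N⁻¹) ^ 4 * _ ≤ (N⁻¹) ^ 4 * (3 * N ^ 2 * (8 * A ^ 4 * L) ^ 2 +
          C * (8 * A ^ 4) ^ 2 * (C4 * N ^ 2 * √N)) := by
          gcongr; exact b3.trans (by gcongr)
      _ ≤ (N⁻¹) ^ 4 * (3 * (N ^ 2 * √N) * (8 * A ^ 4 * L) ^ 2 +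
          C * (8 * A ^ 4) ^ 2 * (C4 * N ^ 2 * √N)) := by
          gcongr; nlinarith
      _ = (C * (8 * A ^ 4) ^ 2 * C4 + 3 * (8 * A ^ 4 * L) ^ 2) / (N * √N) := by
        field_simp; rw [Real.sq_sqrt hN0.le]; ring
      _ ≤ _ := by
        refine div_le_div_of_nonneg_right ?_ (by positivity)
        have : 0 ≤ C * (2 * A ^ 2) ^ 2 * C2 := by positivity
        have : 0 ≤ 3 * (8 * A ^ 4 * L) ^ 2 := by positivity
        linarith

end PlaneArc

lemma sum_latticeSet_neg {M : Type*} [AddCommMonoid M] (m : ℕ) (f : ℤ × ℤ → M) :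
    ∑ μ ∈ latticeSet m, f (-μ) = ∑ μ ∈ latticeSet m, f μ := by
  refine Finset.sum_nbij' (fun μ => -μ) (fun μ => -μ) ?_ ?_ ?_ ?_ ?_ <;> simp [mem_latticeSet]

lemma sum_latticeSet_rot {M : Type*} [AddCommMonoid M] (m : ℕ) (f : ℤ × ℤ → M) :
    ∑ μ ∈ latticeSet m, f (-μ.2, μ.1) = ∑ μ ∈ latticeSet m, f μ := by
  refine Finset.sum_nbij' (fun μ => (-μ.2, μ.1)) (fun μ => (μ.2, -μ.1)) ?_ ?_ ?_ ?_ ?_ <;>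
    simp [mem_latticeSet, add_comm]

lemma sum_eq_zero_of_odd (m : ℕ) (f : ℤ × ℤ → ℝ) (hf : ∀ μ, f (-μ) = -f μ) :
    ∑ μ ∈ latticeSet m, f μ = 0 := by
  have := sum_latticeSet_neg m f
  simp_rw [hf, Finset.sum_neg_distrib] at this
  linarith

lemma lattice_real {m : ℕ} {μ : ℤ × ℤ} (h : μ ∈ latticeSet m) :
    (μ.1 : ℝ) ^ 2 + (μ.2 : ℝ) ^ 2 = m := by
  have := mem_latticeSet.1 h
  exact_mod_cast this

namespace PlaneArc
variable {L : ℝ} (P : PlaneArc L)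

/-- The tangential component `⟨μ, γ'(t)⟩ / √m`. -/
def tang (m : ℕ) (μ : ℤ × ℤ) (t : ℝ) : ℝ := (μ.1 / √m) * P.x1 t + (μ.2 / √m) * P.y1 t

@[fun_prop]
lemma continuous_tang (m : ℕ) (μ : ℤ × ℤ) : Continuous (P.tang m μ) := by
  have := P.cx1
  have := P.cy1
  unfold tang; fun_prop

lemma tang_neg (m : ℕ) (μ : ℤ × ℤ) (t : ℝ) : P.tang m (-μ) t = -P.tang m μ t := by
  simp [tang]; ring

/-- The covariance function of the wave along the arc. -/
def rr (m : ℕ) (t s : ℝ) : ℝ := (latN m : ℝ)⁻¹ *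
  ∑ μ ∈ latticeSet m, Real.cos (P.phase μ t - P.phase μ s)

/-- The normalised first derivative of the covariance function in the first variable. -/
def aa (m : ℕ) (t s : ℝ) : ℝ := -((latN m : ℝ)⁻¹ *
  ∑ μ ∈ latticeSet m, √2 * P.tang m μ t * Real.sin (P.phase μ t - P.phase μ s))

/-- The normalised first derivative of the covariance function in the second variable. -/
def bb (m : ℕ) (t s : ℝ) : ℝ := (latN m : ℝ)⁻¹ *
  ∑ μ ∈ latticeSet m, √2 * P.tang m μ s * Real.sin (P.phase μ t - P.phase μ s)

/-- The normalised mixed second derivative of the covariance function. -/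
def cc (m : ℕ) (t s : ℝ) : ℝ := (latN m : ℝ)⁻¹ *
  ∑ μ ∈ latticeSet m, 2 * (P.tang m μ t * P.tang m μ s) * Real.cos (P.phase μ t - P.phase μ s)

lemma continuous_rr (m : ℕ) : Continuous (fun p : ℝ × ℝ => P.rr m p.1 p.2) := by
  unfold rr; fun_prop
lemma continuous_aa (m : ℕ) : Continuous (fun p : ℝ × ℝ => P.aa m p.1 p.2) := by
  unfold aa; fun_prop
lemma continuous_bb (m : ℕ) : Continuous (fun p : ℝ × ℝ => P.bb m p.1 p.2) := by
  unfold bb; fun_prop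
lemma continuous_cc (m : ℕ) : Continuous (fun p : ℝ × ℝ => P.cc m p.1 p.2) := by
  unfold cc; fun_prop

lemma corr_eq (m : ℕ) (g h : ℤ × ℤ → ℝ → ℝ) (t s : ℝ) : P.corr m g h t s =
    (((latN m : ℝ)⁻¹ * ∑ μ ∈ latticeSet m, (g μ t * h μ s) *
      Real.cos (P.phase μ t - P.phase μ s) : ℝ) : ℂ) +
    (((latN m : ℝ)⁻¹ * ∑ μ ∈ latticeSet m, (g μ t * h μ s) *
      Real.sin (P.phase μ t - P.phase μ s) : ℝ) : ℂ) * Complex.I := by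
  unfold corr
  simp only [Complex.exp_mul_I, mul_add, Finset.sum_add_distrib]
  push_cast
  congr 1
  simp only [Finset.sum_mul, Finset.mul_sum]
  refine Finset.sum_congr rfl fun μ _ => by ring

lemma norm_corr_even (m : ℕ) (g h : ℤ × ℤ → ℝ → ℝ) (t s : ℝ)
    (he : ∀ μ, g (-μ) t * h (-μ) s = g μ t * h μ s) : ‖P.corr m g h t s‖ =
    |(latN m : ℝ)⁻¹ * ∑ μ ∈ latticeSet m, (g μ t * h μ s) *
      Real.cos (P.phase μ t - P.phase μ s)| := by
  rw [corr_eq, sum_eq_zero_of_odd m (fun μ => (g μ t * h μ s) *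
    Real.sin (P.phase μ t - P.phase μ s)), mul_zero, Complex.ofReal_zero, zero_mul, add_zero,
    Complex.norm_real, Real.norm_eq_abs]
  intro μ
  rw [he, phase_neg, phase_neg, show -P.phase μ t - -P.phase μ s =
    -(P.phase μ t - P.phase μ s) by ring, Real.sin_neg]
  ring

lemma norm_corr_odd (m : ℕ) (g h : ℤ × ℤ → ℝ → ℝ) (t s : ℝ)
    (he : ∀ μ, g (-μ) t * h (-μ) s = -(g μ t * h μ s)) : ‖P.corr m g h t s‖ =
    |(latN m : ℝ)⁻¹ * ∑ μ ∈ latticeSet m, (g μ t * h μ s) *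
      Real.sin (P.phase μ t - P.phase μ s)| := by
  rw [corr_eq, sum_eq_zero_of_odd m (fun μ => (g μ t * h μ s) *
    Real.cos (P.phase μ t - P.phase μ s)), mul_zero, Complex.ofReal_zero, zero_add, norm_mul,
    Complex.norm_I, mul_one, Complex.norm_real, Real.norm_eq_abs]
  intro μ
  rw [he, phase_neg, phase_neg, show -P.phase μ t - -P.phase μ s =
    -(P.phase μ t - P.phase μ s) by ring, Real.cos_neg]
  ring

lemma norm_corr_one_one (m : ℕ) (t s : ℝ) :
    ‖P.corr m (fun _ _ => 1) (fun _ _ => 1) t s‖ = |P.rr m t s| := by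
  rw [norm_corr_even _ _ _ _ _ _ (by simp)]; simp [rr]

lemma norm_corr_tang_one (m : ℕ) (t s : ℝ) :
    ‖P.corr m (fun μ t => √2 * P.tang m μ t) (fun _ _ => 1) t s‖ = |P.aa m t s| := by
  rw [norm_corr_odd _ _ _ _ _ _ (by simp [tang_neg])]; simp only [aa, abs_neg, mul_one]

lemma norm_corr_one_tang (m : ℕ) (t s : ℝ) :
    ‖P.corr m (fun _ _ => 1) (fun μ t => √2 * P.tang m μ t) t s‖ = |P.bb m t s| := by
  rw [norm_corr_odd _ _ _ _ _ _ (by simp [tang_neg])]; simp only [bb, one_mul]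

lemma norm_corr_tang_tang (m : ℕ) (t s : ℝ) :
    ‖P.corr m (fun μ t => √2 * P.tang m μ t) (fun μ t => √2 * P.tang m μ t) t s‖ =
      |P.cc m t s| := by
  rw [norm_corr_even _ _ _ _ _ _ (by simp [tang_neg])]
  unfold cc
  congr 2
  refine Finset.sum_congr rfl fun μ _ => ?_
  have : √2 * √2 = 2 := by simp
  linear_combination P.tang m μ t * P.tang m μ s * Real.cos (P.phase μ t - P.phase μ s) * this

lemma sum_tang_sq {m : ℕ} (hm : 0 < m) {t : ℝ} (ht : t ∈ Set.Icc 0 L) :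
    ∑ μ ∈ latticeSet m, 2 * P.tang m μ t ^ 2 = (latN m : ℝ) := by
  have hm0 : (0:ℝ) < m := by exact_mod_cast hm
  have h1 := sum_latticeSet_rot m (fun μ => P.tang m μ t ^ 2)
  have h2 : ∑ μ ∈ latticeSet m, P.tang m (-μ.2, μ.1) t ^ 2 + ∑ μ ∈ latticeSet m, P.tang m μ t ^ 2
      = (latN m : ℝ) := by
    rw [← Finset.sum_add_distrib, latN, Finset.card_eq_sum_ones, Nat.cast_sum]
    refine Finset.sum_congr rfl fun μ hμ => ?_
    have e := lattice_real hμ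
    have e2 := P.unit t ht
    have e3 : √(m:ℝ) ^ 2 = m := Real.sq_sqrt hm0.le
    have e4 : √(m:ℝ) ≠ 0 := (Real.sqrt_pos.2 hm0).ne'
    simp only [tang]
    push_cast
    field_simp
    rw [e3]
    linear_combination (m:ℝ) * e2 + (P.x1 t ^ 2 + P.y1 t ^ 2) * e
  rw [← Finset.mul_sum]
  linarith

lemma tang_bound {A : ℝ} (hA : 1 ≤ A) (hb : ∀ t ∈ Set.Icc 0 L, P.x2 t ^ 2 + P.y2 t ^ 2 ≤ A ^ 2)
    {m : ℕ} (hm : 0 < m) : AmpBound L m (√2 * A) (fun μ t => √2 * P.tang m μ t)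
      (fun μ t => √2 * ((μ.1 / √m) * P.x2 t + (μ.2 / √m) * P.y2 t)) := by
  have cx2 := P.cx2
  have cy2 := P.cy2
  have hm0 : (0:ℝ) < m := by exact_mod_cast hm
  have hunit : ∀ μ ∈ latticeSet m, ((μ.1:ℝ) / √m) ^ 2 + ((μ.2:ℝ) / √m) ^ 2 = 1 := by
    intro μ hμ
    rw [div_pow, div_pow, Real.sq_sqrt hm0.le, ← add_div, lattice_real hμ, div_self hm0.ne']
  refine ⟨fun μ t => ?_, fun μ => by fun_prop, fun μ hμ t ht => ?_, fun μ hμ t ht => ?_⟩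
  · exact (((P.hx1 t).const_mul _).add ((P.hy1 t).const_mul _)).const_mul _
  · rw [abs_mul, abs_of_nonneg (Real.sqrt_nonneg _)]
    gcongr
    refine abs_dot_le (by linarith) (hunit μ hμ) ?_
    rw [P.unit t ht]; nlinarith
  · rw [abs_mul, abs_of_nonneg (Real.sqrt_nonneg _)]
    gcongr
    exact abs_dot_le (by linarith) (hunit μ hμ) (hb t ht)

lemma Bconst_eq {γ : ℝ → ℝ × ℝ} (hγ : ∀ t, deriv γ t = (P.x1 t, P.y1 t)) {m : ℕ} :
    4 * Bconst m γ L = (latN m : ℝ)⁻¹ * ∑ μ ∈ latticeSet m,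
      (∫ t in (0:ℝ)..L, (√2 * P.tang m μ t) ^ 2) * ∫ s in (0:ℝ)..L, (√2 * P.tang m μ s) ^ 2 := by
  have e : ∀ t s, (latN m : ℝ)⁻¹ *
      ∑ μ ∈ latticeSet m,
        (((μ.1 : ℝ) / Real.sqrt ((μ.1 : ℝ) ^ 2 + (μ.2 : ℝ) ^ 2) * (deriv γ t).1 +
          (μ.2 : ℝ) / Real.sqrt ((μ.1 : ℝ) ^ 2 + (μ.2 : ℝ) ^ 2) * (deriv γ t).2) ^ 2 *
         ((μ.1 : ℝ) / Real.sqrt ((μ.1 : ℝ) ^ 2 + (μ.2 : ℝ) ^ 2) * (deriv γ s).1 +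
          (μ.2 : ℝ) / Real.sqrt ((μ.1 : ℝ) ^ 2 + (μ.2 : ℝ) ^ 2) * (deriv γ s).2) ^ 2) =
      ∑ μ ∈ latticeSet m, ((4 * (latN m : ℝ))⁻¹ * (√2 * P.tang m μ t) ^ 2) *
        (√2 * P.tang m μ s) ^ 2 := by
    intro t s
    rw [Finset.mul_sum]
    refine Finset.sum_congr rfl fun μ hμ => ?_
    rw [lattice_real hμ, hγ, hγ, mul_pow, mul_pow, Real.sq_sqrt (by norm_num)]
    simp only [tang, mul_inv]; ring
  unfold Bconst
  simp_rw [e]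
  have e2 : ∀ t, ∫ s in (0:ℝ)..L, ∑ μ ∈ latticeSet m, ((4 * (latN m : ℝ))⁻¹ * (√2 * P.tang m μ t) ^ 2) *
        (√2 * P.tang m μ s) ^ 2 = ∑ μ ∈ latticeSet m, ((4 * (latN m : ℝ))⁻¹ * (√2 * P.tang m μ t) ^ 2) *
        ∫ s in (0:ℝ)..L, (√2 * P.tang m μ s) ^ 2 := by
    intro t
    rw [intervalIntegral.integral_finsetSum]
    · simp_rw [intervalIntegral.integral_const_mul]
    · intro μ _; apply Continuous.intervalIntegrable; fun_prop
  simp_rw [e2]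
  rw [intervalIntegral.integral_finsetSum, Finset.mul_sum, Finset.mul_sum]
  · refine Finset.sum_congr rfl fun μ _ => ?_
    rw [intervalIntegral.integral_mul_const, intervalIntegral.integral_const_mul, mul_inv]; ring
  · intro μ _; apply Continuous.intervalIntegrable; fun_prop

/-- The second and fourth moments of the covariance functions along the arc. -/
theorem exists_moments {γ : ℝ → ℝ × ℝ} (hγ : ∀ t, deriv γ t = (P.x1 t, P.y1 t)) :
    ∃ C > 0, ∀ m : ℕ, 0 < m → 0 < latN m →
    |(∫ t in (0:ℝ)..L, ∫ s in (0:ℝ)..L,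
        (P.rr m t s ^ 2 - P.aa m t s ^ 2 - P.bb m t s ^ 2 + P.cc m t s ^ 2)) -
      (4 * Bconst m γ L - L ^ 2) / latN m| ≤ C / (latN m * √(latN m)) ∧
    (∫ t in (0:ℝ)..L, ∫ s in (0:ℝ)..L,
        (P.rr m t s ^ 4 + P.aa m t s ^ 4 + P.bb m t s ^ 4 + P.cc m t s ^ 4)) ≤
      C / (latN m * √(latN m)) := by
  obtain ⟨A, hA, κ, hκ, hκ1, hb⟩ := P.exists_bounds
  obtain ⟨C, hC, hmom⟩ := P.exists_corr_moments (√2 * A)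
  refine ⟨4 * C, by positivity, fun m hm hN => ?_⟩
  have hN0 : (0:ℝ) < latN m := by exact_mod_cast hN
  have ht := P.tang_bound hA (fun t ht => (hb t ht).1) hm
  have h2 : 1 ≤ √2 * A := by
    have : 1 ≤ √2 := by rw [Real.one_le_sqrt]; norm_num
    nlinarith
  have h1 : AmpBound L m (√2 * A) (fun _ _ => 1) (fun _ _ => 0) :=
    ⟨fun μ t => hasDerivAt_const _ _, fun μ => continuous_const, fun _ _ _ _ => by simpa using h2,
      fun _ _ _ _ => by simp; positivity⟩
  obtain ⟨r2, r4⟩ := hmom m hm hN _ _ _ _ h1 h1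
  obtain ⟨a2, a4⟩ := hmom m hm hN _ _ _ _ ht h1
  obtain ⟨b2, b4⟩ := hmom m hm hN _ _ _ _ h1 ht
  obtain ⟨c2, c4⟩ := hmom m hm hN _ _ _ _ ht ht
  have cr := P.continuous_rr m
  have ca := P.continuous_aa m
  have cb := P.continuous_bb m
  have cc := P.continuous_cc m
  have e4 : ∀ x : ℝ, |x| ^ 4 = x ^ 4 := fun x => by
    rw [show |x| ^ 4 = (|x| ^ 2) ^ 2 by ring, sq_abs]; ring
  simp only [norm_corr_one_one, norm_corr_tang_one, norm_corr_one_tang, norm_corr_tang_tang,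
    sq_abs, e4] at r2 r4 a2 a4 b2 b4 c2 c4
  have hadd : ∀ (f1 f2 f3 f4 : ℝ → ℝ → ℝ), (Continuous fun p : ℝ × ℝ => f1 p.1 p.2) →
      (Continuous fun p : ℝ × ℝ => f2 p.1 p.2) → (Continuous fun p : ℝ × ℝ => f3 p.1 p.2) →
      (Continuous fun p : ℝ × ℝ => f4 p.1 p.2) → ∀ x y z w : ℝ,
      ∫ t in (0:ℝ)..L, ∫ s in (0:ℝ)..L, (x * f1 t s + y * f2 t s + z * f3 t s + w * f4 t s) =
      x * (∫ t in (0:ℝ)..L, ∫ s in (0:ℝ)..L, f1 t s) +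
      y * (∫ t in (0:ℝ)..L, ∫ s in (0:ℝ)..L, f2 t s) +
      z * (∫ t in (0:ℝ)..L, ∫ s in (0:ℝ)..L, f3 t s) +
      w * (∫ t in (0:ℝ)..L, ∫ s in (0:ℝ)..L, f4 t s) := by
    intro f1 f2 f3 f4 c1 c2 c3 c4 x y z w
    have k : ∀ f : ℝ → ℝ → ℝ, (Continuous fun p : ℝ × ℝ => f p.1 p.2) → ∀ t, Continuous (f t) :=
      fun f hf t => hf.comp (continuous_const.prodMk continuous_id)
    have k1 := k f1 c1
    have k2 := k f2 c2
    have k3 := k f3 c3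
    have k4 := k f4 c4
    have j : ∀ f : ℝ → ℝ → ℝ, (Continuous fun p : ℝ × ℝ => f p.1 p.2) →
        Continuous fun t => ∫ s in (0:ℝ)..L, f t s := fun f hf =>
      intervalIntegral.continuous_parametric_intervalIntegral_of_continuous' hf 0 L
    have j1 := j f1 c1
    have j2 := j f2 c2
    have j3 := j f3 c3
    have j4 := j f4 c4
    have e : ∀ t, ∫ s in (0:ℝ)..L, (x * f1 t s + y * f2 t s + z * f3 t s + w * f4 t s) =
        x * (∫ s in (0:ℝ)..L, f1 t s) + y * (∫ s in (0:ℝ)..L, f2 t s) +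
        z * (∫ s in (0:ℝ)..L, f3 t s) + w * (∫ s in (0:ℝ)..L, f4 t s) := by
      intro t
      rw [intervalIntegral.integral_add, intervalIntegral.integral_add,
        intervalIntegral.integral_add]
      · simp_rw [intervalIntegral.integral_const_mul]
      all_goals apply Continuous.intervalIntegrable; fun_prop
    simp_rw [e]
    rw [intervalIntegral.integral_add, intervalIntegral.integral_add, intervalIntegral.integral_add]
    · simp_rw [intervalIntegral.integral_const_mul]
    all_goals apply Continuous.intervalIntegrable; fun_prop
  have q2 := hadd (fun t s => P.rr m t s ^ 2) (fun t s => P.aa m t s ^ 2) (fun t s => P.bb m t s ^ 2)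
    (fun t s => P.cc m t s ^ 2) (by fun_prop) (by fun_prop) (by fun_prop) (by fun_prop) 1 (-1) (-1) 1
  have q4 := hadd (fun t s => P.rr m t s ^ 4) (fun t s => P.aa m t s ^ 4) (fun t s => P.bb m t s ^ 4)
    (fun t s => P.cc m t s ^ 4) (by fun_prop) (by fun_prop) (by fun_prop) (by fun_prop) 1 1 1 1
  simp only [one_mul, neg_mul, ← sub_eq_add_neg] at q2 q4
  have hT : ∑ μ ∈ latticeSet m, ∫ t in (0:ℝ)..L, (√2 * P.tang m μ t) ^ 2 = (latN m : ℝ) * L := by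
    rw [← intervalIntegral.integral_finsetSum]
    · have : Set.EqOn (fun t => ∑ μ ∈ latticeSet m, (√2 * P.tang m μ t) ^ 2)
          (fun _ => (latN m : ℝ)) (Set.uIcc 0 L) := by
        intro t ht'
        rw [Set.uIcc_of_le P.pos.le] at ht'
        simp only [mul_pow, Real.sq_sqrt (show (0:ℝ) ≤ 2 by norm_num)]
        exact P.sum_tang_sq hm ht'
      rw [intervalIntegral.integral_congr this]
      simp [mul_comm]
    · intro μ _; apply Continuous.intervalIntegrable; fun_prop
  have dr : ((latN m : ℝ)⁻¹) ^ 2 * ∑ μ ∈ latticeSet m, (∫ t in (0:ℝ)..L, (1:ℝ) ^ 2) *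
        ∫ s in (0:ℝ)..L, (1:ℝ) ^ 2 = L ^ 2 / latN m := by
    simp only [one_pow, integral_one, sub_zero, Finset.sum_const, nsmul_eq_mul]
    rw [← latN]; field_simp
  have da : ((latN m : ℝ)⁻¹) ^ 2 * ∑ μ ∈ latticeSet m, (∫ t in (0:ℝ)..L, (√2 * P.tang m μ t) ^ 2) *
        ∫ s in (0:ℝ)..L, (1:ℝ) ^ 2 = L ^ 2 / latN m := by
    rw [← Finset.sum_mul, hT]
    simp only [one_pow, integral_one, sub_zero]; field_simp
  have db : ((latN m : ℝ)⁻¹) ^ 2 * ∑ μ ∈ latticeSet m, (∫ t in (0:ℝ)..L, (1:ℝ) ^ 2) *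
        ∫ s in (0:ℝ)..L, (√2 * P.tang m μ s) ^ 2 = L ^ 2 / latN m := by
    rw [← Finset.mul_sum, hT]
    simp only [one_pow, integral_one, sub_zero]; field_simp
  rw [dr] at r2
  rw [da] at a2
  rw [db] at b2
  rw [sq, mul_assoc, ← P.Bconst_eq hγ] at c2
  have cpos : 0 < C / (latN m * √(latN m)) := by positivity
  refine ⟨?_, ?_⟩
  · rw [q2, mul_div_assoc]
    have e : (4 * Bconst m γ L - L ^ 2) / latN m = L ^ 2 / latN m - L ^ 2 / latN m - L ^ 2 / latN m +
      (latN m : ℝ)⁻¹ * (4 * Bconst m γ L) := by ring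
    rw [e, abs_le]
    rw [abs_le] at r2 a2 b2 c2
    constructor <;> linarith
  · rw [q4, mul_div_assoc]; linarith

end PlaneArc

section GaussianSplitting

open scoped RealInnerProductSpace ENNReal

/-- In dimension at least two every vector lies in a plane spanned by a given unit vector and
a second unit vector orthogonal to it. -/
lemma exists_orthogonal_unit {H : Type*} [NormedAddCommGroup H] [InnerProductSpace ℝ H]
    [FiniteDimensional ℝ H] (hdim : 2 ≤ Module.finrank ℝ H) {n : H} (hn : ‖n‖ = 1) (v : H) :
    ∃ n' : H, ‖n'‖ = 1 ∧ ⟪n, n'⟫ = 0 ∧ v = ⟪n, v⟫ • n + ⟪n', v⟫ • n' := by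
  have hnn : ⟪n, n⟫ = 1 := by rw [real_inner_self_eq_norm_sq, hn]; norm_num
  by_cases hv : v - ⟪n, v⟫ • n = 0
  · obtain ⟨w, hw, hw0⟩ : ∃ w : H, w ∈ (Submodule.span ℝ {n})ᗮ ∧ w ≠ 0 := by
      have : (Submodule.span ℝ {n})ᗮ ≠ ⊥ := by
        intro h
        have h1 := Submodule.finrank_add_finrank_orthogonal (Submodule.span ℝ {n})
        rw [h, finrank_bot] at h1
        have h2 := finrank_span_le_card (R := ℝ) ({n} : Set H)
        simp at h2
        omega
      exact Submodule.exists_mem_ne_zero_of_ne_bot this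
    have hnw : ⟪n, w⟫ = 0 := by
      rw [Submodule.mem_orthogonal_singleton_iff_inner_right] at hw
      exact hw
    refine ⟨‖w‖⁻¹ • w, ?_, ?_, ?_⟩
    · rw [norm_smul, norm_inv, norm_norm, inv_mul_cancel₀ (norm_ne_zero_iff.2 hw0)]
    · rw [real_inner_smul_right, hnw, mul_zero]
    · have hwv : ⟪w, v⟫ = 0 := by
        rw [sub_eq_zero.1 hv, real_inner_smul_right, real_inner_comm n w, hnw, mul_zero]
      rw [real_inner_smul_left, hwv, mul_zero, zero_smul, add_zero]
      exact sub_eq_zero.1 hv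
  · set w := v - ⟪n, v⟫ • n with hw
    have hnw : ⟪n, w⟫ = 0 := by
      rw [hw, inner_sub_right, real_inner_smul_right, hnn]; ring
    refine ⟨‖w‖⁻¹ • w, ?_, ?_, ?_⟩
    · rw [norm_smul, norm_inv, norm_norm, inv_mul_cancel₀ (norm_ne_zero_iff.2 hv)]
    · rw [real_inner_smul_right, hnw, mul_zero]
    · have hv' : v = ⟪n, v⟫ • n + w := by rw [hw]; abel
      have hwv : ⟪w, v⟫ = ‖w‖ ^ 2 := by
        conv_lhs => rw [hv', inner_add_right, real_inner_smul_right, real_inner_comm n w, hnw,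
          real_inner_self_eq_norm_sq]
        ring
      have h0 := norm_ne_zero_iff.2 hv
      rw [real_inner_smul_left, hwv, smul_smul]
      have : ‖w‖⁻¹ * ‖w‖ ^ 2 * ‖w‖⁻¹ = 1 := by field_simp
      rw [this, one_smul]
      exact hv'

variable {H : Type*} [NormedAddCommGroup H] [InnerProductSpace ℝ H] [FiniteDimensional ℝ H]
  [MeasurableSpace H] [BorelSpace H]

/-- The standard Gaussian law splits along a unit vector. -/
lemma stdGaussian_eq_map_split {e : H} (he : ‖e‖ = 1) :
    stdGaussian H = ((gaussianReal 0 1).prod (stdGaussian H)).map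
      (fun p : ℝ × H => p.1 • e + (p.2 - ⟪e, p.2⟫ • e)) := by
  have hm : Measurable (fun p : ℝ × H => p.1 • e + (p.2 - ⟪e, p.2⟫ • e)) := by fun_prop
  have : IsProbabilityMeasure (((gaussianReal 0 1).prod (stdGaussian H)).map
      (fun p : ℝ × H => p.1 • e + (p.2 - ⟪e, p.2⟫ • e))) :=
    Measure.isProbabilityMeasure_map hm.aemeasurable
  apply Measure.ext_of_charFun
  ext t
  rw [charFun_stdGaussian, charFun_apply, integral_map hm.aemeasurable (by fun_prop)]
  have h1 : ∀ p : ℝ × H, Complex.exp (⟪p.1 • e + (p.2 - ⟪e, p.2⟫ • e), t⟫ * Complex.I)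
      = Complex.exp (⟪e, t⟫ * p.1 * Complex.I) *
        Complex.exp (⟪p.2, t - ⟪e, t⟫ • e⟫ * Complex.I) := by
    intro p
    rw [← Complex.exp_add]
    congr 1
    have : ⟪p.1 • e + (p.2 - ⟪e, p.2⟫ • e), t⟫ = ⟪e, t⟫ * p.1 + ⟪p.2, t - ⟪e, t⟫ • e⟫ := by
      simp only [inner_add_left, inner_sub_left, inner_sub_right, real_inner_smul_left,
        real_inner_smul_right, real_inner_comm p.2 e]
      ring
    rw [this]
    push_cast
    ring
  simp_rw [h1]
  rw [integral_prod_mul (fun x : ℝ => Complex.exp (⟪e, t⟫ * x * Complex.I))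
    (fun ξ : H => Complex.exp (⟪ξ, t - ⟪e, t⟫ • e⟫ * Complex.I)), ← charFun_apply_real,
    ← charFun_apply, charFun_gaussianReal, charFun_stdGaussian, ← Complex.exp_add]
  congr 1
  have h2 : ‖t - ⟪e, t⟫ • e‖ ^ 2 = ‖t‖ ^ 2 - ⟪e, t⟫ ^ 2 := by
    rw [norm_sub_sq_real, norm_smul, he, real_inner_smul_right, real_inner_comm, mul_one,
      Real.norm_eq_abs, sq_abs]
    ring
  rw [← Complex.ofReal_pow ‖t - _‖, h2]
  push_cast
  ring

lemma lintegral_stdGaussian_split {e : H} (he : ‖e‖ = 1) {F : H → ℝ≥0∞} (hF : Measurable F) :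
    ∫⁻ ξ, F ξ ∂stdGaussian H = ∫⁻ x, ∫⁻ ξ, F (x • e + (ξ - ⟪e, ξ⟫ • e)) ∂stdGaussian H
      ∂gaussianReal 0 1 := by
  conv_lhs => rw [stdGaussian_eq_map_split he]
  have hm : Measurable (fun p : ℝ × H => p.1 • e + (p.2 - ⟪e, p.2⟫ • e)) := by fun_prop
  rw [lintegral_map hF hm]
  exact lintegral_prod _ (hF.comp hm).aemeasurable

lemma lintegral_stdGaussian_split₂ {e f : H} (he : ‖e‖ = 1) (hf : ‖f‖ = 1) (hef : ⟪e, f⟫ = 0)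
    {F : H → ℝ≥0∞} (hF : Measurable F) :
    ∫⁻ ξ, F ξ ∂stdGaussian H = ∫⁻ x, ∫⁻ y, ∫⁻ ξ,
      F (x • e + y • f + (ξ - ⟪e, ξ⟫ • e - ⟪f, ξ⟫ • f)) ∂stdGaussian H
      ∂gaussianReal 0 1 ∂gaussianReal 0 1 := by
  rw [lintegral_stdGaussian_split he hF]
  refine lintegral_congr fun x => ?_
  have hm : Measurable (fun ξ : H => F (x • e + (ξ - ⟪e, ξ⟫ • e))) := hF.comp (by fun_prop)
  rw [lintegral_stdGaussian_split hf hm]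
  refine lintegral_congr fun y => lintegral_congr fun ξ => ?_
  congr 1
  simp only [inner_add_right, inner_sub_right, real_inner_smul_right, hef]
  module

end GaussianSplitting

open scoped ENNReal NNReal in
/-- The one-dimensional area formula with multiplicity. -/
lemma lintegral_abs_deriv_mul_comp {S : Set ℝ} (hS : MeasurableSet S) {X X' : ℝ → ℝ}
    (hX : Measurable X) (hX' : Measurable X')
    (hd : ∀ s ∈ S, HasDerivWithinAt X (X' s) S s) {g : ℝ → ℝ≥0∞} (hg : Measurable g) :
    ∫⁻ s in S, ENNReal.ofReal |X' s| * g (X s)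
      = ∫⁻ y, Measure.count (S ∩ X ⁻¹' {y}) * g y := by
  classical
  set S0 : Set ℝ := S ∩ X' ⁻¹' {0} with hS0
  set S1 : Set ℝ := S \ X' ⁻¹' {0} with hS1
  have hS0m : MeasurableSet S0 := hS.inter (hX' (measurableSet_singleton 0))
  have hS1m : MeasurableSet S1 := hS.diff (hX' (measurableSet_singleton 0))
  have hd1 : ∀ s ∈ S1, HasDerivWithinAt X (X' s) S1 s := fun s hs =>
    (hd s hs.1).mono Set.sdiff_subset
  have hsard : volume (X '' S0) = 0 := by
    refine addHaar_image_eq_zero_of_det_fderivWithin_eq_zero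
      (f' := fun s => ContinuousLinearMap.toSpanSingleton ℝ (X' s)) volume
      (fun s hs => ((hd s hs.1).mono Set.inter_subset_left).hasFDerivWithinAt) ?_
    intro s hs
    have : X' s = 0 := hs.2
    rw [ContinuousLinearMap.det_toSpanSingleton, this]
  obtain ⟨t, A, htd, htm, htc, hta, hte⟩ :=
    exists_partition_approximatesLinearOn_of_hasFDerivWithinAt X S1
      (fun s => ContinuousLinearMap.toSpanSingleton ℝ (X' s))
      (fun s hs => (hd1 s hs).hasFDerivWithinAt)
      (fun A => if A = 0 then 1 else ‖A‖₊ / 2) (by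
        intro A
        split_ifs with h
        · exact one_ne_zero
        · exact div_ne_zero (nnnorm_ne_zero_iff.2 h) two_ne_zero)
  have hinj : ∀ n, Set.InjOn X (S1 ∩ t n) := by
    intro n x hx y hy hxy
    obtain ⟨z, hz, hAz⟩ := hte ⟨x, hx.1⟩ n
    have hA0 : A n ≠ 0 := by
      intro h
      have h1 : A n 1 = X' z := by rw [hAz]; simp
      rw [h] at h1
      exact hz.2 (by simpa using h1.symm)
    have h2 := hta n x hx y hy
    rw [if_neg hA0, hxy, sub_self, zero_sub, norm_neg] at h2
    have h3 : ‖A n (x - y)‖ = ‖A n‖ * ‖x - y‖ := by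
      have h4 : ∀ z : ℝ, A n z = z * A n 1 := fun z => by
        rw [← smul_eq_mul, ← map_smul, smul_eq_mul, mul_one]
      have h5 : ‖A n‖ = ‖A n 1‖ := by
        conv_lhs => rw [hAz]
        rw [hAz]
        simp
      rw [h4, norm_mul, h5, mul_comm]
    rw [h3] at h2
    push_cast at h2
    have h6 : 0 < ‖A n‖ := norm_pos_iff.2 hA0
    have h7 : ‖x - y‖ ≤ 0 := by
      by_contra hcon
      push Not at hcon
      have := mul_pos h6 hcon
      linarith
    exact sub_eq_zero.1 (norm_le_zero_iff.1 h7)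
  have hpm : ∀ n, MeasurableSet (S1 ∩ t n) := fun n => hS1m.inter (htm n)
  have hcov : S1 = ⋃ n, S1 ∩ t n := by
    rw [← Set.inter_iUnion]
    exact (Set.inter_eq_left.2 htc).symm
  have hdisj : Pairwise (Function.onFun Disjoint fun n => S1 ∩ t n) := fun i j hij =>
    (htd hij).mono Set.inter_subset_right Set.inter_subset_right
  have himg : ∀ n, MeasurableSet (X '' (S1 ∩ t n)) := fun n =>
    (hpm n).image_of_continuousOn_injOn
      (fun s hs => ((hd1 s hs.1).continuousWithinAt).mono Set.inter_subset_left) (hinj n)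
  have hcount : ∀ y n, Measure.count ((S1 ∩ t n) ∩ X ⁻¹' {y})
      = (X '' (S1 ∩ t n)).indicator (1 : ℝ → ℝ≥0∞) y := by
    intro y n
    by_cases hy : y ∈ X '' (S1 ∩ t n)
    · obtain ⟨s, hs, rfl⟩ := hy
      rw [Set.indicator_of_mem (Set.mem_image_of_mem _ hs)]
      have : (S1 ∩ t n) ∩ X ⁻¹' {X s} = {s} := by
        ext u
        constructor
        · rintro ⟨hu, hu'⟩
          exact hinj n hu hs hu'
        · rintro rfl
          exact ⟨hs, rfl⟩
      rw [this, Measure.count_singleton]; rfl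
    · rw [Set.indicator_of_notMem hy]
      have : (S1 ∩ t n) ∩ X ⁻¹' {y} = ∅ := by
        ext u
        simp only [Set.mem_inter_iff, Set.mem_empty_iff_false, iff_false]
        rintro ⟨hu, hu'⟩
        exact hy ⟨u, hu, hu'⟩
      rw [this, measure_empty]
  have hcS1 : ∀ y, Measure.count (S1 ∩ X ⁻¹' {y})
      = ∑' n, (X '' (S1 ∩ t n)).indicator (1 : ℝ → ℝ≥0∞) y := by
    intro y
    simp_rw [← hcount y]
    rw [← measure_iUnion, ← Set.iUnion_inter, ← hcov]
    · exact fun i j hij => (hdisj hij).mono Set.inter_subset_left Set.inter_subset_left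
    · exact fun n => (hpm n).inter (hX (measurableSet_singleton y))
  calc ∫⁻ s in S, ENNReal.ofReal |X' s| * g (X s)
      = ∫⁻ s in S1, ENNReal.ofReal |X' s| * g (X s) := by
        rw [← lintegral_inter_add_sdiff _ S (hX' (measurableSet_singleton 0))]
        rw [setLIntegral_congr_fun hS0m (g := fun _ => 0), lintegral_zero, zero_add]
        intro s hs
        have : X' s = 0 := hs.2
        simp [this]
    _ = ∑' n, ∫⁻ s in S1 ∩ t n, ENNReal.ofReal |X' s| * g (X s) := by
        conv_lhs => rw [hcov]
        exact lintegral_iUnion hpm hdisj _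
    _ = ∑' n, ∫⁻ y, (X '' (S1 ∩ t n)).indicator (1 : ℝ → ℝ≥0∞) y * g y := by
        refine tsum_congr fun n => ?_
        rw [← lintegral_image_eq_lintegral_abs_deriv_mul (hpm n)
          (fun s hs => (hd1 s hs.1).mono Set.inter_subset_left) (hinj n),
          ← lintegral_indicator (himg n)]
        refine lintegral_congr fun y => ?_
        by_cases hy : y ∈ X '' (S1 ∩ t n)
        · simp only [Set.indicator_of_mem hy, Pi.one_apply, one_mul]
        · simp only [Set.indicator_of_notMem hy, zero_mul]
    _ = ∫⁻ y, Measure.count (S1 ∩ X ⁻¹' {y}) * g y := by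
        refine (lintegral_tsum fun n =>
          ((measurable_one.indicator (himg n)).mul hg).aemeasurable).symm.trans ?_
        refine lintegral_congr fun y => ?_
        rw [hcS1, ← ENNReal.tsum_mul_right]
        rfl
    _ = ∫⁻ y, Measure.count (S ∩ X ⁻¹' {y}) * g y := by
        refine lintegral_congr_ae ?_
        have : ∀ᵐ y, y ∉ X '' S0 := by
          rw [ae_iff]
          simp only [not_not]
          exact hsard
        filter_upwards [this] with y hy
        congr 2
        ext s
        constructor
        · exact fun h => ⟨h.1.1, h.2⟩
        · exact fun h => ⟨⟨h.1, fun h0 => hy ⟨s, ⟨h.1, h0⟩, h.2⟩⟩, h.2⟩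

section SigmaCompact

lemma IsSigmaCompact.measurableSet' {J : Set ℝ} (hJ : IsSigmaCompact J) : MeasurableSet J := by
  obtain ⟨K, hK, rfl⟩ := hJ
  exact MeasurableSet.iUnion fun n => (hK n).measurableSet

lemma IsSigmaCompact.inter_isClosed' {J F : Set ℝ} (hJ : IsSigmaCompact J) (hF : IsClosed F) :
    IsSigmaCompact (J ∩ F) := by
  obtain ⟨K, hK, rfl⟩ := hJ
  rw [Set.iUnion_inter]
  exact isSigmaCompact_iUnion_of_isCompact _ fun n => (hK n).inter_right hF

lemma IsSigmaCompact.inter_ne_zero {J : Set ℝ} (hJ : IsSigmaCompact J) {c : ℝ → ℝ}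
    (hc : Continuous c) : IsSigmaCompact (J ∩ {s | c s ≠ 0}) := by
  have : J ∩ {s | c s ≠ 0} = ⋃ n : ℕ, J ∩ {s | 1 / ((n : ℝ) + 1) ≤ |c s|} := by
    ext s
    simp only [Set.mem_inter_iff, Set.mem_ofPred_eq, Set.mem_iUnion]
    constructor
    · rintro ⟨h1, h2⟩
      obtain ⟨n, hn⟩ := exists_nat_one_div_lt (abs_pos.2 h2)
      exact ⟨n, h1, hn.le⟩
    · rintro ⟨n, h1, h2⟩
      refine ⟨h1, fun h => ?_⟩
      rw [h, abs_zero] at h2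
      have : (0 : ℝ) < 1 / ((n : ℝ) + 1) := by positivity
      linarith
  rw [this]
  exact isSigmaCompact_iUnion _ fun n =>
    hJ.inter_isClosed' (isClosed_le continuous_const hc.abs)

lemma isSigmaCompact_Ico (a b : ℝ) : IsSigmaCompact (Set.Ico a b) := by
  have h := (isCompact_Icc (a := a) (b := b)).isSigmaCompact.inter_ne_zero
    (c := fun s => s - b) (by fun_prop)
  have h2 : Set.Icc a b ∩ {s | s - b ≠ 0} = Set.Ico a b := by
    ext s
    simp only [Set.mem_inter_iff, Set.mem_Icc, Set.mem_ofPred_eq, Set.mem_Ico, sub_ne_zero]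
    constructor
    · rintro ⟨⟨h1, h2⟩, h3⟩
      exact ⟨h1, lt_of_le_of_ne h2 h3⟩
    · rintro ⟨h1, h2⟩
      exact ⟨⟨h1, h2.le⟩, h2.ne⟩
  rwa [h2] at h

lemma IsSigmaCompact.sdiff_singleton {J : Set ℝ} (hJ : IsSigmaCompact J) (t : ℝ) :
    IsSigmaCompact (J \ {t}) := by
  have h := hJ.inter_ne_zero (c := fun s => s - t) (by fun_prop)
  have h2 : J ∩ {s | s - t ≠ 0} = J \ {t} := by
    ext s
    simp [sub_ne_zero]
  rwa [h2] at h

end SigmaCompact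

section CountZeros

open scoped ENNReal

lemma count_le_of_forall_finset {A : Set ℝ} {b : ℝ≥0∞}
    (h : ∀ T : Finset ℝ, (T : Set ℝ) ⊆ A → (T.card : ℝ≥0∞) ≤ b) : Measure.count A ≤ b := by
  by_cases hA : A.Finite
  · rw [Measure.count_apply_finite A hA]
    exact h _ (by simp)
  · rw [Measure.count_apply_infinite hA]
    refine le_of_tendsto' ENNReal.tendsto_nat_nhds_top fun n => ?_
    obtain ⟨T, hT, rfl⟩ := Set.Infinite.exists_subset_card_eq hA n
    exact h T hT

lemma one_le_count_of_nonempty {A : Set ℝ} (h : A.Nonempty) : 1 ≤ Measure.count A := by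
  obtain ⟨x, hx⟩ := h
  rw [← Measure.count_singleton x]
  exact measure_mono (Set.singleton_subset_iff.2 hx)

lemma exists_nat_injOn_floor (T : Finset ℝ) :
    ∃ n : ℕ, Set.InjOn (fun s : ℝ => ⌊(n : ℝ) * s⌋) (T : Set ℝ) := by
  classical
  have hsep : ∃ n : ℕ, ∀ p ∈ T ×ˢ T, p.1 ≠ p.2 → 1 ≤ (n : ℝ) * |p.1 - p.2| := by
    choose! N hN using fun p : ℝ × ℝ => (fun h : p.1 ≠ p.2 =>
      exists_nat_ge (1 / |p.1 - p.2|))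
    refine ⟨(T ×ˢ T).sup N, fun p hp hne => ?_⟩
    have h0 : 0 < |p.1 - p.2| := abs_pos.2 (sub_ne_zero.2 hne)
    have h1 := hN p hne
    have h2 : (N p : ℝ) ≤ ((T ×ˢ T).sup N : ℕ) := by
      exact_mod_cast Finset.le_sup (f := N) hp
    rw [div_le_iff₀ h0] at h1
    nlinarith
  obtain ⟨n, hn⟩ := hsep
  refine ⟨n, fun x hx y hy hxy => ?_⟩
  by_contra hne
  have h1 := hn (x, y) (Finset.mem_product.2 ⟨hx, hy⟩) hne
  have h2 := Int.abs_sub_lt_one_of_floor_eq_floor hxy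
  rw [← mul_sub, abs_mul, Nat.abs_cast] at h2
  linarith

open scoped Classical in
lemma count_eq_iSup_tsum {A : Set ℝ} (hA : MeasurableSet A) :
    Measure.count A = ⨆ n : ℕ, ∑' k : ℤ,
      if (∃ s ∈ A, ⌊(n : ℝ) * s⌋ = k) then (1 : ℝ≥0∞) else 0 := by
  apply le_antisymm
  · refine count_le_of_forall_finset fun T hT => ?_
    obtain ⟨n, hn⟩ := exists_nat_injOn_floor T
    refine le_trans ?_ (le_iSup _ n)
    rw [← Finset.card_image_of_injOn hn]
    refine le_trans ?_ (ENNReal.sum_le_tsum (T.image fun s : ℝ => ⌊(n : ℝ) * s⌋))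
    rw [Finset.card_eq_sum_ones, Nat.cast_sum]
    refine Finset.sum_le_sum fun k hk => ?_
    obtain ⟨s, hs, hsk⟩ := Finset.mem_image.1 hk
    rw [if_pos ⟨s, hT hs, hsk⟩, Nat.cast_one]
  · refine iSup_le fun n => ?_
    have hm : ∀ k : ℤ, MeasurableSet {s : ℝ | ⌊(n : ℝ) * s⌋ = k} := fun k =>
      (Int.measurable_floor.comp (measurable_const_mul (n : ℝ))) (measurableSet_singleton k)
    have hU : A = ⋃ k : ℤ, A ∩ {s : ℝ | ⌊(n : ℝ) * s⌋ = k} := by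
      ext s
      simp
    conv_rhs => rw [hU]
    rw [measure_iUnion]
    · refine ENNReal.tsum_le_tsum fun k => ?_
      split_ifs with h
      · obtain ⟨s, hs, hsk⟩ := h
        exact one_le_count_of_nonempty ⟨s, hs, hsk⟩
      · exact zero_le
    · intro i j hij
      refine Set.disjoint_left.2 ?_
      rintro s ⟨_, h1⟩ ⟨_, h2⟩
      exact hij (h1.symm.trans h2)
    · exact fun k => hA.inter (hm k)

section ZeroCount

variable {α : Type*} [TopologicalSpace α] [MeasurableSpace α] [OpensMeasurableSpace α]

lemma measurableSet_exists_zero {g : α → ℝ → ℝ} (hg : Continuous (Function.uncurry g))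
    {J : Set ℝ} (hJ : IsSigmaCompact J) : MeasurableSet {a | ∃ s ∈ J, g a s = 0} := by
  obtain ⟨K, hK, rfl⟩ := hJ
  have h1 : {a | ∃ s ∈ ⋃ n, K n, g a s = 0} = ⋃ n, {a | ∃ s ∈ K n, g a s = 0} := by
    ext a
    simp only [Set.mem_iUnion, Set.mem_ofPred_eq]
    constructor
    · rintro ⟨s, ⟨n, hn⟩, h⟩
      exact ⟨n, s, hn, h⟩
    · rintro ⟨n, s, hn, h⟩
      exact ⟨s, ⟨n, hn⟩, h⟩
  rw [h1]
  refine MeasurableSet.iUnion fun n => IsClosed.measurableSet ?_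
  have : CompactSpace (K n) := isCompact_iff_compactSpace.1 (hK n)
  have h2 : {a | ∃ s ∈ K n, g a s = 0}
      = Prod.fst '' {p : α × K n | g p.1 p.2 = 0} := by
    ext a
    constructor
    · rintro ⟨s, hs, h⟩
      exact ⟨(a, ⟨s, hs⟩), h, rfl⟩
    · rintro ⟨⟨b, s⟩, h, rfl⟩
      exact ⟨s, s.2, h⟩
  rw [h2]
  refine isClosedMap_fst_of_compactSpace _ (isClosed_eq ?_ continuous_const)
  exact hg.comp (continuous_fst.prodMk (continuous_subtype_val.comp continuous_snd))

lemma isSigmaCompact_floor_cell (n : ℕ) (k : ℤ) {J : Set ℝ} (hJ : IsSigmaCompact J) :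
    IsSigmaCompact (J ∩ {s : ℝ | ⌊(n : ℝ) * s⌋ = k}) := by
  have h := ((hJ.inter_isClosed' (isClosed_le (continuous_const (y := (k : ℝ)))
      (continuous_const_mul (n : ℝ)))).inter_isClosed'
      (isClosed_le (continuous_const_mul (n : ℝ))
        (continuous_const (y := (k : ℝ) + 1)))).inter_ne_zero
      (c := fun s => (n : ℝ) * s - ((k : ℝ) + 1)) (by fun_prop)
  convert h using 1
  ext s
  simp only [Set.mem_inter_iff, Set.mem_ofPred_eq, Int.floor_eq_iff, sub_ne_zero]
  constructor
  · rintro ⟨h1, h2, h3⟩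
    exact ⟨⟨⟨h1, h2⟩, h3.le⟩, h3.ne⟩
  · rintro ⟨⟨⟨h1, h2⟩, h3⟩, h4⟩
    exact ⟨h1, h2, lt_of_le_of_ne h3 h4⟩

/-- The number of zeros of a continuous random function on a `σ`-compact set is measurable. -/
lemma measurable_count_zeros {g : α → ℝ → ℝ} (hg : Continuous (Function.uncurry g))
    {J : Set ℝ} (hJ : IsSigmaCompact J) :
    Measurable fun a => Measure.count (J ∩ {s | g a s = 0}) := by
  classical
  have hm : ∀ a, MeasurableSet (J ∩ {s | g a s = 0}) := fun a =>
    hJ.measurableSet'.inter (isClosed_eq (hg.comp (by fun_prop : Continuous fun s => (a, s)))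
      continuous_const).measurableSet
  simp_rw [fun a => count_eq_iSup_tsum (hm a)]
  refine Measurable.iSup fun n => Measurable.tsum fun k => ?_
  refine Measurable.ite ?_ measurable_const measurable_const
  have := measurableSet_exists_zero hg (isSigmaCompact_floor_cell n k hJ)
  convert this using 3 with a
  constructor
  · rintro ⟨s, ⟨h1, h2⟩, h3⟩
    exact ⟨s, ⟨h1, h3⟩, h2⟩
  · rintro ⟨s, ⟨h1, h3⟩, h2⟩
    exact ⟨s, ⟨h1, h2⟩, h3⟩

end ZeroCount

end CountZeros

section Palm

open scoped RealInnerProductSpace ENNReal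

/-- The component of `ξ` orthogonal to `v`. -/
def perpTo {H : Type*} [NormedAddCommGroup H] [InnerProductSpace ℝ H] (v ξ : H) : H :=
  ξ - (⟪v, ξ⟫ / ‖v‖ ^ 2) • v

/-- The set of zeros in `J` of the process `s ↦ ⟪ξ, ψ s⟫`, counted. -/
def zeroCount {H : Type*} [NormedAddCommGroup H] [InnerProductSpace ℝ H] (ψ : ℝ → H)
    (J : Set ℝ) (ξ : H) : ℝ≥0∞ :=
  Measure.count (J ∩ {s | ⟪ξ, ψ s⟫ = 0})

variable {H : Type*} [NormedAddCommGroup H] [InnerProductSpace ℝ H] [FiniteDimensional ℝ H]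
  [MeasurableSpace H] [BorelSpace H]

lemma continuous_perpTo {H : Type*} [NormedAddCommGroup H] [InnerProductSpace ℝ H] (v : H) :
    Continuous (perpTo v) := by
  unfold perpTo; fun_prop

lemma perpTo_smul {H : Type*} [NormedAddCommGroup H] [InnerProductSpace ℝ H] {n : H}
    (hn : ‖n‖ = 1) {a : ℝ} (ha : a ≠ 0) (ξ : H) : perpTo (a • n) ξ = ξ - ⟪n, ξ⟫ • n := by
  unfold perpTo
  rw [norm_smul, hn, mul_one, real_inner_smul_left, smul_smul, Real.norm_eq_abs, sq_abs]
  congr 2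
  field_simp

lemma measurable_zeroCount {H : Type*} [NormedAddCommGroup H] [InnerProductSpace ℝ H]
    [MeasurableSpace H] [BorelSpace H] {ψ : ℝ → H} (hψ : Continuous ψ) {J : Set ℝ} (hJ : IsSigmaCompact J) :
    Measurable (zeroCount ψ J) :=
  measurable_count_zeros (g := fun (ξ : H) s => ⟪ξ, ψ s⟫) (by unfold Function.uncurry; fun_prop) hJ

lemma gaussianPDF_eq_ofReal (x : ℝ) :
    gaussianPDF 0 1 x = ENNReal.ofReal ((√(2 * π))⁻¹ * rexp (-x ^ 2 / 2)) := by
  simp [gaussianPDF, gaussianPDFReal]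

lemma lintegral_gaussianReal_std {F : ℝ → ℝ≥0∞} (hF : Measurable F) :
    ∫⁻ x, F x ∂gaussianReal 0 1 = ∫⁻ x, F x * gaussianPDF 0 1 x := by
  rw [gaussianReal_of_var_ne_zero 0 one_ne_zero,
    lintegral_withDensity_eq_lintegral_mul _ (measurable_gaussianPDF 0 1) hF]
  exact lintegral_congr fun x => mul_comm _ _

lemma lintegral_scale {F : ℝ → ℝ≥0∞} (hF : Measurable F) {c : ℝ} (hc : c ≠ 0) :
    ∫⁻ x, F (c⁻¹ * x) = ENNReal.ofReal |c| * ∫⁻ x, F x := by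
  have h := Real.map_volume_mul_left (inv_ne_zero hc)
  rw [inv_inv] at h
  rw [← lintegral_map hF (measurable_const_mul c⁻¹), h, lintegral_smul_measure, smul_eq_mul]

/-- Sliding a Gaussian vector along the direction `e` onto the hyperplane orthogonal to `n`. -/
lemma lintegral_oblique (hdim : 2 ≤ Module.finrank ℝ H) {n e : H} (hn : ‖n‖ = 1) (he : ‖e‖ = 1)
    (hc : ⟪e, n⟫ ≠ 0) {Φ : H → ℝ≥0∞} (hΦ : Measurable Φ) :
    ∫⁻ ξ, Φ ((-⟪ξ - ⟪e, ξ⟫ • e, n⟫ / ⟪e, n⟫) • e + (ξ - ⟪e, ξ⟫ • e)) *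
        gaussianPDF 0 1 (-⟪ξ - ⟪e, ξ⟫ • e, n⟫ / ⟪e, n⟫) ∂stdGaussian H
      = ENNReal.ofReal |⟪e, n⟫| * (ENNReal.ofReal (√(2 * π))⁻¹ *
        ∫⁻ ξ, Φ (ξ - ⟪n, ξ⟫ • n) ∂stdGaussian H) := by
  obtain ⟨n', hn', hnn', hen⟩ := exists_orthogonal_unit hdim hn e
  set c := ⟪e, n⟫ with hcdef
  set d := ⟪n', e⟫ with hddef
  rw [real_inner_comm e n, ← hcdef] at hen
  have hn1 : ⟪n, n⟫ = 1 := by rw [real_inner_self_eq_norm_sq, hn]; norm_num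
  have hn1' : ⟪n', n'⟫ = 1 := by rw [real_inner_self_eq_norm_sq, hn']; norm_num
  have he1 : ⟪e, e⟫ = 1 := by rw [real_inner_self_eq_norm_sq, he]; norm_num
  have hn'n : ⟪n', n⟫ = 0 := by rw [real_inner_comm, hnn']
  have hcd : c ^ 2 + d ^ 2 = 1 := by
    rw [← he1]
    conv_rhs => rw [hen]
    simp only [inner_add_left, inner_add_right, real_inner_smul_left, real_inner_smul_right,
      hn1, hn1', hnn', hn'n]
    ring
  set e' : H := (-d) • n + c • n' with he'
  have hee' : ⟪e, e'⟫ = 0 := by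
    rw [he', hen]
    simp only [inner_add_left, inner_add_right, real_inner_smul_left, real_inner_smul_right,
      hn1, hn1', hnn', hn'n]
    ring
  have hne' : ‖e'‖ = 1 := by
    have : ‖e'‖ ^ 2 = 1 := by
      rw [← real_inner_self_eq_norm_sq, he']
      simp only [inner_add_left, inner_add_right, real_inner_smul_left, real_inner_smul_right,
        hn1, hn1', hnn', hn'n]
      linarith [hcd]
    nlinarith [norm_nonneg e']
  have he'n : ⟪e', n⟫ = -d := by
    rw [he']
    simp only [inner_add_left, real_inner_smul_left, hn1, hn'n]
    ring
  have hR : ∀ ξ : H, ξ - ⟪e, ξ⟫ • e - ⟪e', ξ⟫ • e' = ξ - ⟪n, ξ⟫ • n - ⟪n', ξ⟫ • n' := by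
    intro ξ
    have h1 : ⟪e, ξ⟫ = c * ⟪n, ξ⟫ + d * ⟪n', ξ⟫ := by
      conv_lhs => rw [hen]
      simp only [inner_add_left, real_inner_smul_left]
    have h2 : ⟪e', ξ⟫ = -d * ⟪n, ξ⟫ + c * ⟪n', ξ⟫ := by
      rw [he']
      simp only [inner_add_left, real_inner_smul_left]
    have h3 : ⟪e, ξ⟫ • e + ⟪e', ξ⟫ • e' = ⟪n, ξ⟫ • n + ⟪n', ξ⟫ • n' := by
      have h4 : ⟪e, ξ⟫ • e + ⟪e', ξ⟫ • e'
          = (⟪e, ξ⟫ * c - ⟪e', ξ⟫ * d) • n + (⟪e, ξ⟫ * d + ⟪e', ξ⟫ * c) • n' := by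
        rw [he']
        conv_lhs => rw [show ⟪e, ξ⟫ • e = ⟪e, ξ⟫ • (c • n + d • n') from by rw [← hen]]
        module
      rw [h4, h1, h2]
      congr 2
      · linear_combination ⟪n, ξ⟫ * hcd
      · linear_combination ⟪n', ξ⟫ * hcd
    rw [sub_sub, sub_sub, h3]
  set R : H → H := fun ξ => ξ - ⟪n, ξ⟫ • n - ⟪n', ξ⟫ • n' with hRdef
  have hRm : Measurable R := by fun_prop
  have hRn : ∀ ξ, ⟪n, R ξ⟫ = 0 := by
    intro ξ
    simp only [hRdef, inner_sub_right, real_inner_smul_right, hn1, hnn']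
    ring
  have hRn' : ∀ ξ, ⟪n', R ξ⟫ = 0 := by
    intro ξ
    simp only [hRdef, inner_sub_right, real_inner_smul_right, hn1', hn'n]
    ring
  have hRe : ∀ ξ, ⟪e, R ξ⟫ = 0 := by
    intro ξ
    conv_lhs => rw [hen]
    simp only [inner_add_left, real_inner_smul_left, hRn, hRn']
    ring
  set K : ℝ → ℝ≥0∞ := fun b => ∫⁻ ξ, Φ (b • n' + R ξ) ∂stdGaussian H with hK
  have hKm : Measurable K := by
    have : Measurable (fun p : ℝ × H => Φ (p.1 • n' + R p.2)) := hΦ.comp (by fun_prop)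
    exact this.lintegral_prod_right'
  have hgm := measurable_gaussianPDF 0 1
  have hrhs : ∫⁻ ξ, Φ (ξ - ⟪n, ξ⟫ • n) ∂stdGaussian H = ∫⁻ b, K b * gaussianPDF 0 1 b := by
    rw [lintegral_stdGaussian_split₂ (F := fun ξ => Φ (ξ - ⟪n, ξ⟫ • n)) hn hn' hnn'
      (hΦ.comp (by fun_prop))]
    have : ∀ x y : ℝ, ∀ ξ : H, (x • n + y • n' + (ξ - ⟪n, ξ⟫ • n - ⟪n', ξ⟫ • n'))
        - ⟪n, x • n + y • n' + (ξ - ⟪n, ξ⟫ • n - ⟪n', ξ⟫ • n')⟫ • n = y • n' + R ξ := by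
      intro x y ξ
      change (x • n + y • n' + R ξ) - ⟪n, x • n + y • n' + R ξ⟫ • n = y • n' + R ξ
      simp only [inner_add_right, real_inner_smul_right, hn1, hnn', hRn]
      module
    simp_rw [this]
    rw [lintegral_const, measure_univ, mul_one]
    exact lintegral_gaussianReal_std hKm
  have hexp : ∀ y : ℝ, gaussianPDF 0 1 (y * (d / c)) * gaussianPDF 0 1 y
      = ENNReal.ofReal (√(2 * π))⁻¹ * gaussianPDF 0 1 (c⁻¹ * y) := by
    intro y
    simp only [gaussianPDF_eq_ofReal]
    rw [← ENNReal.ofReal_mul (by positivity), ← ENNReal.ofReal_mul (by positivity)]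
    congr 1
    have : rexp (-(c⁻¹ * y) ^ 2 / 2) = rexp (-(y * (d / c)) ^ 2 / 2) * rexp (-y ^ 2 / 2) := by
      rw [← Real.exp_add]
      congr 1
      field_simp
      linear_combination y ^ 2 * hcd
    rw [this]
    ring
  rw [hrhs, lintegral_stdGaussian_split₂ he hne' hee' (by
    apply Measurable.mul
    · exact hΦ.comp (by fun_prop)
    · exact hgm.comp (by fun_prop))]
  have hproj : ∀ x y : ℝ, ∀ ξ : H, (x • e + y • e' + (ξ - ⟪e, ξ⟫ • e - ⟪e', ξ⟫ • e'))
      - ⟪e, x • e + y • e' + (ξ - ⟪e, ξ⟫ • e - ⟪e', ξ⟫ • e')⟫ • e = y • e' + R ξ := by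
    intro x y ξ
    rw [hR]
    change (x • e + y • e' + R ξ) - ⟪e, x • e + y • e' + R ξ⟫ • e = y • e' + R ξ
    simp only [inner_add_right, real_inner_smul_right, he1, hee', hRe]
    module
  have hX : ∀ y : ℝ, ∀ ξ : H, -⟪y • e' + R ξ, n⟫ / c = y * (d / c) := by
    intro y ξ
    rw [inner_add_left, real_inner_smul_left, he'n, real_inner_comm n, hRn]
    ring
  have hA : ∀ y : ℝ, ∀ ξ : H, (y * (d / c)) • e + (y • e' + R ξ) = (c⁻¹ * y) • n' + R ξ := by
    intro y ξ
    rw [← add_assoc]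
    congr 1
    have h4 : (y * (d / c)) • e + y • e'
        = (y * (d / c) * c - y * d) • n + (y * (d / c) * d + y * c) • n' := by
      rw [he']
      conv_lhs => rw [show (y * (d / c)) • e = (y * (d / c)) • (c • n + d • n') from by
        rw [← hen]]
      module
    rw [h4]
    have h5 : y * (d / c) * c - y * d = 0 := by field_simp; ring
    have h6 : y * (d / c) * d + y * c = c⁻¹ * y := by
      field_simp
      linear_combination y * hcd
    rw [h5, h6, zero_smul, zero_add]
  simp_rw [hproj, hX, hA]
  rw [lintegral_const, measure_univ, mul_one]
  have hstep : ∀ y : ℝ, ∫⁻ ξ, Φ ((c⁻¹ * y) • n' + R ξ) * gaussianPDF 0 1 (y * (d / c))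
      ∂stdGaussian H = K (c⁻¹ * y) * gaussianPDF 0 1 (y * (d / c)) := by
    intro y
    exact lintegral_mul_const _ (hΦ.comp (by fun_prop))
  simp_rw [hstep]
  rw [lintegral_gaussianReal_std (by
    apply Measurable.mul
    · exact hKm.comp (by fun_prop)
    · exact hgm.comp (by fun_prop))]
  simp_rw [mul_assoc, hexp]
  have hcomm : ∀ y : ℝ, K (c⁻¹ * y) * (ENNReal.ofReal (√(2 * π))⁻¹ * gaussianPDF 0 1 (c⁻¹ * y))
      = ENNReal.ofReal (√(2 * π))⁻¹ * (K (c⁻¹ * y) * gaussianPDF 0 1 (c⁻¹ * y)) := fun y => by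
    ring
  simp_rw [hcomm]
  rw [lintegral_const_mul (f := fun x => K (c⁻¹ * x) * gaussianPDF 0 1 (c⁻¹ * x)) _
      ((hKm.mul hgm).comp (measurable_const_mul c⁻¹)),
    lintegral_scale (F := fun b => K b * gaussianPDF 0 1 b) (hKm.mul hgm) hc]
  ring

lemma lintegral_oblique_deriv (hdim : 2 ≤ Module.finrank ℝ H) {e u : H} (he : ‖e‖ = 1)
    (h0 : ⟪e, u⟫ ≠ 0) (v : H) {G : H → ℝ≥0∞} (hG : Measurable G) :
    ∫⁻ ξ, ENNReal.ofReal |-⟪(-⟪ξ - ⟪e, ξ⟫ • e, u⟫ / ⟪e, u⟫) • e + (ξ - ⟪e, ξ⟫ • e), v⟫ / ⟪e, u⟫| *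
        (G ((-⟪ξ - ⟪e, ξ⟫ • e, u⟫ / ⟪e, u⟫) • e + (ξ - ⟪e, ξ⟫ • e)) *
          gaussianPDF 0 1 (-⟪ξ - ⟪e, ξ⟫ • e, u⟫ / ⟪e, u⟫)) ∂stdGaussian H
      = ENNReal.ofReal (√(2 * π) * ‖u‖)⁻¹ *
          ∫⁻ ξ, G (perpTo u ξ) * ENNReal.ofReal |⟪perpTo u ξ, v⟫| ∂stdGaussian H := by
  have hgm := measurable_gaussianPDF 0 1
  have hu0 : u ≠ 0 := by
    intro h
    rw [h, inner_zero_right] at h0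
    exact h0 rfl
  have hnp : 0 < ‖u‖ := norm_pos_iff.2 hu0
  obtain ⟨n, hn1, hun⟩ : ∃ n : H, ‖n‖ = 1 ∧ u = ‖u‖ • n := by
    refine ⟨‖u‖⁻¹ • u, ?_, ?_⟩
    · rw [norm_smul, norm_inv, norm_norm, inv_mul_cancel₀ hnp.ne']
    · rw [smul_smul, mul_inv_cancel₀ hnp.ne', one_smul]
  have hperp : ∀ ξ, perpTo u ξ = ξ - ⟪n, ξ⟫ • n := fun ξ => by
    rw [← perpTo_smul hn1 hnp.ne' ξ, ← hun]
  have hin : ∀ z : H, ⟪z, u⟫ = ‖u‖ * ⟪z, n⟫ := fun z => by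
    conv_lhs => rw [hun, real_inner_smul_right]
  have hen0 : ⟪e, n⟫ ≠ 0 := fun h => h0 (by rw [hin, h, mul_zero])
  have hXn : ∀ z : H, -⟪z, u⟫ / ⟪e, u⟫ = -⟪z, n⟫ / ⟪e, n⟫ := by
    intro z
    rw [hin z, hin e]
    field_simp
  have hΦm : Measurable fun z : H => G z * ENNReal.ofReal |⟪z, v⟫| := hG.mul (by fun_prop)
  have hob := lintegral_oblique hdim hn1 he hen0 hΦm
  have hpt : ∀ (z : H) (q : ℝ≥0∞), ENNReal.ofReal |-⟪z, v⟫ / ⟪e, u⟫| * (G z * q)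
      = ENNReal.ofReal |⟪e, u⟫|⁻¹ * (G z * ENNReal.ofReal |⟪z, v⟫| * q) := by
    intro z q
    rw [abs_div, abs_neg, div_eq_mul_inv, mul_comm |⟪z, v⟫|, ENNReal.ofReal_mul (by positivity)]
    ring
  simp_rw [hpt, hXn, hperp]
  rw [lintegral_const_mul' _ _ ENNReal.ofReal_ne_top, hob, ← mul_assoc, ← mul_assoc,
    ← ENNReal.ofReal_mul (by positivity), ← ENNReal.ofReal_mul (by positivity)]
  congr 2
  rw [hin, abs_mul, abs_of_pos hnp]
  have := abs_ne_zero.2 hen0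
  field_simp

lemma palm_of_inner_ne_zero (hdim : 2 ≤ Module.finrank ℝ H) {ψ ψ' : ℝ → H}
    (hψ : ∀ s, HasDerivAt ψ (ψ' s) s) (hψ' : Continuous ψ') {J : Set ℝ} (hJ : IsSigmaCompact J)
    {e : H} (he : ‖e‖ = 1) (heJ : ∀ s ∈ J, ⟪e, ψ s⟫ ≠ 0) {G : H → ℝ≥0∞} (hG : Measurable G) :
    ∫⁻ ξ, zeroCount ψ J ξ * G ξ ∂stdGaussian H
      = ∫⁻ s in J, ENNReal.ofReal (√(2 * π) * ‖ψ s‖)⁻¹ *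
          ∫⁻ ξ, G (perpTo (ψ s) ξ) * ENNReal.ofReal |⟪perpTo (ψ s) ξ, ψ' s⟫| ∂stdGaussian H := by
  have hψc : Continuous ψ := continuous_iff_continuousAt.2 fun s => (hψ s).continuousAt
  have hNm := measurable_zeroCount hψc hJ
  have hgm := measurable_gaussianPDF 0 1
  obtain ⟨w, hw⟩ : ∃ w : H → H, w = fun ξ => ξ - ⟪e, ξ⟫ • e := ⟨_, rfl⟩
  have hwm : Measurable w := by rw [hw]; fun_prop
  obtain ⟨X, hX⟩ : ∃ X : H → ℝ → ℝ, X = fun ξ s => -⟪w ξ, ψ s⟫ / ⟪e, ψ s⟫ := ⟨_, rfl⟩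
  obtain ⟨X', hX'⟩ : ∃ X' : H → ℝ → ℝ, X' = fun ξ s =>
    -⟪X ξ s • e + w ξ, ψ' s⟫ / ⟪e, ψ s⟫ := ⟨_, rfl⟩
  have hψm := hψc.measurable
  have hψm' := hψ'.measurable
  have hXm2 : Measurable (Function.uncurry X) := by
    unfold Function.uncurry
    simp only [hX]
    apply Measurable.div
    · exact Measurable.neg (Measurable.inner (hwm.comp measurable_fst)
        (hψm.comp measurable_snd))
    · exact Measurable.inner measurable_const (hψm.comp measurable_snd)
  have hAm2 : Measurable (fun p : H × ℝ => X p.1 p.2 • e + w p.1) :=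
    (hXm2.smul_const e).add (hwm.comp measurable_fst)
  have hXm2' : Measurable (Function.uncurry X') := by
    unfold Function.uncurry
    simp only [hX']
    apply Measurable.div
    · exact Measurable.neg (Measurable.inner hAm2 (hψm'.comp measurable_snd))
    · exact Measurable.inner measurable_const (hψm.comp measurable_snd)
  have hXm : ∀ ξ, Measurable (X ξ) := fun ξ => hXm2.comp measurable_prodMk_left
  have hXm' : ∀ ξ, Measurable (X' ξ) := fun ξ => hXm2'.comp measurable_prodMk_left
  have hXd : ∀ ξ, ∀ s ∈ J, HasDerivWithinAt (X ξ) (X' ξ s) J s := by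
    intro ξ s hs
    have h0 := heJ s hs
    have h1 : HasDerivAt (fun s => ⟪w ξ, ψ s⟫) ⟪w ξ, ψ' s⟫ s := by
      simpa using (hasDerivAt_const s (w ξ)).inner ℝ (hψ s)
    have h2 : HasDerivAt (fun s => ⟪e, ψ s⟫) ⟪e, ψ' s⟫ s := by
      simpa using (hasDerivAt_const s e).inner ℝ (hψ s)
    have h3 : HasDerivAt (fun s => -⟪w ξ, ψ s⟫ / ⟪e, ψ s⟫)
      ((-⟪w ξ, ψ' s⟫ * ⟪e, ψ s⟫ - -⟪w ξ, ψ s⟫ * ⟪e, ψ' s⟫) / ⟪e, ψ s⟫ ^ 2) s := h1.neg.div h2 h0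
    have h4 : X ξ = fun s => -⟪w ξ, ψ s⟫ / ⟪e, ψ s⟫ := by rw [hX]
    rw [h4]
    refine (h3.congr_deriv ?_).hasDerivWithinAt
    simp only [hX', hX, inner_add_left, real_inner_smul_left]
    field_simp
    ring
  obtain ⟨g, hg⟩ : ∃ g : H → ℝ → ℝ≥0∞, g = fun ξ x => G (x • e + w ξ) * gaussianPDF 0 1 x :=
    ⟨_, rfl⟩
  have hgm1 : ∀ ξ, Measurable (g ξ) := fun ξ => by
    rw [hg]
    exact Measurable.mul (hG.comp (by fun_prop)) hgm
  have hNG : Measurable fun ξ => zeroCount ψ J ξ * G ξ := hNm.mul hG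
  have hmap : Measurable fun p : ℝ × H => p.1 • e + w p.2 := by fun_prop
  calc ∫⁻ ξ, zeroCount ψ J ξ * G ξ ∂stdGaussian H
      = ∫⁻ x, ∫⁻ ξ, zeroCount ψ J (x • e + w ξ) * G (x • e + w ξ) ∂stdGaussian H
          ∂gaussianReal 0 1 := by rw [hw]; exact lintegral_stdGaussian_split he hNG
    _ = ∫⁻ ξ, ∫⁻ x, zeroCount ψ J (x • e + w ξ) * G (x • e + w ξ) ∂gaussianReal 0 1
          ∂stdGaussian H := lintegral_lintegral_swap (hNG.comp hmap).aemeasurable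
    _ = ∫⁻ ξ, (∫⁻ s in J, ENNReal.ofReal |X' ξ s| * g ξ (X ξ s)) ∂stdGaussian H := by
        refine lintegral_congr fun ξ => ?_
        rw [lintegral_abs_deriv_mul_comp hJ.measurableSet' (hXm ξ) (hXm' ξ) (hXd ξ) (hgm1 ξ),
          lintegral_gaussianReal_std (F := fun x => zeroCount ψ J (x • e + w ξ) *
            G (x • e + w ξ)) (hNG.comp (by fun_prop))]
        refine lintegral_congr fun x => ?_
        rw [hg, mul_assoc]
        congr 1
        unfold zeroCount
        congr 1
        ext s
        simp only [Set.mem_inter_iff, Set.mem_ofPred_eq, Set.mem_preimage,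
          Set.mem_singleton_iff, and_congr_right_iff]
        intro hs
        rw [hX, inner_add_left, real_inner_smul_left, div_eq_iff (heJ s hs)]
        constructor <;> intro h <;> linarith
    _ = ∫⁻ s in J, ∫⁻ ξ, ENNReal.ofReal |X' ξ s| * g ξ (X ξ s) ∂stdGaussian H := by
        refine lintegral_lintegral_swap (Measurable.aemeasurable ?_)
        apply Measurable.mul
        · exact ENNReal.measurable_ofReal.comp (continuous_abs.measurable.comp hXm2')
        · simp only [hg]
          exact Measurable.mul (hG.comp hAm2) (hgm.comp hXm2)
    _ = _ := by
        refine setLIntegral_congr_fun hJ.measurableSet' fun s hs => ?_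
        simp only [hX', hg, hX, hw]
        exact lintegral_oblique_deriv hdim he (heJ s hs) (ψ' s) hG

/-- The one-dimensional Palm (Kac–Rice) formula for Gaussian processes `s ↦ ⟪ξ, ψ s⟫`. -/
lemma lintegral_zeroCount_mul (hdim : 2 ≤ Module.finrank ℝ H) {ψ ψ' : ℝ → H}
    (hψ : ∀ s, HasDerivAt ψ (ψ' s) s) (hψ' : Continuous ψ') {J : Set ℝ} (hJ : IsSigmaCompact J)
    (h0 : ∀ s ∈ J, ψ s ≠ 0) {G : H → ℝ≥0∞} (hG : Measurable G) :
    ∫⁻ ξ, zeroCount ψ J ξ * G ξ ∂stdGaussian H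
      = ∫⁻ s in J, ENNReal.ofReal (√(2 * π) * ‖ψ s‖)⁻¹ *
          ∫⁻ ξ, G (perpTo (ψ s) ξ) * ENNReal.ofReal |⟪perpTo (ψ s) ξ, ψ' s⟫| ∂stdGaussian H := by
  have hψc : Continuous ψ := continuous_iff_continuousAt.2 fun s => (hψ s).continuousAt
  set b := stdOrthonormalBasis ℝ H with hb
  have main : ∀ S : Finset (Fin (Module.finrank ℝ H)), ∀ J : Set ℝ, IsSigmaCompact J →
      (∀ s ∈ J, ∃ k ∈ S, ⟪b k, ψ s⟫ ≠ 0) →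
      ∫⁻ ξ, zeroCount ψ J ξ * G ξ ∂stdGaussian H
      = ∫⁻ s in J, ENNReal.ofReal (√(2 * π) * ‖ψ s‖)⁻¹ *
          ∫⁻ ξ, G (perpTo (ψ s) ξ) * ENNReal.ofReal |⟪perpTo (ψ s) ξ, ψ' s⟫| ∂stdGaussian H := by
    classical
    intro S
    induction S using Finset.induction_on with
    | empty =>
      intro J _ h
      have : J = ∅ := Set.eq_empty_of_forall_notMem fun s hs => by
        obtain ⟨k, hk, _⟩ := h s hs
        simp at hk
      simp [this, zeroCount]
    | insert k S hk ih =>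
      intro J hJ h
      have hc : Continuous fun s => ⟪b k, ψ s⟫ := by fun_prop
      have hJ1 := hJ.inter_ne_zero hc
      have hJ2 := hJ.inter_isClosed' (isClosed_eq hc (continuous_const (y := (0 : ℝ))))
      set J1 := J ∩ {s | ⟪b k, ψ s⟫ ≠ 0} with hJ1d
      set J2 := J ∩ {s | ⟪b k, ψ s⟫ = 0} with hJ2d
      have hU : J = J1 ∪ J2 := by
        ext s
        by_cases hs : ⟪b k, ψ s⟫ = 0 <;> simp [hJ1d, hJ2d, hs]
      have hdisj : Disjoint J1 J2 := Set.disjoint_left.2 fun s h1 h2 => h1.2 h2.2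
      have hN : ∀ ξ, zeroCount ψ J ξ = zeroCount ψ J1 ξ + zeroCount ψ J2 ξ := by
        intro ξ
        unfold zeroCount
        conv_lhs => rw [hU]
        rw [Set.union_inter_distrib_right, measure_union
          (hdisj.mono Set.inter_subset_left Set.inter_subset_left)]
        exact hJ2.measurableSet'.inter
          (isClosed_eq (by fun_prop) continuous_const).measurableSet
      have e1 := palm_of_inner_ne_zero hdim hψ hψ' hJ1 (b.orthonormal.1 k)
        (fun s hs => hs.2) hG
      have e2 := ih J2 hJ2 (by
        intro s hs
        obtain ⟨j, hj, hj0⟩ := h s hs.1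
        rcases Finset.mem_insert.1 hj with rfl | hj
        · exact absurd hs.2 hj0
        · exact ⟨j, hj, hj0⟩)
      simp_rw [hN, add_mul]
      rw [lintegral_add_left (f := fun ξ => zeroCount ψ J1 ξ * G ξ) ((measurable_zeroCount hψc hJ1).mul hG), e1, e2]
      conv_rhs => rw [hU]
      rw [lintegral_union hJ2.measurableSet' hdisj]
  refine main Finset.univ J hJ fun s hs => ?_
  by_contra hcon
  push Not at hcon
  refine h0 s hs ?_
  rw [← b.sum_repr' (ψ s)]
  exact Finset.sum_eq_zero fun k hk => by rw [hcon k hk, zero_smul]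

end Palm

section GaussianMoments

lemma integrable_abs_pow_std (n : ℕ) : Integrable (fun x : ℝ => |x| ^ n) (gaussianReal 0 1) :=
  integrable_pow_abs_of_integrable_exp_mul (t := 1) (X := fun x : ℝ => x) one_ne_zero
    (integrable_exp_mul_gaussianReal 1) (integrable_exp_mul_gaussianReal (-1)) n

lemma integrable_abs_std : Integrable (fun x : ℝ => |x|) (gaussianReal 0 1) := by
  simpa using integrable_abs_pow_std 1

lemma integral_std_eq (f : ℝ → ℝ) :
    ∫ x, f x ∂gaussianReal 0 1 = (√(2 * π))⁻¹ * ∫ x, f x * rexp (-x ^ 2 / 2) := by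
  rw [integral_gaussianReal_eq_integral_smul one_ne_zero, ← integral_const_mul]
  refine integral_congr_ae (Filter.Eventually.of_forall fun x => ?_)
  simp [gaussianPDFReal]
  ring

lemma integral_abs_pow_odd_std (k : ℕ) :
    ∫ x, |x| ^ (2 * k + 1) ∂gaussianReal 0 1 = (√(2 * π))⁻¹ * (2 ^ (k + 1) * k.factorial) := by
  rw [integral_std_eq]
  have h1 := integral_comp_abs (f := fun x : ℝ => x ^ (2 * k + 1) * rexp (-x ^ 2 / 2))
  simp only [sq_abs] at h1
  rw [h1]
  have h2 := integral_rpow_mul_exp_neg_mul_rpow (p := 2) (q := (2 * k + 1 : ℕ)) (b := 1 / 2)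
    two_pos (by have := Nat.cast_nonneg (α := ℝ) (2 * k + 1); linarith) (by norm_num)
  have h3 : ∫ x in Set.Ioi (0 : ℝ), x ^ (2 * k + 1) * rexp (-x ^ 2 / 2)
      = ∫ x in Set.Ioi (0 : ℝ), x ^ ((2 * k + 1 : ℕ) : ℝ) * rexp (-(1 / 2) * x ^ (2 : ℝ)) := by
    refine setIntegral_congr_fun measurableSet_Ioi fun x _ => ?_
    simp only [rpow_natCast, rpow_two]
    ring_nf
  have h4 : (((2 * k + 1 : ℕ) : ℝ) + 1) / 2 = (k : ℝ) + 1 := by push_cast; ring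
  have h5 : -(((2 * k + 1 : ℕ) : ℝ) + 1) / 2 = -((k + 1 : ℕ) : ℝ) := by push_cast; ring
  rw [h3, h2, h4, h5, Gamma_nat_eq_factorial, rpow_neg (by norm_num), rpow_natCast]
  congr 1
  rw [one_div, inv_pow, inv_inv]
  ring

lemma integral_abs_std : ∫ x, |x| ∂gaussianReal 0 1 = 2 * (√(2 * π))⁻¹ := by
  simpa [mul_comm] using integral_abs_pow_odd_std 0

lemma integral_tent (w : ℝ) (hw : 0 ≤ w) (n : ℕ) :
    Integrable (fun v : ℝ => max (w - |v|) 0 * |v| ^ n) ∧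
    ∫ v, max (w - |v|) 0 * |v| ^ n = 2 * (w ^ (n + 2) / (n + 1) - w ^ (n + 2) / (n + 2)) := by
  constructor
  · refine Continuous.integrable_of_hasCompactSupport (by fun_prop) ?_
    refine HasCompactSupport.intro (isCompact_Icc (a := -w) (b := w)) fun v hv => ?_
    have : w < |v| := by
      by_contra h
      exact hv (abs_le.1 (not_lt.1 h))
    rw [max_eq_right (by linarith), zero_mul]
  · rw [integral_comp_abs (f := fun v => max (w - v) 0 * v ^ n)]
    congr 1
    have h1 : ∫ v in Set.Ioi (0 : ℝ), max (w - v) 0 * v ^ n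
        = ∫ v in Set.Ioc (0 : ℝ) w, max (w - v) 0 * v ^ n := by
      refine setIntegral_eq_of_subset_of_forall_sdiff_eq_zero measurableSet_Ioi
        (fun v hv => hv.1) fun v hv => ?_
      have : w < v := by
        by_contra h
        exact hv.2 ⟨hv.1, not_lt.1 h⟩
      rw [max_eq_right (by linarith), zero_mul]
    have h2 : ∫ v in Set.Ioc (0 : ℝ) w, max (w - v) 0 * v ^ n
        = ∫ v in Set.Ioc (0 : ℝ) w, (w * v ^ n - v ^ (n + 1)) := by
      refine setIntegral_congr_fun measurableSet_Ioc fun v hv => ?_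
      rw [max_eq_left (by linarith [hv.2])]
      ring
    rw [h1, h2, ← intervalIntegral.integral_of_le hw, intervalIntegral.integral_sub
      (Continuous.intervalIntegrable (by fun_prop) _ _)
      (Continuous.intervalIntegrable (by fun_prop) _ _), intervalIntegral.integral_const_mul, integral_pow, integral_pow]
    simp
    ring

lemma integral_tent_std (w : ℝ) (hw : 0 ≤ w) :
    Integrable (fun v : ℝ => max (w - |v|) 0) (gaussianReal 0 1) ∧
    ∫ v, max (w - |v|) 0 ∂gaussianReal 0 1 ≤ (√(2 * π))⁻¹ * w ^ 2 ∧
    (√(2 * π))⁻¹ * (w ^ 2 - w ^ 4 / 12) ≤ ∫ v, max (w - |v|) 0 ∂gaussianReal 0 1 := by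
  obtain ⟨i0, e0⟩ := integral_tent w hw 0
  obtain ⟨i2, e2⟩ := integral_tent w hw 2
  simp only [pow_zero, mul_one] at i0 e0
  have hP : 0 ≤ (√(2 * π))⁻¹ := by positivity
  have i1 : Integrable fun v : ℝ => max (w - |v|) 0 * rexp (-v ^ 2 / 2) := by
    refine i0.mono (by fun_prop) (Filter.Eventually.of_forall fun v => ?_)
    rw [norm_mul, Real.norm_of_nonneg (exp_pos _).le]
    exact mul_le_of_le_one_right (norm_nonneg _) (exp_le_one_iff.2 (by nlinarith [sq_nonneg v]))
  refine ⟨?_, ?_, ?_⟩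
  · refine (integrable_const w).mono (by fun_prop) (Filter.Eventually.of_forall fun v => ?_)
    rw [Real.norm_of_nonneg (le_max_right _ _), Real.norm_of_nonneg hw]
    exact max_le (by linarith [abs_nonneg v]) hw
  · rw [integral_std_eq]
    refine mul_le_mul_of_nonneg_left ?_ hP
    calc _ ≤ ∫ v, max (w - |v|) 0 := integral_mono i1 i0 fun v =>
            mul_le_of_le_one_right (le_max_right _ _) (exp_le_one_iff.2 (by nlinarith [sq_nonneg v]))
      _ = w ^ 2 := by rw [e0]; norm_num; ring
  · rw [integral_std_eq]
    refine mul_le_mul_of_nonneg_left ?_ hP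
    calc w ^ 2 - w ^ 4 / 12
        = ∫ v, (max (w - |v|) 0 - (1 / 2) * (max (w - |v|) 0 * |v| ^ 2)) := by
          rw [integral_sub i0 (i2.const_mul _), integral_const_mul, e0, e2]
          norm_num
          ring
      _ ≤ _ := integral_mono (i0.sub (i2.const_mul _)) i1 fun v => by
          have h1 := add_one_le_exp (-v ^ 2 / 2)
          have h2 := le_max_right (w - |v|) 0
          simp only [sq_abs]
          nlinarith

lemma integrable_abs_add_std (w : ℝ) : Integrable (fun v : ℝ => |w + v|) (gaussianReal 0 1) := by
  refine ((integrable_const |w|).add integrable_abs_std).mono (by fun_prop)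
    (Filter.Eventually.of_forall fun v => ?_)
  simp only [Pi.add_apply]
  rw [Real.norm_of_nonneg (abs_nonneg _), Real.norm_of_nonneg (by positivity)]
  exact abs_add_le w v

lemma integral_abs_add_std (w : ℝ) :
    ∫ v, |w + v| ∂gaussianReal 0 1 ≤ (√(2 * π))⁻¹ * (2 + w ^ 2) ∧
    (√(2 * π))⁻¹ * (2 + w ^ 2 - w ^ 4 / 12) ≤ ∫ v, |w + v| ∂gaussianReal 0 1 := by
  obtain ⟨i, hu, hl⟩ := integral_tent_std |w| (abs_nonneg w)
  have hneg : ∫ v, |w + v| ∂gaussianReal 0 1 = ∫ v, |w - v| ∂gaussianReal 0 1 := by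
    have h := gaussianReal_map_neg (μ := 0) (v := 1)
    rw [neg_zero] at h
    conv_lhs => rw [← h]
    rw [integral_map (by fun_prop) (by fun_prop)]
    rfl
  have i2 : Integrable (fun v : ℝ => |w - v|) (gaussianReal 0 1) := by
    have := integrable_abs_add_std (-w)
    refine this.congr (Filter.Eventually.of_forall fun v => ?_)
    simp only
    rw [← abs_neg]
    congr 1
    ring
  have key : ∫ v, |w + v| ∂gaussianReal 0 1
      = 2 * (√(2 * π))⁻¹ + ∫ v, max (|w| - |v|) 0 ∂gaussianReal 0 1 := by
    have h1 : (∫ v, |w + v| ∂gaussianReal 0 1) + ∫ v, |w - v| ∂gaussianReal 0 1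
        = 2 * ((∫ v, |v| ∂gaussianReal 0 1) + ∫ v, max (|w| - |v|) 0 ∂gaussianReal 0 1) := by
      rw [← integral_add (integrable_abs_add_std w) i2, ← integral_add integrable_abs_std i,
        ← integral_const_mul]
      refine integral_congr_ae (Filter.Eventually.of_forall fun v => ?_)
      simp only
      rcases abs_cases w with ⟨hw, _⟩ | ⟨hw, _⟩ <;> rcases abs_cases v with ⟨hv, _⟩ | ⟨hv, _⟩ <;>
      rcases abs_cases (w + v) with ⟨h3, _⟩ | ⟨h3, _⟩ <;>
      rcases abs_cases (w - v) with ⟨h4, _⟩ | ⟨h4, _⟩ <;>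
      rcases max_cases (|w| - |v|) 0 with ⟨h5, _⟩ | ⟨h5, _⟩ <;> rw [h3, h4, h5] <;> linarith
    rw [← hneg, integral_abs_std] at h1
    linarith
  have e4 : |w| ^ 4 = w ^ 4 := by rw [← abs_pow, abs_of_nonneg (by positivity)]
  rw [sq_abs] at hu hl
  rw [e4] at hl
  constructor <;> rw [key] <;> linarith

end GaussianMoments

section AbsMoment

open scoped RealInnerProductSpace ENNReal

lemma ofReal_integral_le_lintegral {α : Type*} [MeasurableSpace α] {μ : Measure α} {f : α → ℝ}
    (hf : Integrable f μ) : ENNReal.ofReal (∫ x, f x ∂μ) ≤ ∫⁻ x, ENNReal.ofReal (f x) ∂μ := by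
  have h1 : ∫ x, f x ∂μ ≤ ∫ x, max (f x) 0 ∂μ :=
    integral_mono hf hf.pos_part fun x => le_max_left _ _
  refine (ENNReal.ofReal_le_ofReal h1).trans ?_
  rw [ofReal_integral_eq_lintegral_ofReal hf.pos_part
    (Filter.Eventually.of_forall fun x => le_max_right _ _)]
  refine lintegral_mono fun x => ?_
  rcases le_total (f x) 0 with h | h
  · simp [max_eq_right h]
  · rw [max_eq_left h]

variable {H : Type*} [NormedAddCommGroup H] [InnerProductSpace ℝ H] [FiniteDimensional ℝ H]
  [MeasurableSpace H] [BorelSpace H]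

/-- The mixed absolute moment `𝔼 |⟪ξ, a⟫| |⟪ξ, b⟫|` of a standard Gaussian vector `ξ`. -/
def absMoment (a b : H) : ℝ≥0∞ :=
  ∫⁻ ξ, ENNReal.ofReal |⟪ξ, a⟫| * ENNReal.ofReal |⟪ξ, b⟫| ∂stdGaussian H

lemma exists_norm_smul_unit {H : Type*} [NormedAddCommGroup H] [InnerProductSpace ℝ H]
    (hdim : 2 ≤ Module.finrank ℝ H) (a : H) :
    ∃ n : H, ‖n‖ = 1 ∧ a = ‖a‖ • n := by
  have : Nontrivial H := Module.nontrivial_of_finrank_pos (R := ℝ) (by omega)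
  by_cases ha : a = 0
  · obtain ⟨n, hn⟩ := exists_norm_eq H zero_le_one
    exact ⟨n, hn, by simp [ha]⟩
  · refine ⟨‖a‖⁻¹ • a, ?_, ?_⟩
    · rw [norm_smul, norm_inv, norm_norm, inv_mul_cancel₀ (norm_ne_zero_iff.2 ha)]
    · rw [smul_smul, mul_inv_cancel₀ (norm_ne_zero_iff.2 ha), one_smul]

lemma lintegral_abs_inner (hdim : 2 ≤ Module.finrank ℝ H) (v : H) :
    ∫⁻ ξ, ENNReal.ofReal |⟪ξ, v⟫| ∂stdGaussian H
      = ENNReal.ofReal (2 * (√(2 * π))⁻¹ * ‖v‖) := by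
  obtain ⟨n, hn, hv⟩ := exists_norm_smul_unit hdim v
  rw [lintegral_stdGaussian_split hn (by fun_prop)]
  have : ∀ (x : ℝ) (ξ : H), |⟪x • n + (ξ - ⟪n, ξ⟫ • n), v⟫| = ‖v‖ * |x| := by
    intro x ξ
    have : ⟪x • n + (ξ - ⟪n, ξ⟫ • n), v⟫ = ‖v‖ * x := by
      conv_lhs => rw [hv]
      simp only [inner_add_left, inner_sub_left, real_inner_smul_left, real_inner_smul_right,
        real_inner_self_eq_norm_sq, hn, real_inner_comm n ξ]
      ring
    rw [this, abs_mul, abs_norm]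
  simp only [this, lintegral_const, measure_univ, mul_one]
  rw [← ofReal_integral_eq_lintegral_ofReal (integrable_abs_std.const_mul _)
    (Filter.Eventually.of_forall fun x => by positivity), integral_const_mul, integral_abs_std]
  congr 1
  ring

lemma absMoment_eq {n n' : H} (hn : ‖n‖ = 1) (hn' : ‖n'‖ = 1) (hnn : ⟪n, n'⟫ = 0) {A p s : ℝ}
    (hA : 0 ≤ A) : absMoment (A • n) (p • n + s • n')
      = ENNReal.ofReal A * ∫⁻ x, ENNReal.ofReal (|x| * ∫ y, |p * x + s * y| ∂gaussianReal 0 1)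
        ∂gaussianReal 0 1 := by
  unfold absMoment
  rw [lintegral_stdGaussian_split₂ hn hn' hnn (by fun_prop),
    ← lintegral_const_mul' _ _ ENNReal.ofReal_ne_top]
  have hnn' : ⟪n', n⟫ = 0 := by rw [real_inner_comm, hnn]
  refine lintegral_congr fun x => ?_
  have h1 : ∀ (y : ℝ) (ξ : H),
      ENNReal.ofReal |⟪x • n + y • n' + (ξ - ⟪n, ξ⟫ • n - ⟪n', ξ⟫ • n'), A • n⟫| *
      ENNReal.ofReal |⟪x • n + y • n' + (ξ - ⟪n, ξ⟫ • n - ⟪n', ξ⟫ • n'), p • n + s • n'⟫|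
      = ENNReal.ofReal (A * |x|) * ENNReal.ofReal |p * x + s * y| := by
    intro y ξ
    have e1 : ⟪x • n + y • n' + (ξ - ⟪n, ξ⟫ • n - ⟪n', ξ⟫ • n'), n⟫ = x := by
      simp only [inner_add_left, inner_sub_left, real_inner_smul_left,
        real_inner_self_eq_norm_sq, hn, hnn', real_inner_comm n ξ]
      ring
    have e2 : ⟪x • n + y • n' + (ξ - ⟪n, ξ⟫ • n - ⟪n', ξ⟫ • n'), n'⟫ = y := by
      simp only [inner_add_left, inner_sub_left, real_inner_smul_left,
        real_inner_self_eq_norm_sq, hn', hnn, real_inner_comm n' ξ]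
      ring
    rw [inner_add_right, real_inner_smul_right, real_inner_smul_right, real_inner_smul_right,
      e1, e2, abs_mul, abs_of_nonneg hA]
  simp only [h1, lintegral_const, measure_univ, mul_one]
  have hi : Integrable (fun y : ℝ => |p * x + s * y|) (gaussianReal 0 1) := by
    refine ((integrable_const |p * x|).add (integrable_abs_std.const_mul |s|)).mono (by fun_prop)
      (Filter.Eventually.of_forall fun v => ?_)
    simp only [Pi.add_apply]
    rw [Real.norm_of_nonneg (abs_nonneg _), Real.norm_of_nonneg (by positivity), ← abs_mul]
    exact abs_add_le _ _
  rw [lintegral_const_mul' _ _ ENNReal.ofReal_ne_top,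
    ← ofReal_integral_eq_lintegral_ofReal hi (Filter.Eventually.of_forall fun x => abs_nonneg _),
    ENNReal.ofReal_mul hA, ENNReal.ofReal_mul (abs_nonneg x), mul_assoc]

lemma integral_abs_affine_std (p x : ℝ) {s : ℝ} (hs : s ≠ 0) :
    ∫ y, |p * x + s * y| ∂gaussianReal 0 1 = |s| * ∫ y, |p * x / s + y| ∂gaussianReal 0 1 := by
  rw [← integral_const_mul]
  refine integral_congr_ae (Filter.Eventually.of_forall fun y => ?_)
  simp only
  rw [← abs_mul]
  congr 1
  field_simp

lemma integral_odd_poly_std (a b c : ℝ) :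
    Integrable (fun x : ℝ => a * |x| + b * |x| ^ 3 + c * |x| ^ 5) (gaussianReal 0 1) ∧
    ∫ x, (a * |x| + b * |x| ^ 3 + c * |x| ^ 5) ∂gaussianReal 0 1
      = (√(2 * π))⁻¹ * (2 * a + 4 * b + 16 * c) := by
  have i1 := integrable_abs_std.const_mul a
  have i3 := (integrable_abs_pow_std 3).const_mul b
  have i5 := (integrable_abs_pow_std 5).const_mul c
  have e3 := integral_abs_pow_odd_std 1
  have e5 := integral_abs_pow_odd_std 2
  norm_num [Nat.factorial] at e3 e5
  refine ⟨(i1.add i3).add i5, ?_⟩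
  rw [integral_add (f := fun x : ℝ => a * |x| + b * |x| ^ 3) (i1.add i3) i5,
    integral_add i1 i3, integral_const_mul, integral_const_mul,
    integral_const_mul, integral_abs_std, e3, e5]
  norm_num
  ring

lemma inv_sqrt_two_pi_sq : (√(2 * π))⁻¹ * (√(2 * π))⁻¹ = 1 / (2 * π) := by
  rw [← mul_inv, mul_self_sqrt (by positivity), one_div]

lemma inv_sqrt_two_pi_le : (√(2 * π))⁻¹ ≤ 1 / 2 := by
  rw [inv_le_comm₀ (by positivity) (by norm_num)]
  refine le_sqrt_of_sq_le ?_
  nlinarith [pi_gt_three]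

lemma lintegral_abs_mul_abs_le (p : ℝ) {s : ℝ} (hs : s ≠ 0) :
    ∫⁻ x, ENNReal.ofReal (|x| * ∫ y, |p * x + s * y| ∂gaussianReal 0 1) ∂gaussianReal 0 1
      ≤ ENNReal.ofReal (2 / π * (|s| + p ^ 2 / |s|)) := by
  have hs' : 0 < |s| := abs_pos.2 hs
  set P := (√(2 * π))⁻¹ with hP
  obtain ⟨i, e⟩ := integral_odd_poly_std (2 * P * |s|) (P * p ^ 2 / |s|) 0
  calc _ ≤ ∫⁻ x, ENNReal.ofReal (2 * P * |s| * |x| + P * p ^ 2 / |s| * |x| ^ 3 + 0 * |x| ^ 5)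
        ∂gaussianReal 0 1 := by
        refine lintegral_mono fun x => ENNReal.ofReal_le_ofReal ?_
        rw [integral_abs_affine_std p x hs]
        have h := (integral_abs_add_std (p * x / s)).1
        calc |x| * (|s| * ∫ y, |p * x / s + y| ∂gaussianReal 0 1)
            ≤ |x| * (|s| * (P * (2 + (p * x / s) ^ 2))) := by gcongr
          _ = _ := by
            rw [div_pow, mul_pow, ← sq_abs x, ← sq_abs s]
            field_simp
            ring
    _ = _ := by
        rw [← ofReal_integral_eq_lintegral_ofReal i
          (Filter.Eventually.of_forall fun x => by positivity), e]
        congr 1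
        have h2 := inv_sqrt_two_pi_sq
        rw [← hP] at h2
        have : P * (2 * (2 * P * |s|) + 4 * (P * p ^ 2 / |s|) + 16 * 0)
          = (P * P) * (4 * (|s| + p ^ 2 / |s|)) := by ring
        rw [this, h2]
        field_simp
        ring

lemma le_lintegral_abs_mul_abs (p : ℝ) {s : ℝ} (hs : s ≠ 0) :
    ENNReal.ofReal (2 / π * (|s| + p ^ 2 / |s| - p ^ 4 / (3 * |s| ^ 3)))
      ≤ ∫⁻ x, ENNReal.ofReal (|x| * ∫ y, |p * x + s * y| ∂gaussianReal 0 1)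
        ∂gaussianReal 0 1 := by
  have hs' : 0 < |s| := abs_pos.2 hs
  set P := (√(2 * π))⁻¹ with hP
  obtain ⟨i, e⟩ := integral_odd_poly_std (2 * P * |s|) (P * p ^ 2 / |s|)
    (-(P * p ^ 4 / (12 * |s| ^ 3)))
  calc _ = ENNReal.ofReal (∫ x, (2 * P * |s| * |x| + P * p ^ 2 / |s| * |x| ^ 3
        + -(P * p ^ 4 / (12 * |s| ^ 3)) * |x| ^ 5) ∂gaussianReal 0 1) := by
        rw [e]
        congr 1
        have h2 := inv_sqrt_two_pi_sq
        rw [← hP] at h2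
        have : P * (2 * (2 * P * |s|) + 4 * (P * p ^ 2 / |s|)
            + 16 * (-(P * p ^ 4 / (12 * |s| ^ 3))))
          = (P * P) * (4 * (|s| + p ^ 2 / |s| - p ^ 4 / (3 * |s| ^ 3))) := by
          field_simp
          ring
        rw [this, h2]
        field_simp
        ring
    _ ≤ _ := ofReal_integral_le_lintegral i
    _ ≤ _ := by
        refine lintegral_mono fun x => ENNReal.ofReal_le_ofReal ?_
        rw [integral_abs_affine_std p x hs]
        have h := (integral_abs_add_std (p * x / s)).2
        calc _ = |x| * (|s| * (P * (2 + (p * x / s) ^ 2 - (p * x / s) ^ 4 / 12))) := by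
              have hx : x ^ 4 = |x| ^ 4 := by rw [← abs_pow, abs_of_nonneg (by positivity)]
              have hs4 : s ^ 4 = |s| ^ 4 := by rw [← abs_pow, abs_of_nonneg (by positivity)]
              rw [div_pow, mul_pow, div_pow, mul_pow, hx, hs4, ← sq_abs x, ← sq_abs s]
              field_simp
              ring
          _ ≤ _ := by gcongr

lemma lintegral_abs_mul_abs_le' (p s : ℝ) :
    ∫⁻ x, ENNReal.ofReal (|x| * ∫ y, |p * x + s * y| ∂gaussianReal 0 1) ∂gaussianReal 0 1
      ≤ ENNReal.ofReal (2 * |p| + 2 * |s|) := by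
  set P := (√(2 * π))⁻¹ with hP
  have hP0 : 0 ≤ P := by positivity
  have hP1 : P ≤ 1 / 2 := inv_sqrt_two_pi_le
  obtain ⟨i, e⟩ := integral_odd_poly_std (|p| / 2 + 2 * P * |s|) (|p| / 2) 0
  calc _ ≤ ∫⁻ x, ENNReal.ofReal ((|p| / 2 + 2 * P * |s|) * |x| + |p| / 2 * |x| ^ 3
          + 0 * |x| ^ 5) ∂gaussianReal 0 1 := by
        refine lintegral_mono fun x => ENNReal.ofReal_le_ofReal ?_
        have h : ∫ y, |p * x + s * y| ∂gaussianReal 0 1 ≤ |p| * |x| + |s| * (2 * P) := by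
          have i0 := (integrable_const (μ := gaussianReal 0 1) (|p| * |x|))
          have i1 := integrable_abs_std.const_mul |s|
          calc _ ≤ ∫ y, (|p| * |x| + |s| * |y|) ∂gaussianReal 0 1 := by
                refine integral_mono_of_nonneg
                  (Filter.Eventually.of_forall fun x => abs_nonneg _) (i0.add i1)
                  (Filter.Eventually.of_forall fun y => ?_)
                simp only [← abs_mul]
                exact abs_add_le _ _
            _ = _ := by
                rw [integral_add i0 i1, integral_const_mul |s|, integral_abs_std]
                simp [hP]
        calc _ ≤ |x| * (|p| * |x| + |s| * (2 * P)) := by gcongr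
          _ ≤ _ := by
            have : |p| * (|x| * (|x| - 1) ^ 2) ≥ 0 := by positivity
            nlinarith
    _ = ENNReal.ofReal (P * (2 * (|p| / 2 + 2 * P * |s|) + 4 * (|p| / 2) + 16 * 0)) := by
        rw [← ofReal_integral_eq_lintegral_ofReal i
          (Filter.Eventually.of_forall fun x => by positivity), e]
    _ ≤ _ := by
        refine ENNReal.ofReal_le_ofReal ?_
        have : P * (2 * (|p| / 2 + 2 * P * |s|) + 4 * (|p| / 2) + 16 * 0)
          = P * (3 * |p| + 4 * P * |s|) := by ring
        rw [this]
        have h1 : 4 * P * |s| ≤ 2 * |s| := by nlinarith [abs_nonneg s]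
        have h2 : 0 ≤ 4 * P * |s| := by positivity
        nlinarith [abs_nonneg s, abs_nonneg p]

lemma absMoment_le (hdim : 2 ≤ Module.finrank ℝ H) (a b : H) :
    absMoment a b ≤ ENNReal.ofReal (4 * ‖a‖ * ‖b‖) := by
  obtain ⟨n, hn, ha⟩ := exists_norm_smul_unit hdim a
  obtain ⟨n', hn', hnn, hb⟩ := exists_orthogonal_unit hdim hn b
  conv_lhs => rw [ha, hb]
  rw [absMoment_eq hn hn' hnn (norm_nonneg a)]
  refine (mul_le_mul_right (lintegral_abs_mul_abs_le' _ _) _).trans ?_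
  rw [← ENNReal.ofReal_mul (norm_nonneg a)]
  refine ENNReal.ofReal_le_ofReal ?_
  have h1 : |⟪n, b⟫| ≤ ‖b‖ := by simpa [hn] using abs_real_inner_le_norm n b
  have h2 : |⟪n', b⟫| ≤ ‖b‖ := by simpa [hn'] using abs_real_inner_le_norm n' b
  nlinarith [norm_nonneg a]

lemma absMoment_expansion (hdim : 2 ≤ Module.finrank ℝ H) (a b : H) {g : ℝ}
    (hg : g = ‖a‖ ^ 2 * ‖b‖ ^ 2 - ⟪a, b⟫ ^ 2) (hg0 : 0 < g) :
    absMoment a b ≤ ENNReal.ofReal (2 / π * (‖a‖ ^ 2 * ‖b‖ ^ 2 / √g)) ∧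
    ENNReal.ofReal (2 / π * (‖a‖ ^ 2 * ‖b‖ ^ 2 / √g - ⟪a, b⟫ ^ 4 / (3 * √g ^ 3)))
      ≤ absMoment a b := by
  obtain ⟨n, hn, ha⟩ := exists_norm_smul_unit hdim a
  obtain ⟨n', hn', hnn, hb⟩ := exists_orthogonal_unit hdim hn b
  set p := ⟪n, b⟫ with hp
  set s := ⟪n', b⟫ with hs
  have hab : ⟪a, b⟫ = ‖a‖ * p := by
    conv_lhs => rw [ha]
    rw [real_inner_smul_left]
  have hbn : ‖b‖ ^ 2 = p ^ 2 + s ^ 2 := by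
    have : ‖b‖ ^ 2 = ⟪b, p • n + s • n'⟫ := by
      conv_rhs => rw [← hb]
      rw [real_inner_self_eq_norm_sq]
    rw [this, inner_add_right, real_inner_smul_right, real_inner_smul_right,
      real_inner_comm n b, real_inner_comm n' b, ← hp, ← hs]
    ring
  have hgs : g = (‖a‖ * |s|) ^ 2 := by
    rw [hg, hab, hbn, mul_pow, mul_pow, sq_abs]
    ring
  have hsq : √g = ‖a‖ * |s| := by rw [hgs, sqrt_sq (by positivity)]
  have hpos : 0 < ‖a‖ * |s| := by
    rw [← hsq]
    exact sqrt_pos.2 hg0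
  have ha0 : 0 < ‖a‖ := pos_of_mul_pos_left hpos (abs_nonneg s)
  have hs0 : 0 < |s| := pos_of_mul_pos_right hpos ha0.le
  have e : absMoment a b = ENNReal.ofReal ‖a‖ * ∫⁻ x, ENNReal.ofReal
      (|x| * ∫ y, |p * x + s * y| ∂gaussianReal 0 1) ∂gaussianReal 0 1 := by
    conv_lhs => rw [ha, hb]
    exact absMoment_eq hn hn' hnn (norm_nonneg a)
  rw [e, hsq, hab, hbn]
  constructor
  · refine (mul_le_mul_right (lintegral_abs_mul_abs_le _ (abs_pos.1 hs0)) _).trans (le_of_eq ?_)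
    rw [← ENNReal.ofReal_mul (norm_nonneg a)]
    congr 1
    rw [← sq_abs s]
    field_simp
    ring
  · refine (le_of_eq ?_).trans (mul_le_mul_right (le_lintegral_abs_mul_abs _ (abs_pos.1 hs0)) _)
    rw [← ENNReal.ofReal_mul (norm_nonneg a)]
    congr 1
    rw [← sq_abs s]
    field_simp
    ring

end AbsMoment

section PairDensity

open scoped RealInnerProductSpace ENNReal

lemma inner_perpTo_comm {H : Type*} [NormedAddCommGroup H] [InnerProductSpace ℝ H] (u ξ v : H) :
    ⟪perpTo u ξ, v⟫ = ⟪ξ, perpTo u v⟫ := by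
  simp only [perpTo, inner_sub_left, inner_sub_right, real_inner_smul_left,
    real_inner_smul_right, real_inner_comm u ξ]
  ring

lemma perpTo_of_inner_eq_zero {H : Type*} [NormedAddCommGroup H] [InnerProductSpace ℝ H] {u v : H}
    (h : ⟪u, v⟫ = 0) : perpTo u v = v := by
  simp [perpTo, h]

lemma perpTo_self {H : Type*} [NormedAddCommGroup H] [InnerProductSpace ℝ H] {u : H}
    (h : ‖u‖ = 1) : perpTo u u = 0 := by
  simp [perpTo, h]

lemma inner_deriv_eq_zero {H : Type*} [NormedAddCommGroup H] [InnerProductSpace ℝ H]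
    {φ φ' : ℝ → H} (hφ : ∀ s, HasDerivAt φ (φ' s) s) (h1 : ∀ s, ‖φ s‖ = 1) (s : ℝ) :
    ⟪φ s, φ' s⟫ = 0 := by
  have h := (hφ s).inner ℝ (hφ s)
  have h2 : (fun t => ⟪φ t, φ t⟫) = fun _ => (1 : ℝ) := by
    funext t
    rw [real_inner_self_eq_norm_sq, h1, one_pow]
  rw [h2] at h
  have h3 := h.unique (hasDerivAt_const s (1 : ℝ))
  linarith [real_inner_comm (φ s) (φ' s)]

variable {H : Type*} [NormedAddCommGroup H] [InnerProductSpace ℝ H] [FiniteDimensional ℝ H]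
  [MeasurableSpace H] [BorelSpace H]

/-- The two-point Kac–Rice density of zeros of `s ↦ ⟪ξ, φ s⟫` at two points where `φ` takes the
values `u`, `v` and its derivative the values `u'`, `v'`. -/
def pairDensity (u u' v v' : H) : ℝ≥0∞ :=
  ENNReal.ofReal (2 * π * ‖perpTo u v‖)⁻¹ *
    absMoment (perpTo (perpTo u v) u') (perpTo (perpTo u v) (perpTo u v'))

lemma conditional_zeroCount (hdim : 2 ≤ Module.finrank ℝ H) {φ φ' : ℝ → H}
    (hφ : ∀ s, HasDerivAt φ (φ' s) s) (hφ' : Continuous φ') {u u' : H} (hu : ⟪u, u'⟫ = 0)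
    {J : Set ℝ} (hJ : IsSigmaCompact J) (hne : ∀ s ∈ J, perpTo u (φ s) ≠ 0) :
    ENNReal.ofReal (√(2 * π))⁻¹ *
      ∫⁻ ξ, zeroCount φ J (perpTo u ξ) * ENNReal.ofReal |⟪perpTo u ξ, u'⟫| ∂stdGaussian H
      = ∫⁻ s in J, pairDensity u u' (φ s) (φ' s) := by
  have hψ : ∀ s, HasDerivAt (fun s => perpTo u (φ s)) (perpTo u (φ' s)) s := by
    intro s
    unfold perpTo
    have h2 : HasDerivAt (fun s => ⟪u, φ s⟫) ⟪u, φ' s⟫ s := by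
      simpa using (hasDerivAt_const s u).inner ℝ (hφ s)
    exact (hφ s).sub ((h2.div_const _).smul_const u)
  have hψ' : Continuous fun s => perpTo u (φ' s) := (continuous_perpTo u).comp hφ'
  have hG : Measurable fun ξ : H => ENNReal.ofReal |⟪ξ, u'⟫| := by fun_prop
  have hz : ∀ ξ, zeroCount φ J (perpTo u ξ) = zeroCount (fun s => perpTo u (φ s)) J ξ := by
    intro ξ
    unfold zeroCount
    simp only [inner_perpTo_comm]
  have hi : ∀ ξ, ⟪perpTo u ξ, u'⟫ = ⟪ξ, u'⟫ := fun ξ => by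
    rw [inner_perpTo_comm, perpTo_of_inner_eq_zero hu]
  simp only [hz, hi]
  rw [lintegral_zeroCount_mul hdim hψ hψ' hJ hne hG,
    ← lintegral_const_mul' _ _ ENNReal.ofReal_ne_top]
  refine lintegral_congr fun s => ?_
  unfold pairDensity absMoment
  simp only [inner_perpTo_comm]
  rw [← mul_assoc, ← ENNReal.ofReal_mul (by positivity)]
  congr 2
  rw [← mul_inv, ← mul_assoc, mul_self_sqrt (by positivity)]

lemma lintegral_zeroCount (hdim : 2 ≤ Module.finrank ℝ H) {φ φ' : ℝ → H}
    (hφ : ∀ s, HasDerivAt φ (φ' s) s) (hφ' : Continuous φ') (h1 : ∀ s, ‖φ s‖ = 1)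
    {J : Set ℝ} (hJ : IsSigmaCompact J) :
    ∫⁻ ξ, zeroCount φ J ξ ∂stdGaussian H = ∫⁻ s in J, ENNReal.ofReal (‖φ' s‖ / π) := by
  have h := lintegral_zeroCount_mul hdim hφ hφ' hJ
    (fun s _ hs => by simpa [hs] using h1 s) (G := fun _ => 1) measurable_const
  simp only [mul_one, one_mul] at h
  rw [h]
  refine lintegral_congr fun s => ?_
  simp only [inner_perpTo_comm, perpTo_of_inner_eq_zero (inner_deriv_eq_zero hφ h1 s), h1]
  rw [lintegral_abs_inner hdim, ← ENNReal.ofReal_mul (by positivity), mul_one]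
  congr 1
  have h2 := inv_sqrt_two_pi_sq
  calc _ = ((√(2 * π))⁻¹ * (√(2 * π))⁻¹) * (2 * ‖φ' s‖) := by ring
    _ = _ := by
      rw [h2]
      field_simp

lemma lintegral_zeroCount_mul_zeroCount (hdim : 2 ≤ Module.finrank ℝ H) {φ φ' : ℝ → H}
    (hφ : ∀ s, HasDerivAt φ (φ' s) s) (hφ' : Continuous φ') (h1 : ∀ s, ‖φ s‖ = 1)
    {I J : Set ℝ} (hI : IsSigmaCompact I) (hJ : IsSigmaCompact J)
    (hne : ∀ t ∈ I, ∀ s ∈ J, perpTo (φ t) (φ s) ≠ 0) :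
    ∫⁻ ξ, zeroCount φ I ξ * zeroCount φ J ξ ∂stdGaussian H
      = ∫⁻ t in I, ∫⁻ s in J, pairDensity (φ t) (φ' t) (φ s) (φ' s) := by
  have hφc : Continuous φ := continuous_iff_continuousAt.2 fun s => (hφ s).continuousAt
  rw [lintegral_zeroCount_mul hdim hφ hφ' hI
    (fun s _ hs => by simpa [hs] using h1 s) (measurable_zeroCount hφc hJ)]
  refine setLIntegral_congr_fun hI.measurableSet' fun t ht => ?_
  rw [← conditional_zeroCount hdim hφ hφ' (inner_deriv_eq_zero hφ h1 t) hJ (hne t ht), h1, mul_one]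

lemma lintegral_zeroCount_sq (hdim : 2 ≤ Module.finrank ℝ H) {φ φ' : ℝ → H}
    (hφ : ∀ s, HasDerivAt φ (φ' s) s) (hφ' : Continuous φ') (h1 : ∀ s, ‖φ s‖ = 1)
    {I : Set ℝ} (hI : IsSigmaCompact I)
    (hne : ∀ t ∈ I, ∀ s ∈ I, s ≠ t → perpTo (φ t) (φ s) ≠ 0) :
    ∫⁻ ξ, zeroCount φ I ξ ^ 2 ∂stdGaussian H
      = ∫⁻ t in I, (ENNReal.ofReal (‖φ' t‖ / π) +
          ∫⁻ s in I \ {t}, pairDensity (φ t) (φ' t) (φ s) (φ' s)) := by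
  have hφc : Continuous φ := continuous_iff_continuousAt.2 fun s => (hφ s).continuousAt
  simp only [sq]
  rw [lintegral_zeroCount_mul hdim hφ hφ' hI
    (fun s _ hs => by simpa [hs] using h1 s) (measurable_zeroCount hφc hI)]
  refine setLIntegral_congr_fun hI.measurableSet' fun t ht => ?_
  have h0 := inner_deriv_eq_zero hφ h1 t
  have hIt : IsSigmaCompact (I \ {t}) := hI.sdiff_singleton t
  have hN : ∀ ξ, zeroCount φ I (perpTo (φ t) ξ) = 1 + zeroCount φ (I \ {t}) (perpTo (φ t) ξ) := by
    intro ξ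
    unfold zeroCount
    have hset : I ∩ {s | ⟪perpTo (φ t) ξ, φ s⟫ = 0}
        = {t} ∪ (I \ {t}) ∩ {s | ⟪perpTo (φ t) ξ, φ s⟫ = 0} := by
      ext s
      by_cases hs : s = t
      · subst hs
        simp [ht, inner_perpTo_comm, perpTo_self (h1 s)]
      · simp [hs]
    rw [hset, measure_union, Measure.count_singleton]
    · exact Set.disjoint_left.2 fun s hs hs' => hs'.1.2 hs
    · exact hIt.measurableSet'.inter
        (isClosed_eq (by fun_prop) continuous_const).measurableSet
  rw [← conditional_zeroCount hdim hφ hφ' h0 hIt (fun s hs => hne t ht s hs.1 hs.2), h1, mul_one]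
  simp only [hN, add_mul, one_mul]
  have hm : Measurable fun ξ => ENNReal.ofReal |⟪perpTo (φ t) ξ, φ' t⟫| :=
    ((continuous_perpTo (φ t)).inner continuous_const).abs.measurable.ennreal_ofReal
  rw [lintegral_add_left hm, mul_add]
  congr 1
  simp only [inner_perpTo_comm, perpTo_of_inner_eq_zero h0]
  rw [lintegral_abs_inner hdim, ← ENNReal.ofReal_mul (by positivity)]
  congr 1
  have h2 := inv_sqrt_two_pi_sq
  calc _ = ((√(2 * π))⁻¹ * (√(2 * π))⁻¹) * (2 * ‖φ' t‖) := by ring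
    _ = _ := by
      rw [h2]
      field_simp

end PairDensity

section RealExpansion

lemma abs_mul_sub_one_add_le {S X Y x y a b c : ℝ} (hS : S ≤ 1) (hX : |X - (1 + x)| ≤ a * S)
    (hY : |Y - (1 + y)| ≤ b * S) (hx : |x| ≤ 1) (hy : |y| ≤ 1) (hx2 : x ^ 2 ≤ c * S)
    (hy2 : y ^ 2 ≤ c * S) (ha : 0 ≤ a) (hb : 0 ≤ b) (hS0 : 0 ≤ S) :
    |X * Y - (1 + (x + y))| ≤ (c + 2 * a + 2 * b + a * b) * S := by
  set ε := X - (1 + x) with hε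
  set δ := Y - (1 + y) with hδ
  have e : X * Y - (1 + (x + y)) = x * y + ε * (1 + y) + δ * (1 + x) + ε * δ := by
    rw [hε, hδ]; ring
  have h1 : |x * y| ≤ c * S := by
    rw [abs_le]; constructor <;> nlinarith [sq_nonneg (x - y), sq_nonneg (x + y)]
  have h2 : |ε * (1 + y)| ≤ a * S * 2 := by
    rw [abs_mul]
    refine mul_le_mul hX ?_ (abs_nonneg _) (by positivity)
    rw [abs_le] at hy ⊢; constructor <;> linarith
  have h3 : |δ * (1 + x)| ≤ b * S * 2 := by
    rw [abs_mul]
    refine mul_le_mul hY ?_ (abs_nonneg _) (by positivity)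
    rw [abs_le] at hx ⊢; constructor <;> linarith
  have h4 : |ε * δ| ≤ a * b * S := by
    rw [abs_mul]
    calc _ ≤ (a * S) * (b * S) := mul_le_mul hX hY (abs_nonneg _) (by positivity)
      _ = (a * b * S) * S := by ring
      _ ≤ a * b * S := mul_le_of_le_one_right (by positivity) hS
  rw [e]
  calc _ ≤ |x * y| + |ε * (1 + y)| + |δ * (1 + x)| + |ε * δ| := by
        refine (abs_add_le _ _).trans (add_le_add ((abs_add_le _ _).trans
          (add_le_add (abs_add_le _ _) le_rfl)) le_rfl)
    _ ≤ _ := by linarith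

set_option maxHeartbeats 1000000 in
lemma kacRice_ratio_expansion {r α β κ p A B D S : ℝ} (hr : r ^ 2 ≤ 1 / 16) (hα : α ^ 2 ≤ 1 / 16)
    (hβ : β ^ 2 ≤ 1 / 16) (hκ : κ ^ 2 ≤ 1 / 16) (hp : p * (1 - r ^ 2) = 1)
    (hA : A = 1 - p * α ^ 2) (hB : B = 1 - p * β ^ 2) (hD : D = κ + p * r * α * β)
    (hS : S = r ^ 4 + α ^ 4 + β ^ 4 + κ ^ 4) :
    1 / 2 ≤ A * B - D ^ 2 ∧ D ^ 4 ≤ 3 * S ∧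
    |√p * (A * B) / √(A * B - D ^ 2) - (1 + (r ^ 2 - α ^ 2 - β ^ 2 + κ ^ 2) / 2)|
      ≤ 1122 * S := by
  obtain ⟨e, he⟩ : ∃ e, e = r ^ 2 := ⟨_, rfl⟩
  obtain ⟨f, hf⟩ : ∃ f, f = α ^ 2 := ⟨_, rfl⟩
  obtain ⟨g, hg⟩ : ∃ g, g = β ^ 2 := ⟨_, rfl⟩
  obtain ⟨k, hk⟩ : ∃ k, k = κ ^ 2 := ⟨_, rfl⟩
  have e0 : 0 ≤ e := he ▸ sq_nonneg r
  have f0 : 0 ≤ f := hf ▸ sq_nonneg α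
  have g0 : 0 ≤ g := hg ▸ sq_nonneg β
  have k0 : 0 ≤ k := hk ▸ sq_nonneg κ
  have hS' : S = e ^ 2 + f ^ 2 + g ^ 2 + k ^ 2 := by rw [hS, he, hf, hg, hk]; ring
  rw [← he] at hr hp ⊢
  rw [← hf] at hα hA ⊢
  rw [← hg] at hβ hB ⊢
  rw [← hk] at hκ ⊢
  have hS0 : 0 ≤ S := by rw [hS']; positivity
  have hS1 : S ≤ 1 / 64 := by
    have h := mul_le_mul hr hr e0 (by norm_num)
    have h2 := mul_le_mul hα hα f0 (by norm_num)
    have h3 := mul_le_mul hβ hβ g0 (by norm_num)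
    have h4 := mul_le_mul hκ hκ k0 (by norm_num)
    rw [hS']; linarith
  have hS4 : e ^ 2 ≤ S ∧ f ^ 2 ≤ S ∧ g ^ 2 ≤ S ∧ k ^ 2 ≤ S := by
    have := sq_nonneg e
    have := sq_nonneg f
    have := sq_nonneg g
    have := sq_nonneg k
    refine ⟨?_, ?_, ?_, ?_⟩ <;> linarith
  obtain ⟨se, sf, sg, sk⟩ := hS4
  have p0 : 0 < p := by
    refine pos_of_mul_pos_left (b := 1 - e) (by rw [hp]; norm_num) (by linarith)
  have p1 : p ≤ 16 / 15 := by
    have := mul_le_mul_of_nonneg_left hr p0.le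
    linarith
  have ppe : p - 1 = p * e := by linarith
  have hpe : 0 ≤ p * e := by positivity
  have a1 : |A - (1 + -f)| ≤ 1 * S := by
    have : A - (1 + -f) = -(p * (e * f)) := by
      rw [hA]; linear_combination (-f) * ppe
    rw [this, abs_neg, abs_of_nonneg (by positivity)]
    have h := mul_le_mul_of_nonneg_right p1 (mul_nonneg e0 f0)
    linarith [sq_nonneg (e - f), sq_nonneg g, sq_nonneg k]
  have b1 : |B - (1 + -g)| ≤ 1 * S := by
    have : B - (1 + -g) = -(p * (e * g)) := by
      rw [hB]; linear_combination (-g) * ppe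
    rw [this, abs_neg, abs_of_nonneg (by positivity)]
    have h := mul_le_mul_of_nonneg_right p1 (mul_nonneg e0 g0)
    linarith [sq_nonneg (e - g), sq_nonneg f, sq_nonneg k]
  have p2 : |p - (1 + e)| ≤ 2 * S := by
    have : p - (1 + e) = p * e ^ 2 := by linear_combination (1 + e) * ppe
    rw [this, abs_of_nonneg (by positivity)]
    have h := mul_le_mul_of_nonneg_right p1 (sq_nonneg e)
    linarith
  have ab : |A * B - (1 + (-f + -g))| ≤ 6 * S := by
    refine (abs_mul_sub_one_add_le (c := 1) (by linarith) a1 b1 ?_ ?_ ?_ ?_ zero_le_one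
      zero_le_one hS0).trans (le_of_eq (by ring))
    · rw [abs_le]; constructor <;> linarith
    · rw [abs_le]; constructor <;> linarith
    · rw [neg_sq]; linarith
    · rw [neg_sq]; linarith
  have hfg1 : |-f + -g| ≤ 1 := by rw [abs_le]; constructor <;> linarith
  have hfg2 : (-f + -g) ^ 2 ≤ 2 * S := by
    linarith [sq_nonneg (f - g), sq_nonneg e, sq_nonneg k]
  have abab : |A * B * (A * B) - (1 + (-f + -g + (-f + -g)))| ≤ 62 * S :=
    (abs_mul_sub_one_add_le (by linarith) ab ab hfg1 hfg1 hfg2 hfg2 (by norm_num)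
      (by norm_num) hS0).trans (le_of_eq (by ring))
  have num : |p * (A * B * (A * B)) - (1 + (e + (-f + -g + (-f + -g))))| ≤ 260 * S := by
    refine (abs_mul_sub_one_add_le (c := 8) (by linarith) p2 abab ?_ ?_ ?_ ?_ (by norm_num)
      (by norm_num) hS0).trans (le_of_eq (by ring))
    · rw [abs_le]; constructor <;> linarith
    · rw [abs_le]; constructor <;> linarith
    · linarith
    · linarith [sq_nonneg (-f + -g), (by ring : (-f + -g + (-f + -g)) ^ 2 = 4 * (-f + -g) ^ 2)]
  have d2 : |D ^ 2 - k| ≤ 2 * S := by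
    have h1 : D ^ 2 - k = 2 * p * ((r * α) * (β * κ)) + p ^ 2 * (e * (f * g)) := by
      rw [hD, he, hf, hg, hk]; ring
    have h2 : |(r * α) * (β * κ)| ≤ S / 4 := by
      have h3 : (r * α) ^ 2 ≤ (e ^ 2 + f ^ 2) / 2 := by
        rw [mul_pow, ← he, ← hf]; linarith [sq_nonneg (e - f)]
      have h4 : (β * κ) ^ 2 ≤ (g ^ 2 + k ^ 2) / 2 := by
        rw [mul_pow, ← hg, ← hk]; linarith [sq_nonneg (g - k)]
      have h5 := sq_nonneg (r * α + β * κ)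
      have h6 := sq_nonneg (r * α - β * κ)
      rw [hS', abs_le]
      constructor <;> linarith
    have h3 : e * (f * g) ≤ S / 16 := by
      have : f * g ≤ S := by
        linarith [sq_nonneg (f - g), sq_nonneg e, sq_nonneg k]
      calc e * (f * g) ≤ 1 / 16 * S := mul_le_mul hr this (mul_nonneg f0 g0) (by norm_num)
        _ = S / 16 := by ring
    have h4 : p ^ 2 ≤ 2 := by
      calc p ^ 2 ≤ (16 / 15) ^ 2 := by gcongr
        _ ≤ 2 := by norm_num
    have h5 : 0 ≤ e * (f * g) := by positivity
    have h6 : |2 * p * ((r * α) * (β * κ))| ≤ S := by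
      rw [abs_mul, abs_of_pos (by positivity : 0 < 2 * p)]
      calc _ ≤ 4 * (S / 4) := mul_le_mul (by linarith) h2 (abs_nonneg _) (by norm_num)
        _ = S := by ring
    have h7 : |p ^ 2 * (e * (f * g))| ≤ S := by
      rw [abs_of_nonneg (by positivity)]
      calc _ ≤ 2 * (S / 16) := mul_le_mul h4 h3 h5 (by norm_num)
        _ ≤ S := by linarith
    rw [h1]
    exact (abs_add_le _ _).trans (by linarith)
  set G := A * B - D ^ 2 with hG
  have hGa : |G - (1 + (-f + -g + -k))| ≤ 8 * S := by
    have : G - (1 + (-f + -g + -k)) = (A * B - (1 + (-f + -g))) - (D ^ 2 - k) := by rw [hG]; ring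
    rw [this]
    exact (abs_sub _ _).trans (by linarith)
  have hGh : 1 / 2 ≤ G := by
    have := (abs_le.1 hGa).1
    linarith
  have hD4 : D ^ 4 ≤ 3 * S := by
    have h1 := (abs_le.1 d2).2
    have h2 : D ^ 2 ≤ k + 2 * S := by linarith
    calc D ^ 4 = (D ^ 2) ^ 2 := by ring
      _ ≤ (k + 2 * S) ^ 2 := by gcongr
      _ ≤ 3 * S := by
        have h4 : S * S ≤ S * (1 / 64) := mul_le_mul_of_nonneg_left hS1 hS0
        linarith [sq_nonneg (k - 2 * S)]
  refine ⟨hGh, hD4, ?_⟩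
  set x := e - f - g + k with hx
  have hx1 : |x| ≤ 1 := by rw [hx, abs_le]; constructor <;> linarith
  have hx2 : x ^ 2 ≤ 4 * S := by
    rw [hx, hS']
    linarith [sq_nonneg (e + f), sq_nonneg (e + g), sq_nonneg (e - k), sq_nonneg (f - g),
      sq_nonneg (f + k), sq_nonneg (g + k)]
  have den : |(1 + x) * G - (1 + (x + (-f + -g + -k)))| ≤ 20 * S := by
    refine (abs_mul_sub_one_add_le (a := 0) (c := 4) (by linarith) (by simp) hGa hx1 ?_ hx2 ?_
      le_rfl (by norm_num) hS0).trans (le_of_eq (by ring))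
    · rw [abs_le]; constructor <;> linarith
    · rw [hS']
      linarith [sq_nonneg (f - g), sq_nonneg (f - k), sq_nonneg (g - k), sq_nonneg e,
        sq_nonneg f, sq_nonneg g, sq_nonneg k]
  set T := √p * (A * B) / √G with hT
  have hAB : 0 ≤ A * B := by linarith [sq_nonneg D]
  have hT0 : 0 ≤ T := by positivity
  have hT2 : T ^ 2 * G = p * (A * B * (A * B)) := by
    rw [hT, div_pow, mul_pow, sq_sqrt p0.le, sq_sqrt (by linarith)]
    field_simp
  have hQ : |T ^ 2 - (1 + x)| * G ≤ 280 * S := by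
    rw [← abs_of_pos (by linarith : 0 < G), ← abs_mul, sub_mul, hT2]
    have : p * (A * B * (A * B)) - (1 + x) * G
      = (p * (A * B * (A * B)) - (1 + (e + (-f + -g + (-f + -g)))))
        - ((1 + x) * G - (1 + (x + (-f + -g + -k)))) := by rw [hx]; ring
    rw [this]
    exact (abs_sub _ _).trans (by linarith)
  have hQ' : |T ^ 2 - (1 + x)| ≤ 560 * S := by
    have := mul_le_mul_of_nonneg_left hGh (abs_nonneg (T ^ 2 - (1 + x)))
    linarith
  have hfac : |T - (1 + x / 2)| * (T + (1 + x / 2)) ≤ 561 * S := by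
    have h1 : 0 ≤ T + (1 + x / 2) := by linarith [(abs_le.1 hx1).1]
    rw [← abs_of_nonneg h1, ← abs_mul]
    have : (T - (1 + x / 2)) * (T + (1 + x / 2)) = (T ^ 2 - (1 + x)) - x ^ 2 / 4 := by ring
    rw [this]
    refine (abs_sub _ _).trans ?_
    rw [abs_of_nonneg (by positivity : 0 ≤ x ^ 2 / 4)]
    linarith
  have h12 : 1 / 2 ≤ T + (1 + x / 2) := by linarith [(abs_le.1 hx1).1]
  have := mul_le_mul_of_nonneg_left h12 (abs_nonneg (T - (1 + x / 2)))
  linarith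

end RealExpansion

section PairExpansion

open scoped RealInnerProductSpace ENNReal

lemma inner_perpTo_perpTo {H : Type*} [NormedAddCommGroup H] [InnerProductSpace ℝ H] (w x y : H) :
    ⟪perpTo w x, perpTo w y⟫ = ⟪x, y⟫ - ⟪w, x⟫ * ⟪w, y⟫ / ‖w‖ ^ 2 := by
  rcases eq_or_ne w 0 with rfl | hw
  · simp [perpTo]
  have : ‖w‖ ^ 2 ≠ 0 := by simpa using hw
  simp only [perpTo, inner_sub_left, inner_sub_right, real_inner_smul_left,
    real_inner_smul_right, real_inner_self_eq_norm_sq, real_inner_comm w x]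
  field_simp
  ring

lemma norm_perpTo_sq {H : Type*} [NormedAddCommGroup H] [InnerProductSpace ℝ H] (w x : H) :
    ‖perpTo w x‖ ^ 2 = ‖x‖ ^ 2 - ⟪w, x⟫ ^ 2 / ‖w‖ ^ 2 := by
  rw [← real_inner_self_eq_norm_sq, inner_perpTo_perpTo, real_inner_self_eq_norm_sq, sq ⟪w, x⟫]

lemma norm_perpTo_le {H : Type*} [NormedAddCommGroup H] [InnerProductSpace ℝ H] (w x : H) :
    ‖perpTo w x‖ ≤ ‖x‖ := by
  refine le_of_sq_le_sq ?_ (norm_nonneg _)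
  rw [norm_perpTo_sq]
  have : 0 ≤ ⟪w, x⟫ ^ 2 / ‖w‖ ^ 2 := by positivity
  linarith

variable {H : Type*} [NormedAddCommGroup H] [InnerProductSpace ℝ H] [FiniteDimensional ℝ H]
  [MeasurableSpace H] [BorelSpace H]

lemma pairDensity_le (hdim : 2 ≤ Module.finrank ℝ H) (u u' v v' : H) :
    pairDensity u u' v v' ≤ ENNReal.ofReal ((2 * π * ‖perpTo u v‖)⁻¹ *
      (4 * ‖perpTo (perpTo u v) u'‖ * ‖perpTo (perpTo u v) (perpTo u v')‖)) := by
  rw [pairDensity, ENNReal.ofReal_mul (by positivity)]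
  gcongr
  exact absMoment_le hdim _ _

lemma pairDensity_expansion (hdim : 2 ≤ Module.finrank ℝ H) {u u' v v' : H} {σ r α β κ : ℝ}
    (hu : ‖u‖ = 1) (hv : ‖v‖ = 1) (huu : ⟪u, u'⟫ = 0) (hvv : ⟪v, v'⟫ = 0) (hσ : 0 < σ)
    (hu' : ‖u'‖ = σ) (hv' : ‖v'‖ = σ) (hr : ⟪u, v⟫ = r) (hα : ⟪u', v⟫ = σ * α)
    (hβ : ⟪u, v'⟫ = σ * β) (hκ : ⟪u', v'⟫ = σ ^ 2 * κ) (hr2 : |r| ≤ 1 / 2) :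
    ENNReal.ofReal (σ ^ 2 / π ^ 2 * (1 + (r ^ 2 - α ^ 2 - β ^ 2 + κ ^ 2) / 2
      - 10000 * (r ^ 4 + α ^ 4 + β ^ 4 + κ ^ 4))) ≤ pairDensity u u' v v' ∧
    pairDensity u u' v v' ≤ ENNReal.ofReal (σ ^ 2 / π ^ 2 *
      (1 + (r ^ 2 - α ^ 2 - β ^ 2 + κ ^ 2) / 2 + 10000 * (r ^ 4 + α ^ 4 + β ^ 4 + κ ^ 4))) := by
  obtain ⟨S, hS⟩ : ∃ S, S = r ^ 4 + α ^ 4 + β ^ 4 + κ ^ 4 := ⟨_, rfl⟩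
  obtain ⟨p, hp⟩ : ∃ p, p = (1 - r ^ 2)⁻¹ := ⟨_, rfl⟩
  have hr4 : r ^ 2 ≤ 1 / 4 := by
    rw [← sq_abs]
    calc |r| ^ 2 ≤ (1 / 2) ^ 2 := by gcongr
      _ = 1 / 4 := by norm_num
  have hd0 : 0 < 1 - r ^ 2 := by linarith
  have hp1 : p * (1 - r ^ 2) = 1 := by rw [hp]; exact inv_mul_cancel₀ hd0.ne'
  have hp0 : 0 < p := by rw [hp]; positivity
  have hw : ‖perpTo u v‖ ^ 2 = 1 - r ^ 2 := by rw [norm_perpTo_sq, hr, hu, hv]; ring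
  have hw' : ‖perpTo u v‖⁻¹ = √p := by
    rw [hp, sqrt_inv, ← hw, sqrt_sq (norm_nonneg _)]
  have hw1 : ⟪perpTo u v, u'⟫ = σ * α := by
    rw [inner_perpTo_comm, perpTo_of_inner_eq_zero huu, real_inner_comm, hα]
  have hw2 : ⟪perpTo u v, perpTo u v'⟫ = -(σ * r * β) := by
    rw [inner_perpTo_perpTo, hvv, hr, hβ, hu]; ring
  have hA : ‖perpTo (perpTo u v) u'‖ ^ 2 = σ ^ 2 * (1 - p * α ^ 2) := by
    rw [norm_perpTo_sq, hw1, hw, hu', div_eq_mul_inv, ← hp]; ring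
  have hB : ‖perpTo (perpTo u v) (perpTo u v')‖ ^ 2 = σ ^ 2 * (1 - p * β ^ 2) := by
    rw [norm_perpTo_sq, hw2, hw, norm_perpTo_sq, hu, hβ, hv', div_eq_mul_inv _ (1 - r ^ 2), ← hp]
    linear_combination (σ ^ 2 * β ^ 2) * hp1
  have hD : ⟪perpTo (perpTo u v) u', perpTo (perpTo u v) (perpTo u v')⟫
      = σ ^ 2 * (κ + p * r * α * β) := by
    rw [inner_perpTo_perpTo, hw1, hw2, hw, ← inner_perpTo_comm, perpTo_of_inner_eq_zero huu, hκ,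
      div_eq_mul_inv, ← hp]
    ring
  rw [← hS]
  by_cases hsmall : r ^ 2 ≤ 1 / 16 ∧ α ^ 2 ≤ 1 / 16 ∧ β ^ 2 ≤ 1 / 16 ∧ κ ^ 2 ≤ 1 / 16
  · obtain ⟨h1, h2, h3, h4⟩ := hsmall
    obtain ⟨hG, hD4, hT⟩ := kacRice_ratio_expansion h1 h2 h3 h4 hp1 rfl rfl rfl hS
    obtain ⟨A, hA'⟩ : ∃ A, A = 1 - p * α ^ 2 := ⟨_, rfl⟩
    obtain ⟨B, hB'⟩ : ∃ B, B = 1 - p * β ^ 2 := ⟨_, rfl⟩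
    obtain ⟨D, hD'⟩ : ∃ D, D = κ + p * r * α * β := ⟨_, rfl⟩
    rw [← hA'] at hA hG hT
    rw [← hB'] at hB hG hT
    rw [← hD'] at hD hG hT hD4
    have hg : σ ^ 4 * (A * B - D ^ 2) = ‖perpTo (perpTo u v) u'‖ ^ 2 *
        ‖perpTo (perpTo u v) (perpTo u v')‖ ^ 2
        - ⟪perpTo (perpTo u v) u', perpTo (perpTo u v) (perpTo u v')⟫ ^ 2 := by
      rw [hA, hB, hD]; ring
    have hG0 : 0 < A * B - D ^ 2 := by linarith
    obtain ⟨hle, hge⟩ := absMoment_expansion hdim _ _ hg (by positivity)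
    rw [hA, hB] at hle
    rw [hA, hB, hD] at hge
    have hsq : √(σ ^ 4 * (A * B - D ^ 2)) = σ ^ 2 * √(A * B - D ^ 2) := by
      rw [sqrt_mul (by positivity), show σ ^ 4 = (σ ^ 2) ^ 2 by ring, sqrt_sq (by positivity)]
    rw [hsq] at hle hge
    obtain ⟨R, hR⟩ : ∃ R, R = √(A * B - D ^ 2) := ⟨_, rfl⟩
    rw [← hR] at hle hge hT
    have hR0 : 0 < R := by rw [hR]; positivity
    have hp2 : √p ≤ 2 := by
      rw [sqrt_le_left (by norm_num)]
      have := mul_le_mul_of_nonneg_left hr4 hp0.le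
      linarith
    have hpref : (2 * π * ‖perpTo u v‖)⁻¹ = √p / (2 * π) := by
      rw [mul_inv, hw']; ring
    have hRh : 1 / 2 ≤ R := by
      rw [hR]; refine le_sqrt_of_sq_le ?_; linarith
    have hR3 : 1 / 4 ≤ 3 * R ^ 3 := by
      have : (1 / 2) ^ 3 ≤ R ^ 3 := by gcongr
      linarith
    have hS0 : 0 ≤ S := by rw [hS]; positivity
    have herr : √p * (D ^ 4 / (3 * R ^ 3)) ≤ 24 * S := by
      have : D ^ 4 / (3 * R ^ 3) ≤ 12 * S := by
        rw [div_le_iff₀ (by positivity)]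
        have := mul_le_mul_of_nonneg_left hR3 (by positivity : 0 ≤ 12 * S)
        linarith
      calc _ ≤ 2 * (12 * S) := mul_le_mul hp2 this (by positivity) (by norm_num)
        _ = _ := by ring
    have hT' := abs_le.1 hT
    unfold pairDensity
    rw [hpref]
    constructor
    · refine le_trans ?_ (mul_le_mul_right hge _)
      rw [← ENNReal.ofReal_mul (by positivity)]
      refine ENNReal.ofReal_le_ofReal ?_
      have e : √p / (2 * π) * (2 / π * (σ ^ 2 * A * (σ ^ 2 * B) / (σ ^ 2 * R)
          - (σ ^ 2 * D) ^ 4 / (3 * (σ ^ 2 * R) ^ 3)))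
          = σ ^ 2 / π ^ 2 * (√p * (A * B) / R - √p * (D ^ 4 / (3 * R ^ 3))) := by
        field_simp
      rw [e]
      refine mul_le_mul_of_nonneg_left ?_ (by positivity)
      linarith [hT'.1]
    · refine (mul_le_mul_right hle _).trans ?_
      rw [← ENNReal.ofReal_mul (by positivity)]
      refine ENNReal.ofReal_le_ofReal ?_
      have e : √p / (2 * π) * (2 / π * (σ ^ 2 * A * (σ ^ 2 * B) / (σ ^ 2 * R)))
          = σ ^ 2 / π ^ 2 * (√p * (A * B) / R) := by
        field_simp
      rw [e]
      refine mul_le_mul_of_nonneg_left ?_ (by positivity)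
      linarith [hT'.2]
  · have hr0 := sq_nonneg (r ^ 2 - 1)
    have hα0 := sq_nonneg (α ^ 2 - 1)
    have hβ0 := sq_nonneg (β ^ 2 - 1)
    have hκ0 := sq_nonneg (κ ^ 2 - 1)
    have hr1 := sq_nonneg (r ^ 2)
    have hα1 := sq_nonneg (α ^ 2)
    have hβ1 := sq_nonneg (β ^ 2)
    have hκ1 := sq_nonneg (κ ^ 2)
    have hS256 : 1 / 256 ≤ S := by
      have aux : ∀ z : ℝ, ¬ z ≤ 1 / 16 → 1 / 256 ≤ z ^ 2 := fun z hz => by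
        have : (1 / 16) ^ 2 ≤ z ^ 2 := by gcongr; linarith
        linarith
      rw [hS]
      by_cases h1 : r ^ 2 ≤ 1 / 16
      · by_cases h2 : α ^ 2 ≤ 1 / 16
        · by_cases h3 : β ^ 2 ≤ 1 / 16
          · linarith [aux _ fun h4 => hsmall ⟨h1, h2, h3, h4⟩]
          · linarith [aux _ h3]
        · linarith [aux _ h2]
      · linarith [aux _ h1]
    constructor
    · rw [ENNReal.ofReal_of_nonpos]
      · exact zero_le
      · refine mul_nonpos_of_nonneg_of_nonpos (by positivity) ?_
        linarith [sq_nonneg α, sq_nonneg β]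
    · refine (pairDensity_le hdim _ _ _ _).trans (ENNReal.ofReal_le_ofReal ?_)
      have hwh : ‖perpTo u v‖⁻¹ ≤ 2 := by
        rw [hw', sqrt_le_left (by norm_num)]
        have := mul_le_mul_of_nonneg_left hr4 hp0.le
        linarith
      have ha := (norm_perpTo_le (perpTo u v) u').trans_eq hu'
      have hb := (norm_perpTo_le (perpTo u v) (perpTo u v')).trans
        ((norm_perpTo_le u v').trans_eq hv')
      calc _ = ‖perpTo u v‖⁻¹ * (‖perpTo (perpTo u v) u'‖ *
            ‖perpTo (perpTo u v) (perpTo u v')‖) * (2 / π) := by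
            rw [mul_inv, mul_inv]; ring
        _ ≤ 2 * (σ * σ) * (2 / π) := by gcongr
        _ = σ ^ 2 / π ^ 2 * (4 * π) := by field_simp; ring
        _ ≤ _ := by
          refine mul_le_mul_of_nonneg_left ?_ (by positivity)
          linarith [pi_le_four, sq_nonneg r, sq_nonneg κ]

end PairExpansion

section UnitCurve

open scoped RealInnerProductSpace ENNReal

/-- A twice differentiable curve on the unit sphere of `H` which has constant speed `σ` and
acceleration at most `K` on `[0, L]`. -/
structure UnitCurve (H : Type*) [NormedAddCommGroup H] [InnerProductSpace ℝ H] (L σ K : ℝ) where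
  φ : ℝ → H
  φ' : ℝ → H
  φ'' : ℝ → H
  hφ : ∀ s, HasDerivAt φ (φ' s) s
  hφ' : ∀ s, HasDerivAt φ' (φ'' s) s
  norm_eq_one : ∀ s, ‖φ s‖ = 1
  norm_deriv : ∀ s ∈ Set.Icc 0 L, ‖φ' s‖ = σ
  norm_deriv2 : ∀ s ∈ Set.Icc 0 L, ‖φ'' s‖ ≤ K
  pos_L : 0 < L
  pos_σ : 0 < σ

namespace UnitCurve

variable {H : Type*} [NormedAddCommGroup H] [InnerProductSpace ℝ H] {L σ K : ℝ}
  (c : UnitCurve H L σ K)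

lemma continuous_φ : Continuous c.φ :=
  continuous_iff_continuousAt.2 fun s => (c.hφ s).continuousAt

lemma continuous_φ' : Continuous c.φ' :=
  continuous_iff_continuousAt.2 fun s => (c.hφ' s).continuousAt

lemma K_nonneg {H : Type*} [NormedAddCommGroup H] [InnerProductSpace ℝ H] {L σ K : ℝ}
    (c : UnitCurve H L σ K) : 0 ≤ K :=
  (norm_nonneg _).trans (c.norm_deriv2 0 ⟨le_rfl, c.pos_L.le⟩)

lemma inner_φ_φ' (s : ℝ) : ⟪c.φ s, c.φ' s⟫ = 0 := inner_deriv_eq_zero c.hφ c.norm_eq_one s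

lemma norm_taylor_le {t s : ℝ} (ht : t ∈ Set.Icc 0 L) (hs : s ∈ Set.Icc 0 L) :
    ‖c.φ s - c.φ t - (s - t) • c.φ' t‖ ≤ K * |s - t| ^ 2 := by
  have hsub : Set.uIcc t s ⊆ Set.Icc 0 L := Set.uIcc_subset_Icc ht hs
  have h1 : ∀ x ∈ Set.uIcc t s, ‖c.φ' x - c.φ' t‖ ≤ K * |s - t| := by
    intro x hx
    refine ((convex_Icc 0 L).norm_image_sub_le_of_norm_hasDerivWithin_le
      (fun y _ => (c.hφ' y).hasDerivWithinAt) c.norm_deriv2 ht (hsub hx)).trans ?_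
    exact mul_le_mul_of_nonneg_left (Set.abs_sub_left_of_mem_uIcc hx) c.K_nonneg
  have h2 : ∀ x ∈ Set.uIcc t s, HasDerivWithinAt (fun x => c.φ x - (x - t) • c.φ' t)
      (c.φ' x - c.φ' t) (Set.uIcc t s) x := by
    intro x _
    have := (c.hφ x).sub (((hasDerivAt_id x).sub_const t).smul_const (c.φ' t))
    rw [one_smul] at this
    exact this.hasDerivWithinAt
  have h3 := (convex_uIcc t s).norm_image_sub_le_of_norm_hasDerivWithin_le h2 h1
    Set.left_mem_uIcc Set.right_mem_uIcc
  have e : c.φ s - (s - t) • c.φ' t - (c.φ t - (t - t) • c.φ' t)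
      = c.φ s - c.φ t - (s - t) • c.φ' t := by
    rw [sub_self, zero_smul]; abel
  rw [e, Real.norm_eq_abs] at h3
  exact h3.trans_eq (by ring)

lemma perpTo_add (u x y : H) : perpTo u (x + y) = perpTo u x + perpTo u y := by
  simp only [perpTo, inner_add_right, add_div, add_smul]; abel

lemma le_norm_perpTo {t s : ℝ} (ht : t ∈ Set.Icc 0 L) (hs : s ∈ Set.Icc 0 L)
    (h : K * |s - t| ≤ σ / 2) : |s - t| * σ / 2 ≤ ‖perpTo (c.φ t) (c.φ s)‖ := by
  have e : c.φ s = c.φ t + ((s - t) • c.φ' t + (c.φ s - c.φ t - (s - t) • c.φ' t)) := by abel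
  have e2 : perpTo (c.φ t) (c.φ s)
      = (s - t) • c.φ' t + perpTo (c.φ t) (c.φ s - c.φ t - (s - t) • c.φ' t) := by
    conv_lhs => rw [e]
    rw [perpTo_add, perpTo_add, perpTo_self (c.norm_eq_one t), zero_add,
      perpTo_of_inner_eq_zero (v := (s - t) • c.φ' t)]
    rw [real_inner_smul_right, c.inner_φ_φ', mul_zero]
  have h1 := (norm_perpTo_le (c.φ t) _).trans (c.norm_taylor_le ht hs)
  have h2 : ‖(s - t) • c.φ' t‖ = |s - t| * σ := by
    rw [norm_smul, c.norm_deriv t ht, Real.norm_eq_abs]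
  have h3 := norm_sub_le_norm_add ((s - t) • c.φ' t)
    (perpTo (c.φ t) (c.φ s - c.φ t - (s - t) • c.φ' t))
  rw [e2]
  have h4 := mul_le_mul_of_nonneg_left h (abs_nonneg (s - t))
  rw [h2] at h3
  linarith [(by ring : K * |s - t| ^ 2 = |s - t| * (K * |s - t|))]

lemma perpTo_ne_zero {t s : ℝ} (ht : t ∈ Set.Icc 0 L) (hs : s ∈ Set.Icc 0 L) (hts : s ≠ t)
    (h : K * |s - t| ≤ σ / 2) : perpTo (c.φ t) (c.φ s) ≠ 0 := by
  have h1 := c.le_norm_perpTo ht hs h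
  have h2 : 0 < |s - t| := abs_pos.2 (sub_ne_zero.2 hts)
  have h3 := c.pos_σ
  exact norm_pos_iff.1 (lt_of_lt_of_le (by positivity) h1)

lemma norm_perpTo_perpTo_le {u v x : H} {d : ℝ} (hu : ‖u‖ = 1) (hd : d ≠ 0) :
    ‖perpTo (perpTo u v) (perpTo u x)‖ ≤ ‖v - u - d • x‖ / |d| := by
  have hself : perpTo (perpTo u v) (perpTo u v) = 0 := by
    rcases eq_or_ne (perpTo u v) 0 with h | h
    · rw [h, perpTo, smul_zero, sub_zero]
    · have : ‖perpTo u v‖ ^ 2 ≠ 0 := by simpa using h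
      rw [perpTo, real_inner_self_eq_norm_sq, div_self this, one_smul, sub_self]
  have e : perpTo (perpTo u v) (perpTo u (v - u - d • x))
      = (-d) • perpTo (perpTo u v) (perpTo u x) := by
    have e1 : v - u - d • x = v + ((-1 : ℝ) • u + (-d) • x) := by
      rw [neg_smul, neg_smul, one_smul]; abel
    have hsmul : ∀ (w y : H) (k : ℝ), perpTo w (k • y) = k • perpTo w y := by
      intro w y k
      simp only [perpTo, real_inner_smul_right, smul_sub, smul_smul, mul_div_assoc]
    rw [e1, perpTo_add, perpTo_add u (_ • u), hsmul, hsmul, perpTo_self hu, smul_zero, zero_add,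
      perpTo_add, hsmul, hself, zero_add]
  have h := (norm_perpTo_le (perpTo u v) (perpTo u (v - u - d • x))).trans (norm_perpTo_le _ _)
  rw [e, norm_smul, norm_neg, Real.norm_eq_abs] at h
  rw [le_div_iff₀ (abs_pos.2 hd)]
  linarith

variable [FiniteDimensional ℝ H] [MeasurableSpace H] [BorelSpace H]

lemma pairDensity_le_of_near (hdim : 2 ≤ Module.finrank ℝ H) {t s : ℝ} (ht : t ∈ Set.Icc 0 L)
    (hs : s ∈ Set.Icc 0 L) (hts : s ≠ t) (h : K * |s - t| ≤ σ / 2) :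
    pairDensity (c.φ t) (c.φ' t) (c.φ s) (c.φ' s) ≤ ENNReal.ofReal K := by
  refine (pairDensity_le hdim _ _ _ _).trans (ENNReal.ofReal_le_ofReal ?_)
  have hd : s - t ≠ 0 := sub_ne_zero.2 hts
  have hd0 : 0 < |s - t| := abs_pos.2 hd
  have hσ := c.pos_σ
  have hK := c.K_nonneg
  have hw := c.le_norm_perpTo ht hs h
  have ha : ‖perpTo (perpTo (c.φ t) (c.φ s)) (c.φ' t)‖ ≤ K * |s - t| := by
    have h1 := norm_perpTo_perpTo_le (v := c.φ s) (x := c.φ' t) (c.norm_eq_one t) hd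
    rw [perpTo_of_inner_eq_zero (c.inner_φ_φ' t)] at h1
    refine h1.trans ?_
    rw [div_le_iff₀ hd0]
    exact (c.norm_taylor_le ht hs).trans_eq (by ring)
  have hb : ‖perpTo (perpTo (c.φ t) (c.φ s)) (perpTo (c.φ t) (c.φ' s))‖ ≤ K * |s - t| := by
    refine (norm_perpTo_perpTo_le (c.norm_eq_one t) hd).trans ?_
    rw [div_le_iff₀ hd0]
    have h1 := c.norm_taylor_le hs ht
    rw [← norm_neg, abs_sub_comm t s] at h1
    have e : -(c.φ t - c.φ s - (t - s) • c.φ' s) = c.φ s - c.φ t - (s - t) • c.φ' s := by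
      rw [← neg_sub s t, neg_smul]; abel
    rw [e] at h1
    exact h1.trans_eq (by ring)
  calc _ ≤ (2 * π * (|s - t| * σ / 2))⁻¹ * (4 * (K * |s - t|) * (K * |s - t|)) := by gcongr
    _ ≤ (2 * π * (|s - t| * σ / 2))⁻¹ * (4 * (K * |s - t|) * (σ / 2)) := by gcongr
    _ = K * (2 / π) := by field_simp; ring
    _ ≤ K * 1 := by
      gcongr
      rw [div_le_one pi_pos]
      linarith [pi_gt_three]
    _ = K := mul_one K

lemma lintegral_zeroCount_Ico (hdim : 2 ≤ Module.finrank ℝ H) {a b : ℝ} (ha : 0 ≤ a)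
    (hb : b ≤ L) :
    ∫⁻ ξ, zeroCount c.φ (Set.Ico a b) ξ ∂stdGaussian H = ENNReal.ofReal ((b - a) * (σ / π)) := by
  have hsub : Set.Ico a b ⊆ Set.Icc 0 L := fun t ht => ⟨ha.trans ht.1, ht.2.le.trans hb⟩
  rw [lintegral_zeroCount hdim c.hφ c.continuous_φ' c.norm_eq_one (isSigmaCompact_Ico a b),
    setLIntegral_congr_fun measurableSet_Ico
      (fun t ht => by simp only [c.norm_deriv t (hsub ht)] : Set.EqOn
        (fun t => ENNReal.ofReal (‖c.φ' t‖ / π)) (fun _ => ENNReal.ofReal (σ / π)) _),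
    setLIntegral_const, Real.volume_Ico, ← ENNReal.ofReal_mul (by have := c.pos_σ; positivity),
    mul_comm]

lemma lintegral_zeroCount_sq_le (hdim : 2 ≤ Module.finrank ℝ H) {a b : ℝ} (ha : 0 ≤ a)
    (hab : a ≤ b) (hb : b ≤ L) (h : K * (b - a) ≤ σ / 2) :
    ∫⁻ ξ, zeroCount c.φ (Set.Ico a b) ξ ^ 2 ∂stdGaussian H
      ≤ ENNReal.ofReal ((b - a) * (σ / π) + (b - a) ^ 2 * K) := by
  have hsub : Set.Ico a b ⊆ Set.Icc 0 L := fun t ht => ⟨ha.trans ht.1, ht.2.le.trans hb⟩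
  have hba : 0 ≤ b - a := sub_nonneg.2 hab
  have hnear : ∀ t ∈ Set.Ico a b, ∀ s ∈ Set.Ico a b, K * |s - t| ≤ σ / 2 := by
    intro t ht s hs
    refine (mul_le_mul_of_nonneg_left ?_ c.K_nonneg).trans h
    rw [abs_le]; constructor <;> linarith [ht.1, ht.2, hs.1, hs.2]
  have hσ := c.pos_σ
  have hK := c.K_nonneg
  rw [lintegral_zeroCount_sq hdim c.hφ c.continuous_φ' c.norm_eq_one (isSigmaCompact_Ico a b)
    (fun t ht s hs hts => c.perpTo_ne_zero (hsub ht) (hsub hs) hts (hnear t ht s hs))]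
  have hpt : ∀ t ∈ Set.Ico a b, ENNReal.ofReal (‖c.φ' t‖ / π) +
      ∫⁻ s in Set.Ico a b \ {t}, pairDensity (c.φ t) (c.φ' t) (c.φ s) (c.φ' s)
      ≤ ENNReal.ofReal (σ / π + (b - a) * K) := by
    intro t ht
    rw [c.norm_deriv t (hsub ht), ENNReal.ofReal_add (by positivity) (by positivity)]
    gcongr
    calc _ ≤ ∫⁻ s in Set.Ico a b \ {t}, ENNReal.ofReal K :=
          setLIntegral_mono measurable_const fun s hs =>
            c.pairDensity_le_of_near hdim (hsub ht) (hsub hs.1) hs.2 (hnear t ht s hs.1)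
      _ ≤ ∫⁻ s in Set.Ico a b, ENNReal.ofReal K := lintegral_mono_set Set.sdiff_subset
      _ = _ := by
        rw [setLIntegral_const, Real.volume_Ico, ← ENNReal.ofReal_mul hK, mul_comm]
  calc _ ≤ ∫⁻ t in Set.Ico a b, ENNReal.ofReal (σ / π + (b - a) * K) :=
        setLIntegral_mono measurable_const hpt
    _ = _ := by
      rw [setLIntegral_const, Real.volume_Ico, ← ENNReal.ofReal_mul (by positivity)]
      congr 1; ring

end UnitCurve

end UnitCurve

section Covariance

open scoped RealInnerProductSpace ENNReal

lemma _root_.Continuous.integrableOn_Ico_prod {F : ℝ × ℝ → ℝ} (hF : Continuous F) (a b a' b' : ℝ) :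
    IntegrableOn F (Set.Ico a b ×ˢ Set.Ico a' b') :=
  (hF.continuousOn.integrableOn_compact (isCompact_Icc.prod isCompact_Icc)).mono_set
    (Set.prod_mono Set.Ico_subset_Icc_self Set.Ico_subset_Icc_self)

lemma volume_real_Ico_prod {a b a' b' : ℝ} (h : a ≤ b) (h' : a' ≤ b') :
    (volume : Measure (ℝ × ℝ)).real (Set.Ico a b ×ˢ Set.Ico a' b') = (b - a) * (b' - a') := by
  rw [Measure.real, Measure.volume_eq_prod, Measure.prod_prod, Real.volume_Ico, Real.volume_Ico,
    ENNReal.toReal_mul, ENNReal.toReal_ofReal (sub_nonneg.2 h),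
    ENNReal.toReal_ofReal (sub_nonneg.2 h')]

lemma setIntegral_affine {F G : ℝ × ℝ → ℝ} (hF : Continuous F) (hG : Continuous G)
    {a b a' b' : ℝ} (h : a ≤ b) (h' : a' ≤ b') (k l : ℝ) :
    ∫ p in Set.Ico a b ×ˢ Set.Ico a' b', k * (1 + F p / 2 + l * G p)
      = k * ((b - a) * (b' - a') + (∫ p in Set.Ico a b ×ˢ Set.Ico a' b', F p) / 2
        + l * ∫ p in Set.Ico a b ×ˢ Set.Ico a' b', G p) := by
  have i1 : IntegrableOn (fun _ : ℝ × ℝ => (1 : ℝ)) (Set.Ico a b ×ˢ Set.Ico a' b') :=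
    continuous_const.integrableOn_Ico_prod _ _ _ _
  have i2 : IntegrableOn (fun p => F p / 2) (Set.Ico a b ×ˢ Set.Ico a' b') :=
    (hF.div_const 2).integrableOn_Ico_prod _ _ _ _
  have i3 : IntegrableOn (fun p => l * G p) (Set.Ico a b ×ˢ Set.Ico a' b') :=
    (hG.const_mul l).integrableOn_Ico_prod _ _ _ _
  rw [integral_const_mul, integral_add (f := fun p => 1 + F p / 2) (i1.add i2) i3,
    integral_add i1 i2, integral_div, integral_const_mul, setIntegral_const,
    volume_real_Ico_prod h h', smul_eq_mul, mul_one]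

lemma setLIntegral_Ico_prod {f : ℝ × ℝ → ℝ≥0∞} (hf : Measurable f) (a b a' b' : ℝ) :
    ∫⁻ p in Set.Ico a b ×ˢ Set.Ico a' b', f p
      = ∫⁻ t in Set.Ico a b, ∫⁻ s in Set.Ico a' b', f (t, s) := by
  rw [Measure.volume_eq_prod, ← Measure.prod_restrict, lintegral_prod _ hf.aemeasurable]

namespace UnitCurve

variable {H : Type*} [NormedAddCommGroup H] [InnerProductSpace ℝ H] {L σ K : ℝ}
  (c : UnitCurve H L σ K)

/-- The covariance of the process `⟪ξ, φ⟫` at two points. -/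
def corr (p : ℝ × ℝ) : ℝ := ⟪c.φ p.1, c.φ p.2⟫

/-- The normalized covariance of the derivative at the first point with the value at the second. -/
def corrL (p : ℝ × ℝ) : ℝ := ⟪c.φ' p.1, c.φ p.2⟫ / σ

/-- The normalized covariance of the value at the first point with the derivative at the second. -/
def corrR (p : ℝ × ℝ) : ℝ := ⟪c.φ p.1, c.φ' p.2⟫ / σ

/-- The normalized covariance of the derivatives at two points. -/
def corrLR (p : ℝ × ℝ) : ℝ := ⟪c.φ' p.1, c.φ' p.2⟫ / σ ^ 2

/-- The second order term of the expansion of the two-point density. -/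
def mainTerm (p : ℝ × ℝ) : ℝ :=
  c.corr p ^ 2 - c.corrL p ^ 2 - c.corrR p ^ 2 + c.corrLR p ^ 2

/-- The error term of the expansion of the two-point density. -/
def quartTerm (p : ℝ × ℝ) : ℝ :=
  c.corr p ^ 4 + c.corrL p ^ 4 + c.corrR p ^ 4 + c.corrLR p ^ 4

lemma continuous_corr : Continuous c.corr :=
  (c.continuous_φ.comp continuous_fst).inner (c.continuous_φ.comp continuous_snd)

lemma continuous_corrL : Continuous c.corrL :=
  ((c.continuous_φ'.comp continuous_fst).inner (c.continuous_φ.comp continuous_snd)).div_const _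

lemma continuous_corrR : Continuous c.corrR :=
  ((c.continuous_φ.comp continuous_fst).inner (c.continuous_φ'.comp continuous_snd)).div_const _

lemma continuous_corrLR : Continuous c.corrLR :=
  ((c.continuous_φ'.comp continuous_fst).inner (c.continuous_φ'.comp continuous_snd)).div_const _

lemma continuous_mainTerm : Continuous c.mainTerm :=
  (((c.continuous_corr.pow 2).sub (c.continuous_corrL.pow 2)).sub (c.continuous_corrR.pow 2)).add
    (c.continuous_corrLR.pow 2)

lemma continuous_quartTerm : Continuous c.quartTerm :=
  (((c.continuous_corr.pow 4).add (c.continuous_corrL.pow 4)).add (c.continuous_corrR.pow 4)).add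
    (c.continuous_corrLR.pow 4)

lemma quartTerm_nonneg (p : ℝ × ℝ) : 0 ≤ c.quartTerm p := by
  unfold quartTerm; positivity

lemma sq_inner_div_le_one {x y : H} {k : ℝ} (h : ‖x‖ * ‖y‖ = k) (hk : 0 < k) :
    (⟪x, y⟫ / k) ^ 2 ≤ 1 := by
  rw [sq_le_one_iff_abs_le_one, abs_div, abs_of_pos hk, div_le_one hk, ← h]
  exact abs_real_inner_le_norm x y

lemma abs_mainTerm_le {t s : ℝ} (ht : t ∈ Set.Icc 0 L) (hs : s ∈ Set.Icc 0 L) :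
    |c.mainTerm (t, s)| ≤ 2 := by
  have hσ := c.pos_σ
  have h1 : c.corr (t, s) ^ 2 ≤ 1 := by
    have := sq_inner_div_le_one (x := c.φ t) (y := c.φ s) (k := 1)
      (by rw [c.norm_eq_one, c.norm_eq_one, mul_one]) one_pos
    rwa [div_one] at this
  have h2 : c.corrL (t, s) ^ 2 ≤ 1 :=
    sq_inner_div_le_one (by simp only [c.norm_deriv t ht, c.norm_eq_one, mul_one]) hσ
  have h3 : c.corrR (t, s) ^ 2 ≤ 1 :=
    sq_inner_div_le_one (by simp only [c.norm_deriv s hs, c.norm_eq_one, one_mul]) hσ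
  have h4 : c.corrLR (t, s) ^ 2 ≤ 1 :=
    sq_inner_div_le_one (by simp only [c.norm_deriv s hs, c.norm_deriv t ht, sq]) (by positivity)
  unfold mainTerm
  rw [abs_le]
  constructor <;> linarith [sq_nonneg (c.corr (t, s)), sq_nonneg (c.corrL (t, s)),
    sq_nonneg (c.corrR (t, s)), sq_nonneg (c.corrLR (t, s))]

lemma abs_corr_sub_le {t s t' s' : ℝ} (ht : t ∈ Set.Icc 0 L) (hs : s ∈ Set.Icc 0 L)
    (ht' : t' ∈ Set.Icc 0 L) (hs' : s' ∈ Set.Icc 0 L) :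
    |c.corr (t, s) - c.corr (t', s')| ≤ σ * |t - t'| + σ * |s - s'| := by
  have lip : ∀ x ∈ Set.Icc 0 L, ∀ y ∈ Set.Icc 0 L, ‖c.φ x - c.φ y‖ ≤ σ * |x - y| :=
    fun x hx y hy => (convex_Icc 0 L).norm_image_sub_le_of_norm_hasDerivWithin_le
      (fun z _ => (c.hφ z).hasDerivWithinAt) (fun z hz => (c.norm_deriv z hz).le) hy hx
  have e : c.corr (t, s) - c.corr (t', s')
      = ⟪c.φ t - c.φ t', c.φ s⟫ + ⟪c.φ t', c.φ s - c.φ s'⟫ := by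
    simp only [corr, inner_sub_left, inner_sub_right]; ring
  rw [e]
  refine (abs_add_le _ _).trans (add_le_add ?_ ?_)
  · refine (abs_real_inner_le_norm _ _).trans ?_
    rw [c.norm_eq_one, mul_one]
    exact lip t ht t' ht'
  · refine (abs_real_inner_le_norm _ _).trans ?_
    rw [c.norm_eq_one, one_mul]
    exact lip s hs s' hs'

lemma abs_setIntegral_mainTerm_le {a b a' b' : ℝ} (ha : 0 ≤ a) (hab : a ≤ b) (hb : b ≤ L)
    (ha' : 0 ≤ a') (hab' : a' ≤ b') (hb' : b' ≤ L) :
    |∫ p in Set.Ico a b ×ˢ Set.Ico a' b', c.mainTerm p| ≤ 2 * ((b - a) * (b' - a')) := by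
  have h := norm_setIntegral_le_of_norm_le_const (μ := volume) (f := c.mainTerm) (C := 2)
    (s := Set.Ico a b ×ˢ Set.Ico a' b') (by
      rw [Measure.volume_eq_prod, Measure.prod_prod, Real.volume_Ico, Real.volume_Ico]
      exact ENNReal.mul_lt_top ENNReal.ofReal_lt_top ENNReal.ofReal_lt_top)
    fun p hp => c.abs_mainTerm_le ⟨ha.trans hp.1.1, hp.1.2.le.trans hb⟩
      ⟨ha'.trans hp.2.1, hp.2.2.le.trans hb'⟩
  rwa [volume_real_Ico_prod hab hab'] at h

variable [FiniteDimensional ℝ H] [MeasurableSpace H] [BorelSpace H]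

lemma pairDensity_bounds (hdim : 2 ≤ Module.finrank ℝ H) {t s : ℝ} (ht : t ∈ Set.Icc 0 L)
    (hs : s ∈ Set.Icc 0 L) (h : |c.corr (t, s)| ≤ 1 / 2) :
    ENNReal.ofReal (σ ^ 2 / π ^ 2 *
      (1 + c.mainTerm (t, s) / 2 + (-10000) * c.quartTerm (t, s)))
      ≤ pairDensity (c.φ t) (c.φ' t) (c.φ s) (c.φ' s) ∧
    pairDensity (c.φ t) (c.φ' t) (c.φ s) (c.φ' s) ≤ ENNReal.ofReal (σ ^ 2 / π ^ 2 *
      (1 + c.mainTerm (t, s) / 2 + 10000 * c.quartTerm (t, s))) := by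
  have hσ := c.pos_σ.ne'
  have := pairDensity_expansion hdim (c.norm_eq_one t) (c.norm_eq_one s) (c.inner_φ_φ' t)
    (c.inner_φ_φ' s) c.pos_σ (c.norm_deriv t ht) (c.norm_deriv s hs)
    (r := c.corr (t, s)) (α := c.corrL (t, s)) (β := c.corrR (t, s)) (κ := c.corrLR (t, s)) rfl
    (by simp only [corrL]; field_simp) (by simp only [corrR]; field_simp)
    (by simp only [corrLR]; field_simp) h
  refine ⟨?_, this.2⟩
  rw [neg_mul, ← sub_eq_add_neg]
  exact this.1

/-- The mixed moment of the numbers of zeros in two intervals. -/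
def mixedMoment (a b a' b' : ℝ) : ℝ≥0∞ :=
  ∫⁻ ξ, zeroCount c.φ (Set.Ico a b) ξ * zeroCount c.φ (Set.Ico a' b') ξ ∂stdGaussian H

lemma mixedMoment_of_corr_le (hdim : 2 ≤ Module.finrank ℝ H) {a b a' b' : ℝ} (ha : 0 ≤ a)
    (hab : a ≤ b) (hb : b ≤ L) (ha' : 0 ≤ a') (hab' : a' ≤ b') (hb' : b' ≤ L)
    (h : ∀ t ∈ Set.Ico a b, ∀ s ∈ Set.Ico a' b', |c.corr (t, s)| ≤ 1 / 2) :
    c.mixedMoment a b a' b' ≠ ⊤ ∧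
    |(c.mixedMoment a b a' b').toReal - σ ^ 2 / π ^ 2 * ((b - a) * (b' - a')
        + (∫ p in Set.Ico a b ×ˢ Set.Ico a' b', c.mainTerm p) / 2)|
      ≤ σ ^ 2 / π ^ 2 * (10000 * ∫ p in Set.Ico a b ×ˢ Set.Ico a' b', c.quartTerm p) := by
  have hsub : Set.Ico a b ⊆ Set.Icc 0 L := fun t ht => ⟨ha.trans ht.1, ht.2.le.trans hb⟩
  have hsub' : Set.Ico a' b' ⊆ Set.Icc 0 L := fun t ht => ⟨ha'.trans ht.1, ht.2.le.trans hb'⟩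
  have hσ := c.pos_σ
  have hne : ∀ t ∈ Set.Ico a b, ∀ s ∈ Set.Ico a' b', perpTo (c.φ t) (c.φ s) ≠ 0 := by
    intro t ht s hs h0
    have h1 := norm_perpTo_sq (c.φ t) (c.φ s)
    have h2 : ⟪c.φ t, c.φ s⟫ ^ 2 ≤ (1 / 2) ^ 2 := sq_le_sq' (abs_le.1 (h t ht s hs)).1
      (abs_le.1 (h t ht s hs)).2
    rw [h0, norm_zero, c.norm_eq_one, c.norm_eq_one] at h1
    linarith
  have hform : c.mixedMoment a b a' b' = ∫⁻ t in Set.Ico a b, ∫⁻ s in Set.Ico a' b',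
      pairDensity (c.φ t) (c.φ' t) (c.φ s) (c.φ' s) :=
    lintegral_zeroCount_mul_zeroCount hdim c.hφ c.continuous_φ' c.norm_eq_one
      (isSigmaCompact_Ico a b) (isSigmaCompact_Ico a' b') hne
  have hcont : ∀ l : ℝ, Continuous fun p => σ ^ 2 / π ^ 2 *
      (1 + c.mainTerm p / 2 + l * c.quartTerm p) := fun l =>
    ((continuous_const.add (c.continuous_mainTerm.div_const 2)).add
      (c.continuous_quartTerm.const_mul l)).const_mul _
  have hmeas : ∀ l : ℝ, Measurable fun p => ENNReal.ofReal (σ ^ 2 / π ^ 2 *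
      (1 + c.mainTerm p / 2 + l * c.quartTerm p)) := fun l => (hcont l).measurable.ennreal_ofReal
  have hupper : c.mixedMoment a b a' b' ≤ ENNReal.ofReal (∫ p in Set.Ico a b ×ˢ Set.Ico a' b',
      σ ^ 2 / π ^ 2 * (1 + c.mainTerm p / 2 + 10000 * c.quartTerm p)) := by
    rw [ofReal_integral_eq_lintegral_ofReal ((hcont 10000).integrableOn_Ico_prod _ _ _ _),
      setLIntegral_Ico_prod (hmeas 10000), hform]
    · refine setLIntegral_mono' measurableSet_Ico fun t ht =>
        setLIntegral_mono' measurableSet_Ico fun s hs => ?_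
      exact (c.pairDensity_bounds hdim (hsub ht) (hsub' hs) (h t ht s hs)).2
    · refine (ae_restrict_iff' (measurableSet_Ico.prod measurableSet_Ico)).2
        (Filter.Eventually.of_forall fun p hp => ?_)
      have h1 := (abs_le.1 (c.abs_mainTerm_le (hsub hp.1) (hsub' hp.2))).1
      have h2 := c.quartTerm_nonneg p
      exact mul_nonneg (by positivity) (by linarith)
  have hlower : ENNReal.ofReal (∫ p in Set.Ico a b ×ˢ Set.Ico a' b',
      σ ^ 2 / π ^ 2 * (1 + c.mainTerm p / 2 + (-10000) * c.quartTerm p))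
      ≤ c.mixedMoment a b a' b' := by
    refine (ofReal_integral_le_lintegral
      ((hcont (-10000)).integrableOn_Ico_prod _ _ _ _)).trans ?_
    rw [setLIntegral_Ico_prod (hmeas (-10000)), hform]
    refine setLIntegral_mono' measurableSet_Ico fun t ht =>
      setLIntegral_mono' measurableSet_Ico fun s hs => ?_
    exact (c.pairDensity_bounds hdim (hsub ht) (hsub' hs) (h t ht s hs)).1
  rw [setIntegral_affine c.continuous_mainTerm c.continuous_quartTerm hab hab'] at hupper hlower
  have hfin : c.mixedMoment a b a' b' ≠ ⊤ := (hupper.trans_lt ENNReal.ofReal_lt_top).ne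
  refine ⟨hfin, ?_⟩
  have hl := (ENNReal.ofReal_le_iff_le_toReal hfin).1 hlower
  have hQ : 0 ≤ ∫ p in Set.Ico a b ×ˢ Set.Ico a' b', c.quartTerm p :=
    integral_nonneg fun p => c.quartTerm_nonneg p
  have hM : -(2 * ((b - a) * (b' - a'))) ≤ ∫ p in Set.Ico a b ×ˢ Set.Ico a' b', c.mainTerm p :=
    (abs_le.1 (c.abs_setIntegral_mainTerm_le ha hab hb ha' hab' hb')).1
  have hu := ENNReal.toReal_le_of_le_ofReal (mul_nonneg (by positivity) (by linarith)) hupper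
  rw [abs_le]
  constructor <;> linarith

end UnitCurve

end Covariance

section CovarianceSum

open scoped RealInnerProductSpace ENNReal

namespace UnitCurve

variable {H : Type*} [NormedAddCommGroup H] [InnerProductSpace ℝ H] {L σ K : ℝ}
  (c : UnitCurve H L σ K) [MeasurableSpace H] [BorelSpace H]

lemma measurable_zeroCount_Ico (a b : ℝ) : Measurable (zeroCount c.φ (Set.Ico a b)) :=
  measurable_zeroCount c.continuous_φ (isSigmaCompact_Ico a b)

variable [FiniteDimensional ℝ H]

lemma mixedMoment_le_one (hdim : 2 ≤ Module.finrank ℝ H) {A a a' h : ℝ} (hA : 4 ≤ A)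
    (hKA : K ≤ A * σ ^ 2) (hh : 0 ≤ h) (hhA : 2 * A * σ * h ≤ 1)
    (ha : 0 ≤ a) (hb : a + h ≤ L) (ha' : 0 ≤ a') (hb' : a' + h ≤ L) :
    c.mixedMoment a (a + h) a' (a' + h) ≤ 1 := by
  have hσ := c.pos_σ
  have hs : 0 ≤ σ * h := by positivity
  have hK2 : K * h ≤ σ / 2 := by
    have h1 := mul_le_mul_of_nonneg_right hKA hh
    have h2 := mul_le_mul_of_nonneg_left hhA hσ.le
    linarith
  have hσh : σ * h ≤ 1 / 8 := by
    have := mul_le_mul_of_nonneg_right hA hs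
    linarith
  have hsq : ∀ x, 0 ≤ x → x + h ≤ L →
      ∫⁻ ξ, zeroCount c.φ (Set.Ico x (x + h)) ξ ^ 2 ∂stdGaussian H ≤ ENNReal.ofReal (1 / 2) := by
    intro x hx hx'
    refine (c.lintegral_zeroCount_sq_le hdim hx (by linarith) hx'
      (by rwa [add_sub_cancel_left])).trans (ENNReal.ofReal_le_ofReal ?_)
    rw [add_sub_cancel_left]
    have h1 : h * (σ / π) ≤ 1 / 8 := by
      rw [← mul_div_assoc, div_le_iff₀ pi_pos]
      linarith [pi_gt_three]
    have h2 : h ^ 2 * K ≤ 1 / 16 := by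
      have h3 := mul_le_mul_of_nonneg_left hK2 hh
      linarith
    linarith
  calc c.mixedMoment a (a + h) a' (a' + h)
      ≤ ∫⁻ ξ, (zeroCount c.φ (Set.Ico a (a + h)) ξ ^ 2
        + zeroCount c.φ (Set.Ico a' (a' + h)) ξ ^ 2) ∂stdGaussian H := by
        refine lintegral_mono fun ξ => ?_
        rcases le_total (zeroCount c.φ (Set.Ico a (a + h)) ξ)
          (zeroCount c.φ (Set.Ico a' (a' + h)) ξ) with hle | hle
        · refine le_trans ?_ le_add_self
          rw [sq]; exact mul_le_mul_left hle _
        · refine le_trans ?_ le_self_add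
          rw [sq]; exact mul_le_mul_right hle _
    _ = _ := lintegral_add_left ((c.measurable_zeroCount_Ico _ _).pow_const 2) _
    _ ≤ ENNReal.ofReal (1 / 2) + ENNReal.ofReal (1 / 2) :=
        add_le_add (hsq a ha hb) (hsq a' ha' hb')
    _ = 1 := by
        rw [← ENNReal.ofReal_add (by norm_num) (by norm_num)]; norm_num

lemma mixedMoment_expansion (hdim : 2 ≤ Module.finrank ℝ H) {A a a' h : ℝ} (hA : 4 ≤ A)
    (hKA : K ≤ A * σ ^ 2) (hh : 0 ≤ h) (hhA : 2 * A * σ * h ≤ 1) (hhA' : 1 ≤ 4 * A * σ * h)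
    (ha : 0 ≤ a) (hb : a + h ≤ L) (ha' : 0 ≤ a') (hb' : a' + h ≤ L) :
    c.mixedMoment a (a + h) a' (a' + h) ≠ ⊤ ∧
    |(c.mixedMoment a (a + h) a' (a' + h)).toReal - σ ^ 2 / π ^ 2 * (h * h
        + (∫ p in Set.Ico a (a + h) ×ˢ Set.Ico a' (a' + h), c.mainTerm p) / 2)|
      ≤ 16384 * A ^ 2 * (σ ^ 2 *
        ∫ p in Set.Ico a (a + h) ×ˢ Set.Ico a' (a' + h), c.quartTerm p) := by
  have hσ := c.pos_σ
  have hab : a ≤ a + h := by linarith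
  have hab' : a' ≤ a' + h := by linarith
  have hQ : 0 ≤ ∫ p in Set.Ico a (a + h) ×ˢ Set.Ico a' (a' + h), c.quartTerm p :=
    integral_nonneg fun p => c.quartTerm_nonneg p
  have hA2 : 4 ^ 2 ≤ A ^ 2 := by gcongr
  by_cases hreg : ∀ t ∈ Set.Ico a (a + h), ∀ s ∈ Set.Ico a' (a' + h), |c.corr (t, s)| ≤ 1 / 2
  · obtain ⟨h1, h2⟩ := c.mixedMoment_of_corr_le hdim ha hab hb ha' hab' hb' hreg
    rw [add_sub_cancel_left, add_sub_cancel_left] at h2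
    refine ⟨h1, h2.trans ?_⟩
    have hσ2 : σ ^ 2 / π ^ 2 ≤ σ ^ 2 := div_le_self (by positivity) (by
      have : (1 : ℝ) ≤ π := by linarith [pi_gt_three]
      exact one_le_pow₀ this)
    calc _ = 10000 * (σ ^ 2 / π ^ 2 * ∫ p in Set.Ico a (a + h) ×ˢ Set.Ico a' (a' + h),
            c.quartTerm p) := by ring
      _ ≤ _ := by
        refine mul_le_mul (by linarith) (mul_le_mul_of_nonneg_right hσ2 hQ) (by positivity)
          (by positivity)
  · push Not at hreg
    obtain ⟨t₀, ht₀, s₀, hs₀, hr₀⟩ := hreg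
    have hsub : ∀ t ∈ Set.Ico a (a + h), t ∈ Set.Icc 0 L :=
      fun t ht => ⟨ha.trans ht.1, ht.2.le.trans hb⟩
    have hsub' : ∀ t ∈ Set.Ico a' (a' + h), t ∈ Set.Icc 0 L :=
      fun t ht => ⟨ha'.trans ht.1, ht.2.le.trans hb'⟩
    have hs : 0 ≤ σ * h := by positivity
    have hσh : σ * h ≤ 1 / 8 := by
      have := mul_le_mul_of_nonneg_right hA hs
      linarith
    have hlow : ∀ p ∈ Set.Ico a (a + h) ×ˢ Set.Ico a' (a' + h), 1 / 256 ≤ c.quartTerm p := by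
      rintro ⟨t, s⟩ ⟨ht, hs⟩
      have h1 := c.abs_corr_sub_le (hsub t₀ ht₀) (hsub' s₀ hs₀) (hsub t ht) (hsub' s hs)
      have h2 : |t₀ - t| ≤ h := by
        rw [abs_le]; constructor <;> linarith [ht.1, ht.2, ht₀.1, ht₀.2]
      have h3 : |s₀ - s| ≤ h := by
        rw [abs_le]; constructor <;> linarith [hs.1, hs.2, hs₀.1, hs₀.2]
      have h4 := mul_le_mul_of_nonneg_left h2 hσ.le
      have h5 := mul_le_mul_of_nonneg_left h3 hσ.le
      have h6 := abs_sub_abs_le_abs_sub (c.corr (t₀, s₀)) (c.corr (t, s))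
      have h7 : 1 / 4 ≤ |c.corr (t, s)| := by linarith
      have h8 : (1 / 4) ^ 4 ≤ |c.corr (t, s)| ^ 4 := by gcongr
      rw [Even.pow_abs ⟨2, rfl⟩] at h8
      unfold quartTerm
      have h9 : 0 ≤ c.corrL (t, s) ^ 4 + c.corrR (t, s) ^ 4 + c.corrLR (t, s) ^ 4 := by positivity
      linarith
    have hQl : h * h / 256 ≤ ∫ p in Set.Ico a (a + h) ×ˢ Set.Ico a' (a' + h), c.quartTerm p := by
      have h1 := setIntegral_mono_on
        (continuous_const.integrableOn_Ico_prod a (a + h) a' (a' + h))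
        (c.continuous_quartTerm.integrableOn_Ico_prod a (a + h) a' (a' + h))
        (measurableSet_Ico.prod measurableSet_Ico) hlow
      rw [setIntegral_const, volume_real_Ico_prod hab hab', smul_eq_mul, add_sub_cancel_left,
        add_sub_cancel_left] at h1
      linarith
    have hM := c.abs_setIntegral_mainTerm_le ha hab hb ha' hab' hb'
    rw [add_sub_cancel_left, add_sub_cancel_left] at hM
    have he := c.mixedMoment_le_one hdim hA hKA hh hhA ha hb ha' hb'
    have he' : (c.mixedMoment a (a + h) a' (a' + h)).toReal ≤ 1 :=
      ENNReal.toReal_le_of_le_ofReal zero_le_one (by rwa [ENNReal.ofReal_one])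
    have he0 : 0 ≤ (c.mixedMoment a (a + h) a' (a' + h)).toReal := ENNReal.toReal_nonneg
    refine ⟨(he.trans_lt ENNReal.one_lt_top).ne, ?_⟩
    have hrhs : 4 ≤ 16384 * A ^ 2 * (σ ^ 2 *
        ∫ p in Set.Ico a (a + h) ×ˢ Set.Ico a' (a' + h), c.quartTerm p) := by
      have h1 : 1 ≤ (4 * A * σ * h) ^ 2 := one_le_pow₀ hhA'
      have h2 := mul_le_mul_of_nonneg_left hQl (by positivity : 0 ≤ 16384 * A ^ 2 * σ ^ 2)
      linarith
    have hmain : |σ ^ 2 / π ^ 2 * (h * h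
        + (∫ p in Set.Ico a (a + h) ×ˢ Set.Ico a' (a' + h), c.mainTerm p) / 2)| ≤ 1 := by
      rw [abs_mul, abs_of_nonneg (by positivity)]
      have h1 : |h * h + (∫ p in Set.Ico a (a + h) ×ˢ Set.Ico a' (a' + h), c.mainTerm p) / 2|
          ≤ 2 * (h * h) := by
        rw [abs_le] at hM ⊢
        have := mul_nonneg hh hh
        constructor <;> linarith [hM.1, hM.2]
      calc _ ≤ σ ^ 2 / π ^ 2 * (2 * (h * h)) := mul_le_mul_of_nonneg_left h1 (by positivity)
        _ = 2 * (σ * h) ^ 2 / π ^ 2 := by ring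
        _ ≤ 2 * (1 / 8) ^ 2 / 3 ^ 2 := by gcongr; exact pi_gt_three.le
        _ ≤ 1 := by norm_num
    rw [abs_le] at hmain ⊢
    constructor <;> linarith [hmain.1, hmain.2]

end UnitCurve

end CovarianceSum

section SecondMoment

open scoped RealInnerProductSpace ENNReal

lemma Ico_union_mul {h : ℝ} (hh : 0 ≤ h) (n : ℕ) :
    Set.Ico 0 ((n + 1 : ℕ) * h) = Set.Ico 0 (n * h) ∪ Set.Ico (n * h) (n * h + h) := by
  rw [Set.Ico_union_Ico_eq_Ico (by positivity) (by linarith)]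
  congr 1; push_cast; ring

lemma disjoint_Ico_mul (h : ℝ) (n : ℕ) :
    Disjoint (Set.Ico 0 (n * h)) (Set.Ico (n * h) (n * h + h)) :=
  Set.disjoint_left.2 fun _ hx hx' => absurd hx.2 (not_lt.2 hx'.1)

lemma zeroCount_Ico_eq_sum {H : Type*} [NormedAddCommGroup H] [InnerProductSpace ℝ H]
    {φ : ℝ → H} (hφ : Continuous φ) {h : ℝ} (hh : 0 ≤ h) (n : ℕ) (ξ : H) :
    zeroCount φ (Set.Ico 0 (n * h)) ξ
      = ∑ i ∈ Finset.range n, zeroCount φ (Set.Ico (i * h) (i * h + h)) ξ := by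
  induction n with
  | zero => simp [zeroCount]
  | succ n ih =>
    rw [Finset.sum_range_succ, ← ih, Ico_union_mul hh]
    unfold zeroCount
    have hcl : MeasurableSet {s | ⟪ξ, φ s⟫ = 0} :=
      (isClosed_eq (continuous_const.inner hφ) continuous_const).measurableSet
    rw [Set.union_inter_distrib_right, measure_union _ (measurableSet_Ico.inter hcl)]
    exact (disjoint_Ico_mul h n).mono Set.inter_subset_left Set.inter_subset_left

lemma setIntegral_Ico_prod_eq_sum {F : ℝ × ℝ → ℝ} (hF : Continuous F) {h : ℝ} (hh : 0 ≤ h)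
    (n m : ℕ) :
    ∫ p in Set.Ico 0 (n * h) ×ˢ Set.Ico 0 (m * h), F p
      = ∑ i ∈ Finset.range n, ∑ j ∈ Finset.range m,
        ∫ p in Set.Ico (i * h) (i * h + h) ×ˢ Set.Ico (j * h) (j * h + h), F p := by
  have hrow : ∀ a b, ∫ p in Set.Ico a b ×ˢ Set.Ico 0 (m * h), F p = ∑ j ∈ Finset.range m,
      ∫ p in Set.Ico a b ×ˢ Set.Ico (j * h) (j * h + h), F p := by
    intro a b
    induction m with
    | zero => simp
    | succ m ih =>
      rw [Finset.sum_range_succ, ← ih, Ico_union_mul hh, Set.prod_union,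
        setIntegral_union _ (measurableSet_Ico.prod measurableSet_Ico)
        (hF.integrableOn_Ico_prod _ _ _ _) (hF.integrableOn_Ico_prod _ _ _ _)]
      exact Set.Disjoint.set_prod_right (disjoint_Ico_mul h m) _ _
  induction n with
  | zero => simp
  | succ n ih =>
    rw [Finset.sum_range_succ, ← ih, ← hrow, Ico_union_mul hh, Set.union_prod,
      setIntegral_union _ (measurableSet_Ico.prod measurableSet_Ico)
      (hF.integrableOn_Ico_prod _ _ _ _) (hF.integrableOn_Ico_prod _ _ _ _)]
    exact Set.Disjoint.set_prod_left (disjoint_Ico_mul h n) _ _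

namespace UnitCurve

variable {H : Type*} [NormedAddCommGroup H] [InnerProductSpace ℝ H] {L σ K : ℝ}
  (c : UnitCurve H L σ K) [FiniteDimensional ℝ H] [MeasurableSpace H] [BorelSpace H]

lemma secondMoment_expansion (hdim : 2 ≤ Module.finrank ℝ H) {A : ℝ} (hA : 4 ≤ A)
    (hKA : K ≤ A * σ ^ 2) (hL : 1 ≤ 2 * A * σ * L) :
    ∫⁻ ξ, zeroCount c.φ (Set.Ico 0 L) ξ ^ 2 ∂stdGaussian H ≠ ⊤ ∧
    |(∫⁻ ξ, zeroCount c.φ (Set.Ico 0 L) ξ ^ 2 ∂stdGaussian H).toReal - (L * (σ / π)) ^ 2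
        - σ ^ 2 / (2 * π ^ 2) * ∫ p in Set.Ico 0 L ×ˢ Set.Ico 0 L, c.mainTerm p|
      ≤ 16384 * A ^ 2 * (σ ^ 2 * ∫ p in Set.Ico 0 L ×ˢ Set.Ico 0 L, c.quartTerm p) := by
  have hσ := c.pos_σ
  have hL0 := c.pos_L
  obtain ⟨M, hM⟩ : ∃ M, M = ⌈2 * A * σ * L⌉₊ := ⟨_, rfl⟩
  have hM1 : 2 * A * σ * L ≤ M := hM ▸ Nat.le_ceil _
  have hM2 : (M : ℝ) < 2 * A * σ * L + 1 := hM ▸ Nat.ceil_lt_add_one (by linarith)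
  have hM0 : (0 : ℝ) < M := by linarith
  obtain ⟨h, hh⟩ : ∃ h, h = L / M := ⟨_, rfl⟩
  have hMh : M * h = L := by rw [hh]; field_simp
  have hh0 : 0 < h := by rw [hh]; positivity
  have hhA : 2 * A * σ * h ≤ 1 := by
    rw [hh, ← mul_div_assoc, div_le_one hM0]; exact hM1
  have hhA' : 1 ≤ 4 * A * σ * h := by
    rw [hh, ← mul_div_assoc, one_le_div hM0]; linarith
  have hin : ∀ i ∈ Finset.range M, 0 ≤ i * h ∧ i * h + h ≤ L := by
    intro i hi
    have h1 : ((i + 1 : ℕ) : ℝ) ≤ M := Nat.cast_le.2 (Finset.mem_range.1 hi)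
    have h2 := mul_le_mul_of_nonneg_right h1 hh0.le
    push_cast at h2
    exact ⟨by positivity, by linarith⟩
  have hpair := fun i hi j hj => c.mixedMoment_expansion hdim hA hKA hh0.le hhA hhA'
    (hin i hi).1 (hin i hi).2 (hin j hj).1 (hin j hj).2
  have hsum : ∫⁻ ξ, zeroCount c.φ (Set.Ico 0 L) ξ ^ 2 ∂stdGaussian H
      = ∑ i ∈ Finset.range M, ∑ j ∈ Finset.range M,
        c.mixedMoment (i * h) (i * h + h) (j * h) (j * h + h) := by
    have hm := fun i : ℕ => c.measurable_zeroCount_Ico (i * h) (i * h + h)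
    unfold mixedMoment
    simp_rw [← hMh, zeroCount_Ico_eq_sum c.continuous_φ hh0.le M, sq, Finset.sum_mul_sum]
    refine (lintegral_finsetSum _ fun i _ => ?_).trans (Finset.sum_congr rfl fun i _ =>
      lintegral_finsetSum _ fun j _ => (hm i).mul (hm j))
    exact Finset.measurable_fun_sum _ fun j _ => (hm i).mul (hm j)
  have hfin : ∀ i ∈ Finset.range M, ∑ j ∈ Finset.range M,
      c.mixedMoment (i * h) (i * h + h) (j * h) (j * h + h) ≠ ⊤ := fun i hi =>
    ENNReal.sum_ne_top.2 fun j hj => (hpair i hi j hj).1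
  rw [hsum]
  refine ⟨ENNReal.sum_ne_top.2 hfin, ?_⟩
  have hmain := setIntegral_Ico_prod_eq_sum c.continuous_mainTerm hh0.le M M
  have hquart := setIntegral_Ico_prod_eq_sum c.continuous_quartTerm hh0.le M M
  rw [hMh] at hmain hquart
  have e : (L * (σ / π)) ^ 2 = ∑ i ∈ Finset.range M, ∑ j ∈ Finset.range M,
      σ ^ 2 / π ^ 2 * (h * h) := by
    simp only [Finset.sum_const, Finset.card_range, nsmul_eq_mul]
    rw [← hMh]; ring
  rw [ENNReal.toReal_sum hfin, hmain, hquart, e, Finset.mul_sum, Finset.mul_sum, Finset.mul_sum,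
    ← Finset.sum_sub_distrib, ← Finset.sum_sub_distrib]
  refine (Finset.abs_sum_le_sum_abs _ _).trans (Finset.sum_le_sum fun i hi => ?_)
  rw [ENNReal.toReal_sum fun j hj => (hpair i hi j hj).1, Finset.mul_sum, Finset.mul_sum,
    Finset.mul_sum, ← Finset.sum_sub_distrib, ← Finset.sum_sub_distrib]
  refine (Finset.abs_sum_le_sum_abs _ _).trans (Finset.sum_le_sum fun j hj => ?_)
  refine le_trans (le_of_eq ?_) (hpair i hi j hj).2
  congr 1
  field_simp
  ring

end UnitCurve

end SecondMoment

section WaveVector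

open scoped RealInnerProductSpace

/-- The Euclidean space of the coefficients of the wave. -/
abbrev CoeffSpace (m : ℕ) : Type := EuclideanSpace ℝ (↥(latticeSet m) ⊕ ↥(latticeSet m))

/-- The vector of `CoeffSpace m` with normalized coordinates `f` and `g`. -/
def coeffVec (m : ℕ) (f g : ℤ × ℤ → ℝ) : CoeffSpace m :=
  WithLp.toLp 2 (Sum.elim (fun μ => (√(latN m))⁻¹ * f μ) (fun μ => (√(latN m))⁻¹ * g μ))

lemma inner_coeffVec (m : ℕ) (f g f' g' : ℤ × ℤ → ℝ) :
    ⟪coeffVec m f g, coeffVec m f' g'⟫ =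
      (latN m : ℝ)⁻¹ * ∑ μ ∈ latticeSet m, (f μ * f' μ + g μ * g' μ) := by
  have h : (√(latN m : ℝ))⁻¹ * (√(latN m : ℝ))⁻¹ = (latN m : ℝ)⁻¹ := by
    rw [← mul_inv, Real.mul_self_sqrt (Nat.cast_nonneg _)]
  simp only [PiLp.inner_apply, coeffVec, Fintype.sum_sum_type, Sum.elim_inl, Sum.elim_inr,
    RCLike.inner_apply, conj_trivial, Finset.sum_add_distrib, mul_add, Finset.mul_sum]
  rw [← Finset.sum_coe_sort (latticeSet m), ← Finset.sum_coe_sort (latticeSet m)]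
  congr 1 <;> refine Finset.sum_congr rfl fun μ _ => ?_
  · linear_combination f μ * f' μ * h
  · linear_combination g μ * g' μ * h

lemma HasDerivAt.coeffVec {m : ℕ} {f g : ℤ × ℤ → ℝ → ℝ} {f' g' : ℤ × ℤ → ℝ} {t : ℝ}
    (hf : ∀ μ, HasDerivAt (f μ) (f' μ) t) (hg : ∀ μ, HasDerivAt (g μ) (g' μ) t) :
    HasDerivAt (fun t => coeffVec m (fun μ => f μ t) (fun μ => g μ t))
      (_root_.coeffVec m f' g') t := by
  have h : HasDerivAt (fun t => (Sum.elim (fun μ => (√(latN m))⁻¹ * f μ t)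
      (fun μ => (√(latN m))⁻¹ * g μ t) : ↥(latticeSet m) ⊕ ↥(latticeSet m) → ℝ))
      (Sum.elim (fun μ => (√(latN m))⁻¹ * f' μ) (fun μ => (√(latN m))⁻¹ * g' μ)) t := by
    refine hasDerivAt_pi.2 ?_
    rintro (μ | μ)
    · exact (hf μ).const_mul _
    · exact (hg μ).const_mul _
  exact (PiLp.hasFDerivAt_toLp (𝕜 := ℝ) 2 _).comp_hasDerivAt t h

end WaveVector

namespace PlaneArc

variable {L : ℝ} (P : PlaneArc L)

/-- The derivative of the phase. -/
def phase1 (v : ℤ × ℤ) (t : ℝ) : ℝ := 2 * π * (v.1 * P.x1 t + v.2 * P.y1 t)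

/-- The second derivative of the phase. -/
def phase2 (v : ℤ × ℤ) (t : ℝ) : ℝ := 2 * π * (v.1 * P.x2 t + v.2 * P.y2 t)

lemma hasDerivAt_phase (v : ℤ × ℤ) (t : ℝ) : HasDerivAt (P.phase v) (P.phase1 v t) t :=
  (((P.hx t).const_mul (v.1 : ℝ)).add ((P.hy t).const_mul (v.2 : ℝ))).const_mul (2 * π)

lemma hasDerivAt_phase1 (v : ℤ × ℤ) (t : ℝ) : HasDerivAt (P.phase1 v) (P.phase2 v t) t :=
  (((P.hx1 t).const_mul (v.1 : ℝ)).add ((P.hy1 t).const_mul (v.2 : ℝ))).const_mul (2 * π)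

lemma phase1_eq {m : ℕ} (hm : 0 < m) (μ : ℤ × ℤ) (t : ℝ) :
    P.phase1 μ t = √2 * P.tang m μ t * (√2 * π * √m) := by
  have hm' : √(m : ℝ) ≠ 0 := by positivity
  have h2 : √(2 : ℝ) * √2 = 2 := Real.mul_self_sqrt zero_le_two
  simp only [tang, phase1]
  field_simp
  linear_combination (-(P.x1 t * μ.1 + P.y1 t * μ.2)) * h2

lemma phase1_sq_le {m : ℕ} {μ : ℤ × ℤ} (hμ : μ ∈ latticeSet m) {t : ℝ} (ht : t ∈ Set.Icc 0 L) :
    P.phase1 μ t ^ 2 ≤ 4 * π ^ 2 * m := by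
  have h1 := lattice_real hμ
  have h2 := P.unit t ht
  have h : (μ.1 * P.x1 t + μ.2 * P.y1 t) ^ 2 ≤ m := by
    have e : ((μ.1 : ℝ) * P.x1 t + μ.2 * P.y1 t) ^ 2 =
        m - (μ.1 * P.y1 t - μ.2 * P.x1 t) ^ 2 := by
      linear_combination ((μ.1 : ℝ) ^ 2 + (μ.2 : ℝ) ^ 2) * h2 + h1
    rw [e]
    linarith [sq_nonneg ((μ.1 : ℝ) * P.y1 t - μ.2 * P.x1 t)]
  calc P.phase1 μ t ^ 2 = 4 * π ^ 2 * (μ.1 * P.x1 t + μ.2 * P.y1 t) ^ 2 := by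
        simp only [phase1]; ring
    _ ≤ _ := mul_le_mul_of_nonneg_left h (by positivity)

lemma phase2_sq_le {A : ℝ} {m : ℕ} {μ : ℤ × ℤ} (hμ : μ ∈ latticeSet m) {t : ℝ}
    (hA : P.x2 t ^ 2 + P.y2 t ^ 2 ≤ A ^ 2) :
    P.phase2 μ t ^ 2 ≤ 4 * π ^ 2 * (m * A ^ 2) := by
  have h1 := lattice_real hμ
  have h : (μ.1 * P.x2 t + μ.2 * P.y2 t) ^ 2 ≤ m * A ^ 2 := by
    have e : ((μ.1 : ℝ) * P.x2 t + μ.2 * P.y2 t) ^ 2 =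
        m * (P.x2 t ^ 2 + P.y2 t ^ 2) - (μ.1 * P.y2 t - μ.2 * P.x2 t) ^ 2 := by
      linear_combination (P.x2 t ^ 2 + P.y2 t ^ 2) * h1
    have h3 : (m : ℝ) * (P.x2 t ^ 2 + P.y2 t ^ 2) ≤ m * A ^ 2 :=
      mul_le_mul_of_nonneg_left hA (Nat.cast_nonneg _)
    rw [e]
    linarith [sq_nonneg ((μ.1 : ℝ) * P.y2 t - μ.2 * P.x2 t)]
  calc P.phase2 μ t ^ 2 = 4 * π ^ 2 * (μ.1 * P.x2 t + μ.2 * P.y2 t) ^ 2 := by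
        simp only [phase2]; ring
    _ ≤ _ := mul_le_mul_of_nonneg_left h (by positivity)

/-- The feature map of the arithmetic random wave restricted to the arc. -/
def waveVec (m : ℕ) (t : ℝ) : CoeffSpace m :=
  coeffVec m (fun μ => Real.cos (P.phase μ t)) (fun μ => Real.sin (P.phase μ t))

/-- The derivative of `waveVec`. -/
def waveVec1 (m : ℕ) (t : ℝ) : CoeffSpace m :=
  coeffVec m (fun μ => -Real.sin (P.phase μ t) * P.phase1 μ t)
    (fun μ => Real.cos (P.phase μ t) * P.phase1 μ t)

/-- The second derivative of `waveVec`. -/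
def waveVec2 (m : ℕ) (t : ℝ) : CoeffSpace m :=
  coeffVec m
    (fun μ => -(Real.cos (P.phase μ t) * P.phase1 μ t) * P.phase1 μ t +
      -Real.sin (P.phase μ t) * P.phase2 μ t)
    (fun μ => -Real.sin (P.phase μ t) * P.phase1 μ t * P.phase1 μ t +
      Real.cos (P.phase μ t) * P.phase2 μ t)

lemma hasDerivAt_waveVec (m : ℕ) (t : ℝ) : HasDerivAt (P.waveVec m) (P.waveVec1 m t) t :=
  HasDerivAt.coeffVec (f := fun μ t => Real.cos (P.phase μ t))
    (g := fun μ t => Real.sin (P.phase μ t)) (fun μ => (P.hasDerivAt_phase μ t).cos)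
    (fun μ => (P.hasDerivAt_phase μ t).sin)

lemma continuous_waveVec (m : ℕ) : Continuous (P.waveVec m) :=
  continuous_iff_continuousAt.2 fun t => (P.hasDerivAt_waveVec m t).continuousAt

lemma hasDerivAt_waveVec1 (m : ℕ) (t : ℝ) : HasDerivAt (P.waveVec1 m) (P.waveVec2 m t) t :=
  HasDerivAt.coeffVec (f := fun μ t => -Real.sin (P.phase μ t) * P.phase1 μ t)
    (g := fun μ t => Real.cos (P.phase μ t) * P.phase1 μ t)
    (fun μ => (P.hasDerivAt_phase μ t).sin.neg.mul (P.hasDerivAt_phase1 μ t))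
    (fun μ => (P.hasDerivAt_phase μ t).cos.mul (P.hasDerivAt_phase1 μ t))

lemma norm_waveVec {m : ℕ} (hN : 0 < latN m) (t : ℝ) : ‖P.waveVec m t‖ = 1 := by
  have hN' : (latN m : ℝ) ≠ 0 := by positivity
  have : ‖P.waveVec m t‖ ^ 2 = 1 := by
    rw [← real_inner_self_eq_norm_sq, waveVec, inner_coeffVec]
    simp_rw [← pow_two, Real.cos_sq_add_sin_sq]
    rw [Finset.sum_const, nsmul_one, ← latN, inv_mul_cancel₀ hN']
  exact (pow_eq_one_iff_of_nonneg (norm_nonneg _) two_ne_zero).1 this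

lemma norm_waveVec1 {m : ℕ} (hm : 0 < m) (hN : 0 < latN m) {t : ℝ} (ht : t ∈ Set.Icc 0 L) :
    ‖P.waveVec1 m t‖ = √2 * π * √m := by
  have hN' : (latN m : ℝ) ≠ 0 := by positivity
  rw [← sq_eq_sq₀ (norm_nonneg _) (by positivity), ← real_inner_self_eq_norm_sq, waveVec1,
    inner_coeffVec]
  have e : ∀ μ ∈ latticeSet m, -Real.sin (P.phase μ t) * P.phase1 μ t *
      (-Real.sin (P.phase μ t) * P.phase1 μ t) + Real.cos (P.phase μ t) * P.phase1 μ t *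
      (Real.cos (P.phase μ t) * P.phase1 μ t) = (√2 * π * √m) ^ 2 * (2 * P.tang m μ t ^ 2) := by
    intro μ _
    have h2 : √(2 : ℝ) ^ 2 = 2 := Real.sq_sqrt zero_le_two
    rw [P.phase1_eq hm]
    linear_combination (√2 * P.tang m μ t * (√2 * π * √m)) ^ 2 * Real.sin_sq_add_cos_sq (P.phase μ t)
      + (√2 * π * √m) ^ 2 * P.tang m μ t ^ 2 * h2
  rw [Finset.sum_congr rfl e, ← Finset.mul_sum, P.sum_tang_sq hm ht]
  field_simp

lemma norm_waveVec2_le {A : ℝ} (hA0 : 0 ≤ A) {m : ℕ} (hN : 0 < latN m) {t : ℝ}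
    (ht : t ∈ Set.Icc 0 L) (hA : P.x2 t ^ 2 + P.y2 t ^ 2 ≤ A ^ 2) (hm : 0 < m) :
    ‖P.waveVec2 m t‖ ≤ 4 * π ^ 2 * m * (1 + A) := by
  have hN' : (latN m : ℝ) ≠ 0 := by positivity
  refine le_of_sq_le_sq ?_ (by positivity)
  rw [← real_inner_self_eq_norm_sq, waveVec2, inner_coeffVec]
  have hm1 : (1 : ℝ) ≤ m := by exact_mod_cast hm
  have hπ : 1 ≤ 4 * π ^ 2 := by nlinarith [Real.pi_gt_three]
  have e : ∀ μ ∈ latticeSet m,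
      (-(Real.cos (P.phase μ t) * P.phase1 μ t) * P.phase1 μ t +
        -Real.sin (P.phase μ t) * P.phase2 μ t) *
      (-(Real.cos (P.phase μ t) * P.phase1 μ t) * P.phase1 μ t +
        -Real.sin (P.phase μ t) * P.phase2 μ t) +
      (-Real.sin (P.phase μ t) * P.phase1 μ t * P.phase1 μ t +
        Real.cos (P.phase μ t) * P.phase2 μ t) *
      (-Real.sin (P.phase μ t) * P.phase1 μ t * P.phase1 μ t +
        Real.cos (P.phase μ t) * P.phase2 μ t) ≤ (4 * π ^ 2 * m * (1 + A)) ^ 2 := by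
    intro μ hμ
    have h1 := P.phase1_sq_le hμ ht
    have h2 := P.phase2_sq_le hμ hA
    have h3 : (P.phase1 μ t ^ 2) ^ 2 ≤ (4 * π ^ 2 * m) ^ 2 := pow_le_pow_left₀ (sq_nonneg _) h1 2
    have h4 : 4 * π ^ 2 * (m * A ^ 2) ≤ (4 * π ^ 2 * m) ^ 2 * A ^ 2 := by
      have h5 : 4 * π ^ 2 * m * 1 ≤ 4 * π ^ 2 * m * (4 * π ^ 2 * m) :=
        mul_le_mul_of_nonneg_left (one_le_mul_of_one_le_of_one_le hπ hm1) (by positivity)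
      have h6 := mul_le_mul_of_nonneg_right h5 (sq_nonneg A)
      linarith
    have h7 : 0 ≤ (4 * π ^ 2 * m) ^ 2 * A := by positivity
    calc _ = (P.phase1 μ t ^ 2) ^ 2 + P.phase2 μ t ^ 2 := by
          linear_combination ((P.phase1 μ t ^ 2) ^ 2 + P.phase2 μ t ^ 2) *
            Real.sin_sq_add_cos_sq (P.phase μ t)
      _ ≤ _ := by linarith
  calc _ ≤ (latN m : ℝ)⁻¹ * ∑ μ ∈ latticeSet m, (4 * π ^ 2 * m * (1 + A)) ^ 2 :=
        mul_le_mul_of_nonneg_left (Finset.sum_le_sum e) (by positivity)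
    _ = _ := by
        rw [Finset.sum_const, nsmul_eq_mul, ← latN]
        field_simp

/-- The arithmetic random wave along the arc as a curve on the unit sphere. -/
def unitCurve {A : ℝ} (hA0 : 0 ≤ A) (hA : ∀ t ∈ Set.Icc 0 L, P.x2 t ^ 2 + P.y2 t ^ 2 ≤ A ^ 2)
    {m : ℕ} (hm : 0 < m) (hN : 0 < latN m) :
    UnitCurve (CoeffSpace m) L (√2 * π * √m) (4 * π ^ 2 * m * (1 + A)) where
  φ := P.waveVec m
  φ' := P.waveVec1 m
  φ'' := P.waveVec2 m
  hφ := P.hasDerivAt_waveVec m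
  hφ' := P.hasDerivAt_waveVec1 m
  norm_eq_one := P.norm_waveVec hN
  norm_deriv := fun _ ht => P.norm_waveVec1 hm hN ht
  norm_deriv2 := fun t ht => P.norm_waveVec2_le hA0 hN ht (hA t ht) hm
  pos_L := P.pos
  pos_σ := by positivity

variable {A : ℝ} (hA0 : 0 ≤ A) (hA : ∀ t ∈ Set.Icc 0 L, P.x2 t ^ 2 + P.y2 t ^ 2 ≤ A ^ 2)
  {m : ℕ} (hm : 0 < m) (hN : 0 < latN m)

lemma unitCurve_corr (p : ℝ × ℝ) : (P.unitCurve hA0 hA hm hN).corr p = P.rr m p.1 p.2 := by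
  simp only [UnitCurve.corr, unitCurve, waveVec, inner_coeffVec, rr, Real.cos_sub]

lemma unitCurve_corrL (p : ℝ × ℝ) : (P.unitCurve hA0 hA hm hN).corrL p = P.aa m p.1 p.2 := by
  have hσ : √2 * π * √(m : ℝ) ≠ 0 := by positivity
  simp only [UnitCurve.corrL, unitCurve, waveVec, waveVec1, inner_coeffVec, aa, Real.sin_sub]
  rw [div_eq_iff hσ, ← mul_neg, ← Finset.sum_neg_distrib, mul_assoc, Finset.sum_mul]
  congr 1
  refine Finset.sum_congr rfl fun μ _ => ?_
  rw [P.phase1_eq hm]; ring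

lemma unitCurve_corrR (p : ℝ × ℝ) : (P.unitCurve hA0 hA hm hN).corrR p = P.bb m p.1 p.2 := by
  have hσ : √2 * π * √(m : ℝ) ≠ 0 := by positivity
  simp only [UnitCurve.corrR, unitCurve, waveVec, waveVec1, inner_coeffVec, bb, Real.sin_sub]
  rw [div_eq_iff hσ, mul_assoc, Finset.sum_mul]
  congr 1
  refine Finset.sum_congr rfl fun μ _ => ?_
  rw [P.phase1_eq hm]; ring

lemma unitCurve_corrLR (p : ℝ × ℝ) : (P.unitCurve hA0 hA hm hN).corrLR p = P.cc m p.1 p.2 := by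
  have hσ : (√2 * π * √(m : ℝ)) ^ 2 ≠ 0 := by positivity
  have h2 : √(2 : ℝ) ^ 2 = 2 := Real.sq_sqrt zero_le_two
  simp only [UnitCurve.corrLR, unitCurve, waveVec1, inner_coeffVec, cc, Real.cos_sub]
  rw [div_eq_iff hσ, mul_assoc, Finset.sum_mul]
  congr 1
  refine Finset.sum_congr rfl fun μ _ => ?_
  rw [P.phase1_eq hm, P.phase1_eq hm]
  linear_combination (P.tang m μ p.1 * P.tang m μ p.2 * (√2 * π * √(m : ℝ)) ^ 2 *
    (Real.cos (P.phase μ p.1) * Real.cos (P.phase μ p.2) +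
      Real.sin (P.phase μ p.1) * Real.sin (P.phase μ p.2))) * h2

end PlaneArc

section Link

open scoped RealInnerProductSpace ENNReal

lemma variance_toReal {Ω : Type*} [MeasurableSpace Ω] {μ : Measure Ω} [IsProbabilityMeasure μ]
    {f : Ω → ℝ≥0∞} (hf : AEMeasurable f μ) (h2 : ∫⁻ ω, f ω ^ 2 ∂μ ≠ ⊤) :
    variance (fun ω => (f ω).toReal) μ =
      (∫⁻ ω, f ω ^ 2 ∂μ).toReal - (∫⁻ ω, f ω ∂μ).toReal ^ 2 := by
  have hfin : ∀ᵐ ω ∂μ, f ω ^ 2 < ⊤ := ae_lt_top' (hf.pow_const 2) h2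
  have hfin' : ∀ᵐ ω ∂μ, f ω < ⊤ := hfin.mono fun ω h => by
    rcases eq_or_ne (f ω) ⊤ with e | e
    · simp [e] at h
    · exact e.lt_top
  have hmem : MemLp (fun ω => (f ω).toReal) 2 μ := by
    rw [memLp_two_iff_integrable_sq hf.ennreal_toReal.aestronglyMeasurable]
    simp_rw [← ENNReal.toReal_pow]
    exact integrable_toReal_of_lintegral_ne_top (hf.pow_const 2) h2
  rw [variance_eq_sub hmem]
  rw [integral_toReal hf hfin', ← integral_toReal (hf.pow_const 2) hfin]
  simp only [Pi.pow_apply, ENNReal.toReal_pow]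

lemma Continuous.setIntegral_Ico_prod {F : ℝ × ℝ → ℝ} (hF : Continuous F) {a b : ℝ} (h : a ≤ b) :
    ∫ p in Set.Ico a b ×ˢ Set.Ico a b, F p = ∫ t in a..b, ∫ s in a..b, F (t, s) := by
  rw [Measure.volume_eq_prod, setIntegral_prod _ (hF.integrableOn_Ico_prod a b a b)]
  simp_rw [intervalIntegral.integral_of_le h, integral_Ico_eq_integral_Ioc]

/-- The pair of coefficient sequences as a vector. -/
def coeffs (m : ℕ) (ω : WaveSpace m) : CoeffSpace m := WithLp.toLp 2 (Sum.elim ω.1 ω.2)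

lemma measurePreserving_coeffs (m : ℕ) :
    MeasurePreserving (coeffs m) (waveMeasure m) (stdGaussian (CoeffSpace m)) := by
  have h1 := measurePreserving_sumPiEquivProdPi_symm
    (X := fun _ : ↥(latticeSet m) ⊕ ↥(latticeSet m) => ℝ) (fun _ => gaussianReal 0 1)
  have h2 : MeasurePreserving (WithLp.toLp 2)
      (Measure.pi fun _ : ↥(latticeSet m) ⊕ ↥(latticeSet m) => gaussianReal 0 1)
      (stdGaussian (CoeffSpace m)) := ⟨by fun_prop, map_pi_eq_stdGaussian⟩
  have h3 : coeffs m = WithLp.toLp 2 ∘ (MeasurableEquiv.sumPiEquivProdPi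
      (fun _ : ↥(latticeSet m) ⊕ ↥(latticeSet m) => ℝ)).symm := by
    funext ω
    refine congrArg (WithLp.toLp 2) (funext ?_)
    rintro (μ | μ) <;> rfl
  rw [h3]
  exact h2.comp h1

lemma PlaneArc.wave_eq_inner {L : ℝ} (P : PlaneArc L) (m : ℕ) (ω : WaveSpace m) (t : ℝ) :
    wave m ω (P.x t, P.y t) = ⟪coeffs m ω, P.waveVec m t⟫ := by
  simp only [wave, coeffs, waveVec, coeffVec, phase, PiLp.inner_apply, Fintype.sum_sum_type,
    Sum.elim_inl, Sum.elim_inr, RCLike.inner_apply, conj_trivial, Finset.mul_sum,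
    ← Finset.sum_add_distrib]
  exact Finset.sum_congr rfl fun μ _ => by ring

lemma PlaneArc.nodalCount_eq {L : ℝ} (P : PlaneArc L) {γ : ℝ → ℝ × ℝ}
    (hγ : ∀ t, γ t = (P.x t, P.y t)) (m : ℕ) (ω : WaveSpace m) :
    (nodalCount m γ L ω : ℝ) = (zeroCount (P.waveVec m) (Set.Icc 0 L) (coeffs m ω)).toReal := by
  have hset : {t : ℝ | t ∈ Set.Icc 0 L ∧ wave m ω (γ t) = 0} =
      Set.Icc 0 L ∩ {s | ⟪coeffs m ω, P.waveVec m s⟫ = 0} := by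
    ext t
    simp only [hγ, P.wave_eq_inner]
    rfl
  have hmeas : MeasurableSet (Set.Icc 0 L ∩ {s | ⟪coeffs m ω, P.waveVec m s⟫ = 0}) := by
    exact measurableSet_Icc.inter
      (isClosed_eq (continuous_const.inner (P.continuous_waveVec m)) continuous_const).measurableSet
  rw [nodalCount, hset, zeroCount, Measure.count_apply hmeas, Set.ncard]
  generalize Set.encard _ = e
  induction e <;> simp

lemma UnitCurve.zeroCount_Icc_ae {H : Type*} [NormedAddCommGroup H] [InnerProductSpace ℝ H]
    [FiniteDimensional ℝ H] [MeasurableSpace H] [BorelSpace H] {L σ K : ℝ} (c : UnitCurve H L σ K)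
    (hdim : 2 ≤ Module.finrank ℝ H) :
    zeroCount c.φ (Set.Icc 0 L) =ᵐ[stdGaussian H] zeroCount c.φ (Set.Ico 0 L) := by
  have hJ : IsSigmaCompact {L} := isCompact_singleton.isSigmaCompact
  have h0 : ∫⁻ ξ, zeroCount c.φ {L} ξ ∂stdGaussian H = 0 := by
    rw [lintegral_zeroCount hdim c.hφ c.continuous_φ' c.norm_eq_one hJ]
    simp
  rw [lintegral_eq_zero_iff (measurable_zeroCount c.continuous_φ hJ)] at h0
  filter_upwards [h0] with ξ hξ
  refine le_antisymm ?_ (measure_mono (Set.inter_subset_inter_left _ Set.Ico_subset_Icc_self))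
  rw [← Set.Ico_union_right c.pos_L.le]
  calc zeroCount c.φ (Set.Ico 0 L ∪ {L}) ξ
      ≤ zeroCount c.φ (Set.Ico 0 L) ξ + zeroCount c.φ {L} ξ := by
        unfold zeroCount
        rw [Set.union_inter_distrib_right]
        exact measure_union_le _ _
    _ = _ := by rw [hξ, Pi.zero_apply, add_zero]

lemma UnitCurve.variance_zeroCount {H : Type*} [NormedAddCommGroup H] [InnerProductSpace ℝ H]
    [FiniteDimensional ℝ H] [MeasurableSpace H] [BorelSpace H] {L σ K : ℝ} (c : UnitCurve H L σ K)
    (hdim : 2 ≤ Module.finrank ℝ H) {A : ℝ} (hA : 4 ≤ A)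
    (hKA : K ≤ A * σ ^ 2) (hL : 1 ≤ 2 * A * σ * L) :
    |variance (fun ξ => (zeroCount c.φ (Set.Icc 0 L) ξ).toReal) (stdGaussian H)
        - σ ^ 2 / (2 * π ^ 2) * ∫ p in Set.Ico 0 L ×ˢ Set.Ico 0 L, c.mainTerm p|
      ≤ 16384 * A ^ 2 * (σ ^ 2 * ∫ p in Set.Ico 0 L ×ˢ Set.Ico 0 L, c.quartTerm p) := by
  obtain ⟨hfin, hexp⟩ := c.secondMoment_expansion hdim hA hKA hL
  have hL0 := c.pos_L
  have hσ := c.pos_σ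
  have hae : (fun ξ => (zeroCount c.φ (Set.Icc 0 L) ξ).toReal) =ᵐ[stdGaussian H]
      fun ξ => (zeroCount c.φ (Set.Ico 0 L) ξ).toReal :=
    (c.zeroCount_Icc_ae hdim).mono fun ξ h => congrArg ENNReal.toReal h
  rwa [variance_congr hae, variance_toReal (c.measurable_zeroCount_Ico 0 L).aemeasurable hfin,
    c.lintegral_zeroCount_Ico hdim le_rfl le_rfl, ENNReal.toReal_ofReal (by
      rw [sub_zero]; positivity), sub_zero]

end Link

namespace PlaneArc

variable {L : ℝ} (P : PlaneArc L)

lemma variance_nodalCount {γ : ℝ → ℝ × ℝ} (hγ : ∀ t, γ t = (P.x t, P.y t)) (m : ℕ) :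
    variance (fun ω => (nodalCount m γ L ω : ℝ)) (waveMeasure m) =
      variance (fun ξ => (zeroCount (P.waveVec m) (Set.Icc 0 L) ξ).toReal)
        (stdGaussian (CoeffSpace m)) := by
  rw [← (measurePreserving_coeffs m).variance_fun_comp
    (measurable_zeroCount (P.continuous_waveVec m) isCompact_Icc.isSigmaCompact).ennreal_toReal.aemeasurable]
  exact congrArg (variance · _) (funext (P.nodalCount_eq hγ m))

lemma exists_variance_bound {γ : ℝ → ℝ × ℝ} (hγ : ∀ t, γ t = (P.x t, P.y t)) :
    ∃ C > 0, ∀ m : ℕ, 0 < m → 0 < latN m →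
    |variance (fun ω => (nodalCount m γ L ω : ℝ)) (waveMeasure m)
        - m * ∫ t in (0:ℝ)..L, ∫ s in (0:ℝ)..L,
          (P.rr m t s ^ 2 - P.aa m t s ^ 2 - P.bb m t s ^ 2 + P.cc m t s ^ 2)|
      ≤ C * (m * ∫ t in (0:ℝ)..L, ∫ s in (0:ℝ)..L,
          (P.rr m t s ^ 4 + P.aa m t s ^ 4 + P.bb m t s ^ 4 + P.cc m t s ^ 4)) := by
  obtain ⟨A, hA1, κ, -, -, hb⟩ := P.exists_bounds
  have hL := P.pos
  have hA0 : 0 ≤ A := by linarith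
  obtain ⟨B, hB⟩ : ∃ B, B = 2 * (1 + A) + 1 / L := ⟨_, rfl⟩
  have hLinv : 0 < 1 / L := by positivity
  have hB4 : 4 ≤ B := by linarith
  refine ⟨16384 * B ^ 2 * (2 * π ^ 2), by positivity, fun m hm hN => ?_⟩
  have hm0 : (0 : ℝ) < m := by exact_mod_cast hm
  have hm1 : (1 : ℝ) ≤ m := by exact_mod_cast hm
  have hA : ∀ t ∈ Set.Icc 0 L, P.x2 t ^ 2 + P.y2 t ^ 2 ≤ A ^ 2 := fun t ht => (hb t ht).1
  have hσ2 : (√2 * π * √(m : ℝ)) ^ 2 = 2 * π ^ 2 * m := by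
    rw [mul_pow, mul_pow, Real.sq_sqrt zero_le_two, Real.sq_sqrt hm0.le]
  have hσ1 : 1 ≤ √2 * π * √(m : ℝ) := by
    refine one_le_mul_of_one_le_of_one_le (one_le_mul_of_one_le_of_one_le ?_ ?_) ?_
    · rw [Real.one_le_sqrt]; norm_num
    · linarith [Real.pi_gt_three]
    · rwa [Real.one_le_sqrt]
  have hdim : 2 ≤ Module.finrank ℝ (CoeffSpace m) := by
    rw [finrank_euclideanSpace, Fintype.card_sum, Fintype.card_coe, ← latN]
    omega
  have hK : 4 * π ^ 2 * m * (1 + A) ≤ B * (√2 * π * √(m : ℝ)) ^ 2 := by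
    rw [hσ2, hB]
    have : 0 ≤ 1 / L * (2 * π ^ 2 * m) := by positivity
    linarith
  have hBL : 1 ≤ 2 * B * (√2 * π * √(m : ℝ)) * L := by
    have h1 : 1 ≤ 2 * B * L := by
      have h2 : 1 / L * L = 1 := by field_simp
      have h3 : 0 ≤ (1 + A) * L := by positivity
      rw [hB]; linarith
    have := one_le_mul_of_one_le_of_one_le h1 hσ1
    linarith
  have hF := (P.unitCurve hA0 hA hm hN).variance_zeroCount hdim hB4 hK hBL
  rw [(P.unitCurve hA0 hA hm hN).continuous_mainTerm.setIntegral_Ico_prod hL.le,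
    (P.unitCurve hA0 hA hm hN).continuous_quartTerm.setIntegral_Ico_prod hL.le] at hF
  simp only [UnitCurve.mainTerm, UnitCurve.quartTerm, unitCurve_corr, unitCurve_corrL,
    unitCurve_corrR, unitCurve_corrLR, hσ2] at hF
  have hπ : 2 * π ^ 2 * m / (2 * π ^ 2) = (m : ℝ) := by field_simp
  rw [hπ] at hF
  rw [P.variance_nodalCount hγ]
  refine hF.trans_eq ?_
  ring

lemma exists_variance_asymptotics {γ : ℝ → ℝ × ℝ} (hγ : ∀ t, γ t = (P.x t, P.y t))
    (hγ' : ∀ t, deriv γ t = (P.x1 t, P.y1 t)) :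
    ∃ C > 0, ∀ m : ℕ, 0 < m → 0 < latN m →
    |variance (fun ω => (nodalCount m γ L ω : ℝ)) (waveMeasure m)
        - (4 * Bconst m γ L - L ^ 2) * m / latN m| ≤ C * m / (latN m : ℝ) ^ ((3 : ℝ) / 2) := by
  obtain ⟨C₁, hC₁, h1⟩ := P.exists_variance_bound hγ
  obtain ⟨C₂, hC₂, h2⟩ := P.exists_moments hγ'
  refine ⟨(1 + C₁) * C₂, by positivity, fun m hm hN => ?_⟩
  have hN0 : (0 : ℝ) < latN m := by exact_mod_cast hN
  have hm0 : (0 : ℝ) ≤ m := Nat.cast_nonneg m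
  have h3 := h1 m hm hN
  obtain ⟨h4, h5⟩ := h2 m hm hN
  generalize (∫ t in (0:ℝ)..L, ∫ s in (0:ℝ)..L,
    (P.rr m t s ^ 2 - P.aa m t s ^ 2 - P.bb m t s ^ 2 + P.cc m t s ^ 2)) = I at h3 h4
  generalize (∫ t in (0:ℝ)..L, ∫ s in (0:ℝ)..L,
    (P.rr m t s ^ 4 + P.aa m t s ^ 4 + P.bb m t s ^ 4 + P.cc m t s ^ 4)) = Q at h3 h5
  generalize variance (fun ω => (nodalCount m γ L ω : ℝ)) (waveMeasure m) = V at h3 ⊢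
  have hpow : (latN m : ℝ) ^ ((3 : ℝ) / 2) = latN m * √(latN m) := by
    rw [Real.sqrt_eq_rpow, show (3 : ℝ) / 2 = 1 + 1 / 2 by norm_num, Real.rpow_add hN0,
      Real.rpow_one]
  rw [hpow]
  have h6 := mul_le_mul_of_nonneg_left h4 hm0
  rw [← abs_of_nonneg hm0, ← abs_mul, abs_of_nonneg hm0] at h6
  have h7 := mul_le_mul_of_nonneg_left (mul_le_mul_of_nonneg_left h5 hm0) hC₁.le
  calc |V - (4 * Bconst m γ L - L ^ 2) * m / latN m|
      = |(V - m * I) + m * (I - (4 * Bconst m γ L - L ^ 2) / latN m)| := by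
        congr 1; ring
    _ ≤ |V - m * I| + |m * (I - (4 * Bconst m γ L - L ^ 2) / latN m)| := abs_add_le _ _
    _ ≤ C₁ * (m * (C₂ / (latN m * √(latN m)))) + m * (C₂ / (latN m * √(latN m))) :=
        add_le_add (h3.trans h7) h6
    _ = _ := by ring

end PlaneArc

/-- Asymptotics of the nodal intersections variance:
`Var(Z) = (4 B_𝒞(E) − L²)·m/N + O(m/N^{3/2})` whenever `|τ̂_m(4)| ≤ 1 − ε₀`. -/
theorem nodal_intersections_variance_asymptotics
    (L : ℝ) (hL : 0 < L) (γ : ℝ → ℝ × ℝ) (hγ : ContDiff ℝ (⊤ : ℕ∞) γ)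
    (hunit : ∀ t ∈ Set.Icc (0:ℝ) L, (deriv γ t).1 ^ 2 + (deriv γ t).2 ^ 2 = 1)
    (hcurv : ∀ t ∈ Set.Icc (0:ℝ) L, deriv (deriv γ) t ≠ 0) :
    ∀ ε₀ ∈ Set.Ioo (0:ℝ) 1, ∃ C > 0, ∀ m : ℕ, 0 < m →
      (∃ a b : ℤ, a ^ 2 + b ^ 2 = (m : ℤ)) →
      |tauHat4 m| ≤ 1 - ε₀ →
      |variance (fun ω => (nodalCount m γ L ω : ℝ)) (waveMeasure m)
          - (4 * Bconst m γ L - L ^ 2) * m / latN m|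
        ≤ C * m / (latN m : ℝ) ^ ((3:ℝ)/2) := by
  obtain ⟨C, hC, h⟩ := (PlaneArc.ofContDiff hL γ hγ hunit hcurv).exists_variance_asymptotics
    (γ := γ) (fun _ => rfl) (fun _ => rfl)
  refine fun _ _ => ⟨C, hC, fun m hm ⟨a, b, hab⟩ _ => h m hm ?_⟩
  exact Finset.card_pos.2 ⟨(a, b), mem_latticeSet.2 hab⟩

end
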